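/- Let {γ_k} ⊂ (0,1) with γ_k → 1, and set a_k = 1 − 2γ_k and d_k = 2^{2γ_k−1} Γ(γ_k)/Γ(1−γ_k). For each k let u_k : ℝ × [0,∞) → ℝ be a bounded continuous function, twice continuously differentiable on ℝ × (0,∞), with |u_k| < 1, H_{a_k} u_k = 0 on ℝ × (0,∞), such that ∂_t u_k extends continuously to ℝ × [0,∞), lim_{y→0⁺} y^{a_k} ∂_y u_k(t,y) = −(1/d_k) f(u_k(t,0)) for every t, ∂_t u_k(t,0) > 0 for every t, u_k(t,0) → ±1 as t → ±∞, and u_k(0,0) = 0. Then the functions w_k(t) := u_k(t,0) converge, in C² uniformly on every compact subset of ℝ, to the unique bounded C² function w̄ : ℝ → ℝ satisfying −w̄″(t) − (n−1) tanh(t) w̄′(t) = f(w̄(t)) for all t, w̄(0) = 0, w̄′ > 0, and w̄(t) → ±1 as t → ±∞. -/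

import Mathlib

open Real Filter MeasureTheory Set Topology

noncomputable def pt (u : ℝ → ℝ → ℝ) (t y : ℝ) : ℝ := deriv (fun s => u s y) t
noncomputable def py (u : ℝ → ℝ → ℝ) (t y : ℝ) : ℝ := deriv (fun z => u t z) y
noncomputable def ptt (u : ℝ → ℝ → ℝ) (t y : ℝ) : ℝ := deriv (fun s => pt u s y) t
noncomputable def pyy (u : ℝ → ℝ → ℝ) (t y : ℝ) : ℝ := deriv (fun z => py u t z) y
noncomputable def pty (u : ℝ → ℝ → ℝ) (t y : ℝ) : ℝ := deriv (fun z => pt u t z) y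

/-- The degenerate elliptic operator `H_a u = u_yy + (a/y) u_y + u_tt + (n-1) tanh t · u_t`. -/
noncomputable def Ha (n : ℕ) (a : ℝ) (u : ℝ → ℝ → ℝ) (t y : ℝ) : ℝ :=
  pyy u t y + (a / y) * py u t y + ptt u t y + ((n : ℝ) - 1) * Real.tanh t * pt u t y

/-- A classical solution of the boundary reaction problem: a bounded continuous function on
`ℝ × [0,∞)`, `C²` on `ℝ × (0,∞)`, with `H_a u = 0` there, `∂_t u` extending continuously to
`ℝ × [0,∞)`, and for every `t` the limit `lim_{y→0⁺} y^a ∂_y u(t,y)` exists and equals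
`-f(u(t,0)) = F'(u(t,0))`, where `f = -F'`. -/
structure BRSolution (n : ℕ) (a : ℝ) (F : ℝ → ℝ) (u : ℝ → ℝ → ℝ) : Prop where
  bounded : ∃ M : ℝ, ∀ t y : ℝ, 0 ≤ y → |u t y| ≤ M
  cont : ContinuousOn (fun p : ℝ × ℝ => u p.1 p.2) {p : ℝ × ℝ | 0 ≤ p.2}
  smooth : ContDiffOn ℝ 2 (fun p : ℝ × ℝ => u p.1 p.2) {p : ℝ × ℝ | 0 < p.2}
  eqn : ∀ t y : ℝ, 0 < y → Ha n a u t y = 0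
  pt_cont : ContinuousOn (fun p : ℝ × ℝ => pt u p.1 p.2) {p : ℝ × ℝ | 0 ≤ p.2}
  bc : ∀ t : ℝ, Tendsto (fun y : ℝ => y ^ a * py u t y) (𝓝[>] (0:ℝ))
        (𝓝 (deriv F (u t 0)))

/-- `F` is a smooth double-well potential: `F(±1) = 0`, `F > 0` on `(-1,1)`,
`F'(±1) = 0`, `F''(±1) > 0`. -/
def DoubleWell (F : ℝ → ℝ) : Prop :=
  ContDiff ℝ (⊤ : ℕ∞) F ∧ F (-1) = 0 ∧ F 1 = 0 ∧ (∀ s ∈ Set.Ioo (-1:ℝ) 1, 0 < F s) ∧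
    deriv F (-1) = 0 ∧ deriv F 1 = 0 ∧
    0 < iteratedDeriv 2 F (-1) ∧ 0 < iteratedDeriv 2 F 1

/-- The normalizing constant `d_γ = 2^{2γ-1} Γ(γ)/Γ(1-γ)` of the extension problem. -/
noncomputable def dgamma (γ : ℝ) : ℝ :=
  2 ^ (2 * γ - 1) * Real.Gamma γ / Real.Gamma (1 - γ)

/-- Second-order necessary condition at a local maximum. -/
lemma IsLocalMax.second_deriv_nonpos {f f' : ℝ → ℝ} {c x : ℝ} (h : IsLocalMax f x)
    (hf : ∀ᶠ r in 𝓝 x, HasDerivAt f (f' r) r) (hf' : HasDerivAt f' c x) : c ≤ 0 := by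
  by_contra! hc
  have e1 : deriv f =ᶠ[𝓝 x] f' := hf.mono fun r hr => hr.deriv
  have e2 : deriv (deriv f) x = c := by rw [e1.deriv_eq, hf'.deriv]
  have hmin : IsLocalMin f x :=
    isLocalMin_of_deriv_deriv_pos (by rw [e2]; exact hc) h.deriv_eq_zero
      hf.self_of_nhds.continuousAt
  have e3 : f =ᶠ[𝓝 x] fun _ => f x := by
    filter_upwards [h, hmin] with r h1 h2 using le_antisymm h1 h2
  have e4 : deriv f =ᶠ[𝓝 x] fun _ => 0 := by
    refine e3.deriv.trans ?_
    simp [Filter.EventuallyEq.refl]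
  have e5 : deriv (deriv f) x = 0 := by rw [e4.deriv_eq]; simp
  linarith

lemma hasDerivAt_max_sq (x : ℝ) :
    HasDerivAt (fun x : ℝ => (max x 0) ^ 2) (2 * max x 0) x := by
  rcases lt_trichotomy x 0 with h | h | h
  · have : (fun x : ℝ => (max x 0) ^ 2) =ᶠ[𝓝 x] fun _ => 0 := by
      filter_upwards [Iio_mem_nhds h] with z hz
      simp [max_eq_right (le_of_lt (show z < 0 from hz))]
    rw [max_eq_right h.le, mul_zero]
    exact (hasDerivAt_const x (0 : ℝ)).congr_of_eventuallyEq this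
  · subst h
    rw [max_self, mul_zero, hasDerivAt_iff_isLittleO]
    have : (fun x : ℝ => x ^ 2) =o[𝓝 0] fun x : ℝ => x := by
      simpa using Asymptotics.isLittleO_pow_pow (𝕜 := ℝ) (m := 1) (n := 2) (by norm_num)
    refine (Asymptotics.IsBigO.trans_isLittleO ?_ this).congr_right (by simp)
    refine Asymptotics.IsBigO.of_bound 1 (Eventually.of_forall fun z => ?_)
    rcases le_total z 0 with hz | hz <;> simp [hz]; positivity
  · have : (fun x : ℝ => (max x 0) ^ 2) =ᶠ[𝓝 x] fun x => x ^ 2 := by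
      filter_upwards [Ioi_mem_nhds h] with z hz
      simp [max_eq_left (le_of_lt (show 0 < z from hz))]
    rw [max_eq_left h.le]
    simpa using (hasDerivAt_pow 2 x).congr_of_eventuallyEq this

/-- The derivative of the bottom profile used to absorb the conormal derivative. -/
noncomputable def profileDeriv (β y : ℝ) : ℝ := y ^ (1 - β) * (max (1 - y ^ β) 0) ^ 2 / β

lemma profileDeriv_nonneg {β y : ℝ} (hβ : 0 < β) (hy : 0 ≤ y) : 0 ≤ profileDeriv β y := by
  unfold profileDeriv; positivity

lemma profileDeriv_le {β y : ℝ} (hβ : 0 < β) (hβ2 : β ≤ 1 / 2) (hy : 0 < y) (hy1 : y ≤ 1) :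
    profileDeriv β y ≤ 16 * β := by
  have h1 : 1 - y ^ β ≤ β * (4 * y ^ (-(1 / 4) : ℝ)) := by
    have e1 : 1 + β * log y ≤ y ^ β := by
      rw [rpow_def_of_pos hy, mul_comm (log y)]; linarith [add_one_le_exp (β * log y)]
    have e2 : -log y ≤ 4 * y ^ (-(1 / 4) : ℝ) := by
      have := Real.log_le_rpow_div (inv_nonneg.2 hy.le) (show (0 : ℝ) < 1 / 4 by norm_num)
      rw [log_inv, inv_rpow hy.le, ← rpow_neg hy.le] at this
      linarith
    nlinarith
  have h2 : 0 ≤ max (1 - y ^ β) 0 := le_max_right _ _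
  have h3 : max (1 - y ^ β) 0 ≤ β * (4 * y ^ (-(1 / 4) : ℝ)) := max_le h1 (by positivity)
  have h4 : (max (1 - y ^ β) 0) ^ 2 ≤ 16 * β ^ 2 * y ^ (-(1 / 2) : ℝ) := by
    calc _ ≤ (β * (4 * y ^ (-(1 / 4) : ℝ))) ^ 2 := by gcongr
      _ = 16 * β ^ 2 * (y ^ (-(1 / 4) : ℝ) * y ^ (-(1 / 4) : ℝ)) := by ring
      _ = _ := by rw [← rpow_add hy]; norm_num
  unfold profileDeriv
  rw [div_le_iff₀ hβ]
  calc _ ≤ y ^ (1 - β) * (16 * β ^ 2 * y ^ (-(1 / 2) : ℝ)) := by gcongr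
    _ = 16 * β ^ 2 * (y ^ (1 - β) * y ^ (-(1 / 2) : ℝ)) := by ring
    _ = 16 * β ^ 2 * y ^ (1 / 2 - β) := by rw [← rpow_add hy]; ring_nf
    _ ≤ 16 * β ^ 2 * 1 := by gcongr; exact rpow_le_one hy.le hy1 (by linarith)
    _ = _ := by ring

lemma profileDeriv_eq_zero {β y : ℝ} (hβ : 0 < β) (hy1 : 1 ≤ y) : profileDeriv β y = 0 := by
  unfold profileDeriv
  rw [max_eq_right (by linarith [one_le_rpow hy1 hβ.le])]; simp

lemma continuous_profileDeriv {β : ℝ} (hβ : 0 < β) (hβ2 : β ≤ 1 / 2) :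
    Continuous (profileDeriv β) := by
  unfold profileDeriv
  have h1 := continuous_rpow_const (q := 1 - β) (by linarith)
  have h2 := continuous_rpow_const (q := β) hβ.le
  fun_prop

lemma hasDerivAt_profileDeriv {β y : ℝ} (hβ : 0 < β) (hy : 0 < y) :
    HasDerivAt (profileDeriv β)
      ((1 - β) / y * profileDeriv β y - 2 * max (1 - y ^ β) 0) y := by
  have h1 := hasDerivAt_rpow_const (x := y) (p := 1 - β) (Or.inl hy.ne')
  have h2 := (hasDerivAt_rpow_const (x := y) (p := β) (Or.inl hy.ne')).const_sub 1
  have h3 := (hasDerivAt_max_sq (1 - y ^ β)).comp y h2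
  have h4 := (h1.mul h3).div_const β
  refine h4.congr_deriv ?_
  unfold profileDeriv
  have e1 : y ^ (1 - β - 1) = y ^ (1 - β) / y := by
    rw [rpow_sub hy (1 - β) 1, rpow_one]
  have e2 : y ^ (1 - β) * y ^ (β - 1) = 1 := by
    rw [← rpow_add hy]; simp
  simp only [Function.comp]
  rw [e1]
  field_simp
  linear_combination (-2 * max (1 - y ^ β) 0 * y * β) * e2

/-- A multiplier close to one whose conormal derivative at `y = 0` is `-Λ/β`. -/
lemma exists_multiplier {β Λ : ℝ} (hβ : 0 < β) (hβ2 : β ≤ 1 / 2) (hΛ : 0 ≤ Λ)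
    (h : 32 * Λ * β ≤ 1) : ∃ m m1 m2 : ℝ → ℝ, Continuous m ∧ m 0 = 1 ∧
      (∀ y, 0 ≤ y → 1 / 2 ≤ m y ∧ m y ≤ 1) ∧
      (∀ y, 0 < y → HasDerivAt m (m1 y) y ∧ HasDerivAt m1 (m2 y) y ∧ m1 y ≤ 0 ∧
        m2 y + ((β - 1) / y) * m1 y ≤ 2 * Λ) ∧
      Tendsto (fun y => y ^ (β - 1) * m1 y) (𝓝[>] 0) (𝓝 (-(Λ / β))) := by
  have hc := continuous_profileDeriv hβ hβ2
  have hd : ∀ y, HasDerivAt (fun y => ∫ s in (0:ℝ)..y, profileDeriv β s) (profileDeriv β y) y :=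
    fun y => (hc.integral_hasStrictDerivAt 0 y).hasDerivAt
  refine ⟨fun y => 1 - Λ * ∫ s in (0:ℝ)..y, profileDeriv β s, fun y => -(Λ * profileDeriv β y),
    fun y => -(Λ * ((1 - β) / y * profileDeriv β y - 2 * max (1 - y ^ β) 0)), ?_, ?_, ?_, ?_, ?_⟩
  · exact continuous_const.sub (continuous_const.mul
      (continuous_iff_continuousAt.2 fun y => (hd y).continuousAt))
  · simp
  · intro y hy
    have h0 : 0 ≤ ∫ s in (0:ℝ)..y, profileDeriv β s :=
      intervalIntegral.integral_nonneg hy fun s hs => profileDeriv_nonneg hβ hs.1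
    have h1 : ∀ y, 0 ≤ y → y ≤ 1 → ∫ s in (0:ℝ)..y, profileDeriv β s ≤ 16 * β := by
      intro y hy hy1
      have := intervalIntegral.norm_integral_le_of_norm_le_const (a := 0) (b := y) (C := 16 * β)
        (f := profileDeriv β) (fun s hs => by
          rw [uIoc_of_le hy] at hs
          rw [norm_of_nonneg (profileDeriv_nonneg hβ hs.1.le)]
          exact profileDeriv_le hβ hβ2 hs.1 (hs.2.trans hy1))
      have h2 := le_of_abs_le this
      rw [sub_zero, abs_of_nonneg hy] at h2
      nlinarith
    have h2 : ∫ s in (0:ℝ)..y, profileDeriv β s ≤ 16 * β := by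
      rcases le_total y 1 with hy1 | hy1
      · exact h1 y hy hy1
      · rw [← intervalIntegral.integral_add_adjacent_intervals
          (hc.intervalIntegrable 0 1) (hc.intervalIntegrable 1 y)]
        have : ∫ s in (1:ℝ)..y, profileDeriv β s = 0 := by
          rw [intervalIntegral.integral_congr (g := fun _ => 0)]
          · simp
          · intro s hs
            rw [uIcc_of_le hy1] at hs
            exact profileDeriv_eq_zero hβ hs.1
        rw [this, add_zero]
        exact h1 1 zero_le_one le_rfl
    constructor <;> nlinarith
  · intro y hy
    refine ⟨((hd y).const_mul Λ).const_sub 1,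
      ((hasDerivAt_profileDeriv hβ hy).const_mul Λ).neg, ?_, ?_⟩
    · have := profileDeriv_nonneg hβ hy.le
      nlinarith
    · have h1 : max (1 - y ^ β) 0 ≤ 1 := max_le (by linarith [rpow_pos_of_pos hy β]) zero_le_one
      have : -(Λ * ((1 - β) / y * profileDeriv β y - 2 * max (1 - y ^ β) 0)) +
          (β - 1) / y * -(Λ * profileDeriv β y) = 2 * Λ * max (1 - y ^ β) 0 := by ring
      rw [this]
      nlinarith
  · have h1 : Tendsto (fun y : ℝ => -(Λ * (max (1 - y ^ β) 0) ^ 2 / β)) (𝓝[>] 0)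
        (𝓝 (-(Λ / β))) := by
      have h2 := continuous_rpow_const (q := β) hβ.le
      have h3 : Continuous fun y : ℝ => -(Λ * (max (1 - y ^ β) 0) ^ 2 / β) := by fun_prop
      have := (h3.tendsto 0).mono_left (nhdsWithin_le_nhds (s := Ioi 0))
      simpa [zero_rpow hβ.ne'] using this
    refine h1.congr' ?_
    filter_upwards [self_mem_nhdsWithin] with y hy
    have hy : 0 < y := hy
    have e2 : y ^ (β - 1) * y ^ (1 - β) = 1 := by
      rw [← rpow_add hy]; simp
    unfold profileDeriv
    linear_combination (Λ * (max (1 - y ^ β) 0) ^ 2 / β) * e2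

lemma hasDerivAt_tanh_real (t : ℝ) : HasDerivAt tanh (1 - tanh t ^ 2) t := by
  have h : tanh = fun x => sinh x / cosh x := funext fun x => tanh_eq_sinh_div_cosh x
  rw [h]
  refine ((hasDerivAt_sinh t).div (hasDerivAt_cosh t) (cosh_pos t).ne').congr_deriv ?_
  have := (cosh_pos t).ne'
  field_simp

lemma abs_tanh_le_one (t : ℝ) : |tanh t| ≤ 1 := by
  rw [abs_le]
  constructor
  · linarith [neg_one_lt_tanh t]
  · linarith [tanh_lt_one t]

lemma abs_tanh_sub_le (t s : ℝ) : |tanh t - tanh s| ≤ |t - s| := by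
  have := convex_univ.norm_image_sub_le_of_norm_hasDerivWithin_le (C := 1) (x := s) (y := t)
    (fun x _ => (hasDerivAt_tanh_real x).hasDerivWithinAt) (fun x _ => by
      have h := abs_le.1 (abs_tanh_le_one x)
      rw [norm_of_nonneg (by nlinarith)]; nlinarith [sq_nonneg (tanh x)]) (mem_univ s) (mem_univ t)
  simpa using this

lemma hasDerivAt_log_cosh (t : ℝ) : HasDerivAt (fun t => log (cosh t)) (tanh t) t := by
  rw [tanh_eq_sinh_div_cosh]
  exact (hasDerivAt_cosh t).log (cosh_pos t).ne'

lemma log_cosh_nonneg (t : ℝ) : 0 ≤ log (cosh t) := log_nonneg (one_le_cosh t)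

lemma abs_le_log_cosh (t : ℝ) : |t| ≤ log (cosh t) + log 2 := by
  rw [← log_mul (cosh_pos t).ne' two_ne_zero, Real.le_log_iff_exp_le (by positivity)]
  rw [Real.cosh_eq]
  rcases abs_cases t with ⟨h, _⟩ | ⟨h, _⟩ <;> rw [h] <;>
    linarith [exp_pos t, exp_pos (-t)]

/-- A function on the closed half plane which is classically regular in each variable inside,
with conormal boundary data `G / d` at the bottom. -/
structure ExtSol (β d : ℝ) (z zt ztt zy zyy : ℝ → ℝ → ℝ) (G : ℝ → ℝ) : Prop where
  cont : ContinuousOn (fun p : ℝ × ℝ => z p.1 p.2) {p | 0 ≤ p.2}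
  dt : ∀ t y, 0 < y → HasDerivAt (fun s => z s y) (zt t y) t
  dtt : ∀ t y, 0 < y → HasDerivAt (fun s => zt s y) (ztt t y) t
  dy : ∀ t y, 0 < y → HasDerivAt (fun x => z t x) (zy t y) y
  dyy : ∀ t y, 0 < y → HasDerivAt (fun x => zy t x) (zyy t y) y
  bc : ∀ t, Tendsto (fun y => y ^ (β - 1) * zy t y) (𝓝[>] 0) (𝓝 (G t / d))

/-- The left-hand side of the extension equation. -/
noncomputable def extResidual (c β : ℝ) (zt ztt zy zyy : ℝ → ℝ → ℝ) (t y : ℝ) : ℝ :=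
  zyy t y + (β - 1) / y * zy t y + ztt t y + c * tanh t * zt t y

lemma ExtSol.slice_cont {β d : ℝ} {z zt ztt zy zyy : ℝ → ℝ → ℝ} {G : ℝ → ℝ}
    (h : ExtSol β d z zt ztt zy zyy G) (t : ℝ) : ContinuousOn (fun y => z t y) (Ici 0) :=
  h.cont.comp (f := fun y : ℝ => (t, y)) (by fun_prop) fun _ hy => hy

lemma exists_lt_of_conormal_pos {β l : ℝ} {E E1 : ℝ → ℝ} (hc : ContinuousOn E (Ici 0))
    (hd : ∀ y, 0 < y → HasDerivAt E (E1 y) y)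
    (ht : Tendsto (fun y => y ^ (β - 1) * E1 y) (𝓝[>] 0) (𝓝 l)) (hl : 0 < l) :
    ∃ y, 0 < y ∧ E 0 < E y := by
  obtain ⟨δ, hδ, h⟩ := (mem_nhdsGT_iff_exists_Ioo_subset).1 (ht.eventually (lt_mem_nhds hl))
  have hδ : 0 < δ := hδ
  refine ⟨δ / 2, by linarith, ?_⟩
  have hm : StrictMonoOn E (Icc 0 (δ / 2)) := by
    refine strictMonoOn_of_deriv_pos (convex_Icc _ _) (hc.mono fun x hx => hx.1) fun x hx => ?_
    rw [interior_Icc] at hx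
    rw [(hd x hx.1).deriv]
    have h1 : 0 < x ^ (β - 1) * E1 x := h ⟨hx.1, by linarith [hx.2]⟩
    exact pos_of_mul_pos_right h1 (rpow_nonneg hx.1.le _)
  exact hm ⟨le_rfl, by linarith⟩ ⟨by linarith, le_rfl⟩ (by linarith)

/-- Explicit Lipschitz constant in the tangential variable. -/
def lipConst (c M R Λ N : ℝ) : ℝ := 8 * M * (c + 1) + 2 * N + 2 * R + 8 * (2 * Λ + 3) * M + 3

/-- The comparison function in the doubled tangential variables. -/
noncomputable def doubledBarrier (m : ℝ → ℝ) (K ε q t s y : ℝ) : ℝ :=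
  m y * (K * ((t - s) - (t - s) ^ 2 / 2) + ε * (log (cosh t) + log (cosh s) + y ^ 2) + q)

/-- A positive supremum of a penalized difference is attained. -/
lemma exists_touching {z : ℝ → ℝ → ℝ} {m : ℝ → ℝ} {M K τ : ℝ}
    (hz : ContinuousOn (fun p : ℝ × ℝ => z p.1 p.2) {p | 0 ≤ p.2})
    (hm : Continuous m) (hm1 : ∀ y, 0 ≤ y → 1 / 2 ≤ m y ∧ m y ≤ 1)
    (hM : ∀ t y, 0 ≤ y → |z t y| ≤ M) (hK : 0 ≤ K) (hτ : τ ≤ 1)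
    {t₀ s₀ y₀ : ℝ} (hy₀ : 0 ≤ y₀) (h0 : 0 ≤ t₀ - s₀) (h1 : t₀ - s₀ ≤ τ)
    (hpos : K * (t₀ - s₀) < z t₀ y₀ - z s₀ y₀) {ε₀ : ℝ} (hε₀ : 0 < ε₀) :
    ∃ ε q t s y : ℝ, 0 < ε ∧ ε ≤ ε₀ ∧ 0 < q ∧ 0 ≤ y ∧ 0 ≤ t - s ∧ t - s ≤ τ ∧
      z t y - z s y = doubledBarrier m K ε q t s y ∧
      ∀ t' s' y', 0 ≤ y' → 0 ≤ t' - s' → t' - s' ≤ τ →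
        z t' y' - z s' y' ≤ doubledBarrier m K ε q t' s' y' := by
  have hM0 : 0 ≤ M := (abs_nonneg _).trans (hM t₀ y₀ hy₀)
  set p₀ : ℝ := log (cosh t₀) + log (cosh s₀) + y₀ ^ 2 with hp₀
  have hp₀n : 0 ≤ p₀ := by
    have := log_cosh_nonneg t₀; have := log_cosh_nonneg s₀; positivity
  set X : ℝ := (z t₀ y₀ - z s₀ y₀) - K * (t₀ - s₀) with hX
  have hXp : 0 < X := by linarith
  set ε : ℝ := min ε₀ (X / (2 * (p₀ + 1))) with hε
  have hεp : 0 < ε := lt_min hε₀ (by positivity)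
  have hεX : ε * p₀ < X := by
    have : ε * (2 * (p₀ + 1)) ≤ X := by
      rw [← le_div_iff₀ (by positivity)]; exact min_le_right _ _
    nlinarith
  set Q : ℝ × ℝ × ℝ → ℝ := fun x => (z x.1 x.2.2 - z x.2.1 x.2.2) / m x.2.2 -
    (K * ((x.1 - x.2.1) - (x.1 - x.2.1) ^ 2 / 2) +
      ε * (log (cosh x.1) + log (cosh x.2.1) + x.2.2 ^ 2)) with hQ
  set B : ℝ := 4 * M / ε + log 2 + 1 with hB
  have hlog2 : 0 < log 2 := log_pos one_lt_two
  have hdiv : 0 ≤ 4 * M / ε := by positivity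
  set S : Set (ℝ × ℝ × ℝ) := {x | 0 ≤ x.2.2 ∧ 0 ≤ x.1 - x.2.1 ∧ x.1 - x.2.1 ≤ τ} with hS
  set C : Set (ℝ × ℝ × ℝ) := (Icc (-B) B ×ˢ Icc (-B) B ×ˢ Icc (-B) B) ∩ S with hC
  have hSc : IsClosed S := by
    have c1 : IsClosed {x : ℝ × ℝ × ℝ | 0 ≤ x.2.2} := isClosed_le (by fun_prop) (by fun_prop)
    have c2 : IsClosed {x : ℝ × ℝ × ℝ | 0 ≤ x.1 - x.2.1} :=
      isClosed_le (by fun_prop) (by fun_prop)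
    have c3 : IsClosed {x : ℝ × ℝ × ℝ | x.1 - x.2.1 ≤ τ} :=
      isClosed_le (by fun_prop) (by fun_prop)
    exact c1.inter (c2.inter c3)
  have hCc : IsCompact C := ((isCompact_Icc.prod (isCompact_Icc.prod isCompact_Icc))).inter_right hSc
  have hcosh : Continuous fun x => log (cosh x) :=
    continuous_iff_continuousAt.2 fun x => (hasDerivAt_log_cosh x).continuousAt
  have hQc : ContinuousOn Q C := by
    have e1 : ContinuousOn (fun x : ℝ × ℝ × ℝ => z x.1 x.2.2) C :=
      hz.comp (f := fun x : ℝ × ℝ × ℝ => (x.1, x.2.2)) (by fun_prop) fun x hx => hx.2.1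
    have e2 : ContinuousOn (fun x : ℝ × ℝ × ℝ => z x.2.1 x.2.2) C :=
      hz.comp (f := fun x : ℝ × ℝ × ℝ => (x.2.1, x.2.2)) (by fun_prop) fun x hx => hx.2.1
    refine ((e1.sub e2).div (by fun_prop) fun x hx => ?_).sub ?_
    · have := (hm1 _ hx.2.1).1; linarith
    · have a1 : Continuous fun x : ℝ × ℝ × ℝ => log (cosh x.1) := hcosh.comp continuous_fst
      have a2 : Continuous fun x : ℝ × ℝ × ℝ => log (cosh x.2.1) :=
        hcosh.comp (continuous_fst.comp continuous_snd)
      exact Continuous.continuousOn (by fun_prop)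
  have hquot : ∀ t s y, 0 ≤ y → (z t y - z s y) / m y ≤ 4 * M := by
    intro t s y hy
    have := (hm1 y hy).1
    rw [div_le_iff₀ (by linarith)]
    have a := abs_le.1 (hM t y hy); have b := abs_le.1 (hM s y hy)
    nlinarith
  have hψ : ∀ r : ℝ, 0 ≤ r → r ≤ τ → 0 ≤ K * (r - r ^ 2 / 2) := fun r h h' =>
    mul_nonneg hK (by nlinarith)
  have hbox : ∀ x ∈ S, 0 < Q x → x ∈ C := by
    intro x hx hx0
    refine ⟨?_, hx⟩
    have h2 := hquot x.1 x.2.1 x.2.2 hx.1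
    have h3 := hψ _ hx.2.1 hx.2.2
    have h4 : ε * (log (cosh x.1) + log (cosh x.2.1) + x.2.2 ^ 2) ≤ 4 * M := by
      simp only [hQ] at hx0; linarith
    rw [mul_comm, ← le_div_iff₀ hεp] at h4
    have a1 := log_cosh_nonneg x.1
    have a2 := log_cosh_nonneg x.2.1
    have a3 := sq_nonneg x.2.2
    have b1 := abs_le.1 ((abs_le_log_cosh x.1).trans (show _ ≤ B by linarith))
    have b2 := abs_le.1 ((abs_le_log_cosh x.2.1).trans (show _ ≤ B by linarith))
    refine ⟨b1, b2, ?_, ?_⟩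
    · linarith [hx.1]
    · by_contra! hcon
      nlinarith [hx.1]
  have hx₀S : (t₀, s₀, y₀) ∈ S := ⟨hy₀, h0, h1⟩
  have hQ0 : 0 < Q (t₀, s₀, y₀) := by
    have e := hm1 y₀ hy₀
    have e1 : z t₀ y₀ - z s₀ y₀ ≤ (z t₀ y₀ - z s₀ y₀) / m y₀ := by
      rw [le_div_iff₀ (by linarith)]
      have : 0 ≤ K * (t₀ - s₀) := mul_nonneg hK h0
      nlinarith
    simp only [hQ]
    have : K * ((t₀ - s₀) - (t₀ - s₀) ^ 2 / 2) ≤ K * (t₀ - s₀) :=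
      mul_le_mul_of_nonneg_left (by nlinarith [sq_nonneg (t₀ - s₀)]) hK
    linarith
  obtain ⟨x, hxC, hmax⟩ := hCc.exists_isMaxOn ⟨_, hbox _ hx₀S hQ0⟩ hQc
  have hqpos : 0 < Q x := hQ0.trans_le (hmax (hbox _ hx₀S hQ0))
  have hall : ∀ x' ∈ S, Q x' ≤ Q x := by
    intro x' hx'
    rcases le_or_gt (Q x') 0 with h | h
    · linarith
    · exact hmax (hbox x' hx' h)
  refine ⟨ε, Q x, x.1, x.2.1, x.2.2, hεp, min_le_left _ _, hqpos, hxC.2.1, hxC.2.2.1,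
    hxC.2.2.2, ?_, ?_⟩
  · have := (hm1 _ hxC.2.1).1
    have hne : m x.2.2 ≠ 0 := by linarith
    simp only [doubledBarrier, hQ]
    field_simp
    ring
  · intro t s y hy hts hts'
    have h2 := hall (t, s, y) ⟨hy, hts, hts'⟩
    have hmp : 0 < m y := by linarith [(hm1 _ hy).1]
    have h3 : (z t y - z s y) / m y ≤ K * ((t - s) - (t - s) ^ 2 / 2) +
        ε * (log (cosh t) + log (cosh s) + y ^ 2) + Q x := by
      simp only [hQ] at h2 ⊢; linarith
    rw [div_le_iff₀ hmp] at h3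
    unfold doubledBarrier
    linarith

section Touching

variable {β d c : ℝ} {z zt ztt zy zyy : ℝ → ℝ → ℝ} {G : ℝ → ℝ} {m m1 m2 : ℝ → ℝ}
  {K ε q t s y τ : ℝ}

lemma ExtSol.touching_first_order (hz : ExtSol β d z zt ztt zy zyy G) (hy : 0 < y)
    (hτ0 : 0 < t - s) (hτ1 : t - s < τ)
    (heq : z t y - z s y = doubledBarrier m K ε q t s y)
    (hle : ∀ t' s' y', 0 ≤ y' → 0 ≤ t' - s' → t' - s' ≤ τ →
      z t' y' - z s' y' ≤ doubledBarrier m K ε q t' s' y') :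
    zt t y = m y * (K * (1 - (t - s)) + ε * tanh t) ∧
    zt s y = m y * (K * (1 - (t - s)) - ε * tanh s) := by
  constructor
  · have hloc : IsLocalMax (fun r => z r y - z s y - doubledBarrier m K ε q r s y) t := by
      have h1 : ∀ᶠ r in 𝓝 t, 0 < r - s := (continuous_id.sub continuous_const).continuousAt.eventually
        (lt_mem_nhds hτ0)
      have h2 : ∀ᶠ r in 𝓝 t, r - s < τ := (continuous_id.sub continuous_const).continuousAt.eventually
        (gt_mem_nhds hτ1)
      filter_upwards [h1, h2] with r hr1 hr2
      have := hle r s y hy.le hr1.le hr2.le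
      linarith
    have hd : HasDerivAt (fun r => z r y - z s y - doubledBarrier m K ε q r s y)
        (zt t y - m y * (K * (1 - (t - s)) + ε * tanh t)) t := by
      have e1 := (hasDerivAt_id t).sub_const s
      have e2 := ((e1.sub ((e1.pow 2).div_const 2)).const_mul K)
      have e3 := (((hasDerivAt_log_cosh t).add_const (log (cosh s))).add_const (y ^ 2)).const_mul ε
      have e4 := (((e2.add e3).add_const q).const_mul (m y))
      refine (((hz.dt t y hy).sub_const (z s y)).sub e4).congr_deriv ?_
      simp only [id]; push_cast; ring
    have := hloc.hasDerivAt_eq_zero hd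
    linarith
  · have hloc : IsLocalMax (fun r => z t y - z r y - doubledBarrier m K ε q t r y) s := by
      have h1 : ∀ᶠ r in 𝓝 s, 0 < t - r := (continuous_const.sub continuous_id).continuousAt.eventually
        (lt_mem_nhds hτ0)
      have h2 : ∀ᶠ r in 𝓝 s, t - r < τ := (continuous_const.sub continuous_id).continuousAt.eventually
        (gt_mem_nhds hτ1)
      filter_upwards [h1, h2] with r hr1 hr2
      have := hle t r y hy.le hr1.le hr2.le
      linarith
    have hd : HasDerivAt (fun r => z t y - z r y - doubledBarrier m K ε q t r y)
        (-zt s y + m y * (K * (1 - (t - s)) - ε * tanh s)) s := by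
      have e1 := (hasDerivAt_id s).const_sub t
      have e2 := ((e1.sub ((e1.pow 2).div_const 2)).const_mul K)
      have e3 := (((hasDerivAt_log_cosh s).const_add (log (cosh t))).add_const (y ^ 2)).const_mul ε
      have e4 := (((e2.add e3).add_const q).const_mul (m y))
      refine (((hz.dt s y hy).const_sub (z t y)).sub e4).congr_deriv ?_
      simp only [id]; push_cast; ring
    have := hloc.hasDerivAt_eq_zero hd
    linarith

lemma ExtSol.touching_second_order (hz : ExtSol β d z zt ztt zy zyy G) (hy : 0 < y)
    (hm : 0 ≤ m y) (hε : 0 ≤ ε)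
    (hτ0 : 0 < t - s) (hτ1 : t - s < τ)
    (heq : z t y - z s y = doubledBarrier m K ε q t s y)
    (hle : ∀ t' s' y', 0 ≤ y' → 0 ≤ t' - s' → t' - s' ≤ τ →
      z t' y' - z s' y' ≤ doubledBarrier m K ε q t' s' y') :
    ztt t y - ztt s y ≤ m y * (-4 * K + 2 * ε) := by
  set f : ℝ → ℝ := fun r => z (t + r) y - z (s - r) y - doubledBarrier m K ε q (t + r) (s - r) y
  set f' : ℝ → ℝ := fun r => zt (t + r) y + zt (s - r) y -
    m y * (K * (2 - 2 * ((t + r) - (s - r))) + ε * (tanh (t + r) - tanh (s - r)))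
  have hloc : IsLocalMax f 0 := by
    have hc : ContinuousAt (fun r : ℝ => (t + r) - (s - r)) 0 := by fun_prop
    have h1 : ∀ᶠ r in 𝓝 (0:ℝ), 0 < (t + r) - (s - r) :=
      hc.eventually (lt_mem_nhds (by simpa using hτ0))
    have h2 : ∀ᶠ r in 𝓝 (0:ℝ), (t + r) - (s - r) < τ :=
      hc.eventually (gt_mem_nhds (by simpa using hτ1))
    filter_upwards [h1, h2] with r hr1 hr2
    have := hle _ _ y hy.le hr1.le hr2.le
    simp only [f, add_zero, sub_zero]
    linarith
  have a1 : ∀ r, HasDerivAt (fun r => t + r) 1 r := fun r => (hasDerivAt_id r).const_add t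
  have a2 : ∀ r, HasDerivAt (fun r => s - r) (-1) r := fun r => (hasDerivAt_id r).const_sub s
  have hf : ∀ r, HasDerivAt f (f' r) r := by
    intro r
    have e0 := (a1 r).sub (a2 r)
    have e2 := ((e0.sub ((e0.pow 2).div_const 2)).const_mul K)
    have e3 := ((((hasDerivAt_log_cosh (t + r)).comp r (a1 r)).add
      ((hasDerivAt_log_cosh (s - r)).comp r (a2 r))).add_const (y ^ 2)).const_mul ε
    have e4 := (((e2.add e3).add_const q).const_mul (m y))
    refine ((((hz.dt (t + r) y hy).comp r (a1 r)).sub ((hz.dt (s - r) y hy).comp r (a2 r))).sub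
      e4).congr_deriv ?_
    simp only [f', Pi.sub_apply]; push_cast; ring
  have hf' : HasDerivAt f' (ztt t y - ztt s y - m y * (-4 * K + ε * ((1 - tanh t ^ 2) +
      (1 - tanh s ^ 2)))) 0 := by
    have e0 := (a1 0).sub (a2 0)
    have b1 : HasDerivAt (fun r => zt r y) (ztt t y) (t + 0) := by simpa using hz.dtt t y hy
    have b2 : HasDerivAt (fun r => zt r y) (ztt s y) (s - 0) := by simpa using hz.dtt s y hy
    have b3 : HasDerivAt tanh (1 - tanh t ^ 2) (t + 0) := by simpa using hasDerivAt_tanh_real t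
    have b4 : HasDerivAt tanh (1 - tanh s ^ 2) (s - 0) := by simpa using hasDerivAt_tanh_real s
    have e1 := (b1.comp 0 (a1 0)).add (b2.comp 0 (a2 0))
    have e2 := ((e0.const_mul 2).const_sub 2).const_mul K
    have e3 := ((b3.comp 0 (a1 0)).sub (b4.comp 0 (a2 0))).const_mul ε
    refine (e1.sub ((e2.add e3).const_mul (m y))).congr_deriv ?_
    ring
  have h := hloc.second_deriv_nonpos (Eventually.of_forall hf) hf'
  have h3 : m y * (-4 * K + ε * ((1 - tanh t ^ 2) + (1 - tanh s ^ 2))) ≤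
      m y * (-4 * K + 2 * ε) := by
    refine mul_le_mul_of_nonneg_left ?_ hm
    nlinarith [mul_nonneg hε (sq_nonneg (tanh t)), mul_nonneg hε (sq_nonneg (tanh s))]
  linarith

lemma ExtSol.touching_vertical (hz : ExtSol β d z zt ztt zy zyy G) (hy : 0 < y)
    (hm : ∀ y, 0 < y → HasDerivAt m (m1 y) y ∧ HasDerivAt m1 (m2 y) y)
    (hτ0 : 0 < t - s) (hτ1 : t - s < τ)
    (heq : z t y - z s y = doubledBarrier m K ε q t s y)
    (hle : ∀ t' s' y', 0 ≤ y' → 0 ≤ t' - s' → t' - s' ≤ τ →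
      z t' y' - z s' y' ≤ doubledBarrier m K ε q t' s' y') {P : ℝ}
    (hP : P = K * ((t - s) - (t - s) ^ 2 / 2) + ε * (log (cosh t) + log (cosh s) + y ^ 2) + q) :
    zy t y - zy s y = m1 y * P + m y * (2 * ε * y) ∧
    zyy t y - zyy s y ≤ m2 y * P + 4 * ε * y * m1 y + 2 * ε * m y := by
  set f : ℝ → ℝ := fun x => z t x - z s x - doubledBarrier m K ε q t s x
  set p : ℝ → ℝ := fun x => K * ((t - s) - (t - s) ^ 2 / 2) +
    ε * (log (cosh t) + log (cosh s) + x ^ 2) + q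
  have hp : ∀ x, HasDerivAt p (2 * ε * x) x := by
    intro x
    have := ((((hasDerivAt_pow 2 x).const_add (log (cosh t) + log (cosh s))).const_mul
      ε).const_add (K * ((t - s) - (t - s) ^ 2 / 2))).add_const q
    refine this.congr_deriv ?_
    push_cast; ring
  set f' : ℝ → ℝ := fun x => zy t x - zy s x - (m1 x * p x + m x * (2 * ε * x))
  have hloc : IsLocalMax f y := by
    filter_upwards [lt_mem_nhds hy] with x hx
    have := hle t s x hx.le hτ0.le hτ1.le
    simp only [f]
    linarith
  have hf : ∀ x, 0 < x → HasDerivAt f (f' x) x := fun x hx =>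
    ((hz.dy t x hx).sub (hz.dy s x hx)).sub ((hm x hx).1.mul (hp x))
  have hpy : p y = P := hP.symm
  have hf' : HasDerivAt f' (zyy t y - zyy s y - ((m2 y * P + m1 y * (2 * ε * y)) +
      (m1 y * (2 * ε * y) + m y * (2 * ε)))) y := by
    have e1 := (hm y hy).2.mul (hp y)
    have e2 := (hm y hy).1.mul ((hasDerivAt_id y).const_mul (2 * ε))
    refine (((hz.dyy t y hy).sub (hz.dyy s y hy)).sub (e1.add e2)).congr_deriv ?_
    rw [hpy]; simp
  constructor
  · have := hloc.hasDerivAt_eq_zero (hf y hy)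
    simp only [f', hpy] at this
    linarith
  · have := hloc.second_deriv_nonpos ((lt_mem_nhds hy).mono hf) hf'
    linarith

lemma ExtSol.touching_residual (hz : ExtSol β d z zt ztt zy zyy G) (hy : 0 < y)
    (hβ2 : β ≤ 1 / 2) (hc : 0 ≤ c) {L P₀ : ℝ}
    (hm1 : 1 / 2 ≤ m y ∧ m y ≤ 1)
    (hm : ∀ y, 0 < y → HasDerivAt m (m1 y) y ∧ HasDerivAt m1 (m2 y) y ∧ m1 y ≤ 0 ∧
        m2 y + ((β - 1) / y) * m1 y ≤ 2 * L) (hL : 0 ≤ L)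
    (hε : 0 ≤ ε) (hK : 0 ≤ K) (hq : 0 ≤ q)
    (hτ0 : 0 < t - s) (hτ1 : t - s < τ) (hτ : τ ≤ 1) (hcτ : c * τ ≤ 1)
    (hεK : 2 * ε * (1 + c) ≤ K)
    (heq : z t y - z s y = doubledBarrier m K ε q t s y)
    (hP₀ : z t y - z s y ≤ P₀ / 2)
    (hle : ∀ t' s' y', 0 ≤ y' → 0 ≤ t' - s' → t' - s' ≤ τ →
      z t' y' - z s' y' ≤ doubledBarrier m K ε q t' s' y') :
    extResidual c β zt ztt zy zyy t y - extResidual c β zt ztt zy zyy s y ≤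
      -K + 2 * L * P₀ + ε := by
  set P := K * ((t - s) - (t - s) ^ 2 / 2) + ε * (log (cosh t) + log (cosh s) + y ^ 2) + q with hP
  obtain ⟨a1, a2⟩ := hz.touching_first_order hy hτ0 hτ1 heq hle
  have a3 := hz.touching_second_order hy (by linarith [hm1.1]) hε hτ0 hτ1 heq hle
  obtain ⟨a4, a5⟩ := hz.touching_vertical hy (fun y hy => ⟨(hm y hy).1, (hm y hy).2.1⟩)
    hτ0 hτ1 heq hle hP
  have hP0 : 0 ≤ P := by
    have b1 : 0 ≤ K * ((t - s) - (t - s) ^ 2 / 2) := mul_nonneg hK (by nlinarith)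
    have := log_cosh_nonneg t
    have := log_cosh_nonneg s
    positivity
  have hPle : P ≤ P₀ := by
    have h1 : z t y - z s y = m y * P := heq
    have h2 := mul_nonneg (by linarith [hm1.1] : 0 ≤ m y - 1 / 2) hP0
    linarith
  have hyne := hy.ne'
  have v1 : zyy t y - zyy s y + (β - 1) / y * (zy t y - zy s y) ≤ 2 * L * P₀ + ε := by
    have e1 : (β - 1) / y * (zy t y - zy s y) =
        P * ((β - 1) / y * m1 y) + (β - 1) * (2 * ε) * m y := by
      rw [a4]; field_simp
    have e2 : P * (m2 y + (β - 1) / y * m1 y) ≤ P₀ * (2 * L) :=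
      (mul_le_mul_of_nonneg_left (hm y hy).2.2.2 hP0).trans
        (mul_le_mul_of_nonneg_right hPle (by linarith))
    have e3 : 4 * ε * y * m1 y ≤ 0 :=
      mul_nonpos_of_nonneg_of_nonpos (by positivity) (hm y hy).2.2.1
    have e4 : β * (2 * ε) * m y ≤ ε := by
      have h0 : 0 ≤ ε * m y := mul_nonneg hε (by linarith [hm1.1])
      have h1 : ε * m y ≤ ε := mul_le_of_le_one_right hε hm1.2
      have h2 := mul_nonneg (by linarith : 0 ≤ 1 / 2 - β) h0
      linarith
    linarith
  have v2 : c * tanh t * zt t y - c * tanh s * zt s y ≤ m y * (K + 2 * c * ε) := by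
    rw [a1, a2]
    have e1 : tanh t - tanh s ≤ t - s := by
      have := abs_tanh_sub_le t s
      rw [abs_of_pos hτ0] at this
      exact (le_abs_self _).trans this
    have e2 := (sq_le_one_iff_abs_le_one _).2 (abs_tanh_le_one t)
    have e3 := (sq_le_one_iff_abs_le_one _).2 (abs_tanh_le_one s)
    have e4 : tanh t ^ 2 + tanh s ^ 2 ≤ 2 := by linarith
    have e5 : c * (1 - (t - s)) * (tanh t - tanh s) ≤ 1 := by
      have h0 : 0 ≤ c * (1 - (t - s)) := mul_nonneg hc (by linarith)
      have h1 : c * (1 - (t - s)) * (tanh t - tanh s) ≤ c * (1 - (t - s)) * (t - s) :=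
        mul_le_mul_of_nonneg_left e1 h0
      have h2 : c * (t - s) ≤ c * τ := mul_le_mul_of_nonneg_left hτ1.le hc
      have h3 := mul_nonneg hc (sq_nonneg (t - s))
      linarith
    have e6 : K * (c * (1 - (t - s)) * (tanh t - tanh s)) ≤ K * 1 :=
      mul_le_mul_of_nonneg_left e5 hK
    have e7 : c * ε * (tanh t ^ 2 + tanh s ^ 2) ≤ c * ε * 2 :=
      mul_le_mul_of_nonneg_left e4 (mul_nonneg hc hε)
    have e8 : m y * (K * (c * (1 - (t - s)) * (tanh t - tanh s)) +
        c * ε * (tanh t ^ 2 + tanh s ^ 2)) ≤ m y * (K + 2 * c * ε) :=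
      mul_le_mul_of_nonneg_left (by linarith) (by linarith [hm1.1])
    linarith
  have v3 : m y * (-4 * K + 2 * ε) + m y * (K + 2 * c * ε) ≤ -K := by
    have h1 := mul_nonneg (by linarith [hm1.1] : 0 ≤ m y) (sub_nonneg.2 hεK)
    have h2 := mul_nonneg (by linarith [hm1.1] : 0 ≤ m y - 1 / 2) hK
    linarith
  unfold extResidual
  linarith

lemma ExtSol.touching_bottom_false (hz : ExtSol β d z zt ztt zy zyy G) (hβ : 0 < β)
    (hd : 0 < d) (hdβ : β ≤ 2 * d) {Λ N : ℝ} (hΛ : 0 ≤ Λ) (hNK : 2 * N ≤ K)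
    (hmc : Continuous m) (hm0 : m 0 = 1)
    (hm : ∀ y, 0 < y → HasDerivAt m (m1 y) y)
    (hmb : Tendsto (fun y => y ^ (β - 1) * m1 y) (𝓝[>] 0) (𝓝 (-((2 * Λ + 3) / β))))
    (hε : 0 ≤ ε) (hK : 0 ≤ K) (hq : 0 < q)
    (hG : ∀ t s, |G t - G s| ≤ Λ * |z t 0 - z s 0| + N * |t - s|)
    (hτ0 : 0 ≤ t - s) (hτ1 : t - s ≤ τ) (hτ : τ ≤ 1)
    (heq : z t 0 - z s 0 = doubledBarrier m K ε q t s 0)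
    (hle : ∀ t' s' y', 0 ≤ y' → 0 ≤ t' - s' → t' - s' ≤ τ →
      z t' y' - z s' y' ≤ doubledBarrier m K ε q t' s' y') : False := by
  set A := K * ((t - s) - (t - s) ^ 2 / 2) + ε * (log (cosh t) + log (cosh s)) + q with hA
  set p : ℝ → ℝ := fun x => K * ((t - s) - (t - s) ^ 2 / 2) +
    ε * (log (cosh t) + log (cosh s) + x ^ 2) + q with hp_def
  have hp : ∀ x, HasDerivAt p (2 * ε * x) x := by
    intro x
    have := ((((hasDerivAt_pow 2 x).const_add (log (cosh t) + log (cosh s))).const_mul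
      ε).const_add (K * ((t - s) - (t - s) ^ 2 / 2))).add_const q
    refine this.congr_deriv ?_
    push_cast; ring
  have hp0 : p 0 = A := by simp [hp_def, hA]
  have hpc : Continuous p := continuous_iff_continuousAt.2 fun x => (hp x).continuousAt
  have hDA : z t 0 - z s 0 = A := by
    rw [heq]; simp [doubledBarrier, hm0, hA]
  have hAτ : K * (t - s) / 2 ≤ A := by
    have := log_cosh_nonneg t
    have := log_cosh_nonneg s
    have h1 : 0 ≤ ε * (log (cosh t) + log (cosh s)) := by positivity
    have h2 : K * ((t - s) / 2) ≤ K * ((t - s) - (t - s) ^ 2 / 2) :=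
      mul_le_mul_of_nonneg_left (by nlinarith) hK
    linarith
  have hA0 : 0 < A := by
    have := log_cosh_nonneg t
    have := log_cosh_nonneg s
    have h1 : 0 ≤ ε * (log (cosh t) + log (cosh s)) := by positivity
    have h2 : 0 ≤ K * ((t - s) - (t - s) ^ 2 / 2) := mul_nonneg hK (by nlinarith)
    linarith
  have hGA : -((Λ + 1) * A) ≤ G t - G s := by
    have h1 := hG t s
    rw [hDA, abs_of_pos hA0, abs_of_nonneg hτ0] at h1
    have h2 := (abs_le.1 h1).1
    nlinarith
  have hlim : Tendsto (fun x => x ^ (β - 1) * (zy t x - zy s x - (m1 x * p x + m x * (2 * ε * x))))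
      (𝓝[>] 0) (𝓝 (G t / d - G s / d - (-((2 * Λ + 3) / β) * A + 1 * (2 * ε * 0)))) := by
    have b1 : Tendsto p (𝓝[>] 0) (𝓝 A) := hp0 ▸ (hpc.tendsto 0).mono_left nhdsWithin_le_nhds
    have b2 : Tendsto m (𝓝[>] 0) (𝓝 1) := hm0 ▸ (hmc.tendsto 0).mono_left nhdsWithin_le_nhds
    have b3 : Tendsto (fun x : ℝ => 2 * ε * x ^ β) (𝓝[>] 0) (𝓝 (2 * ε * 0)) := by
      have h2 := (continuous_rpow_const (q := β) hβ.le).tendsto 0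
      rw [zero_rpow hβ.ne'] at h2
      exact (h2.mono_left nhdsWithin_le_nhds).const_mul _
    refine (((hz.bc t).sub (hz.bc s)).sub ((hmb.mul b1).add (b2.mul b3))).congr' ?_
    filter_upwards [self_mem_nhdsWithin] with x hx
    have hx : 0 < x := hx
    have : x ^ β = x ^ (β - 1) * x := by
      rw [← rpow_add_one hx.ne']; ring_nf
    rw [this]; ring
  have hpos : 0 < G t / d - G s / d - (-((2 * Λ + 3) / β) * A + 1 * (2 * ε * 0)) := by
    have h1 : -((Λ + 1) * A) / d ≤ (G t - G s) / d := by gcongr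
    have h2 : (Λ + 1) * A / d ≤ (2 * Λ + 2) * A / β := by
      rw [div_le_div_iff₀ hd hβ]
      have : 0 ≤ (Λ + 1) * A := by positivity
      nlinarith
    have h3 : (2 * Λ + 2) * A / β < (2 * Λ + 3) * A / β := by gcongr; linarith
    have h4 : (G t - G s) / d = G t / d - G s / d := by ring
    have h5 : -((Λ + 1) * A) / d = -((Λ + 1) * A / d) := by ring
    have h6 : (2 * Λ + 3) * A / β = (2 * Λ + 3) / β * A := by ring
    linarith
  obtain ⟨x, hx, hlt⟩ := exists_lt_of_conormal_pos (β := β)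
    (E := fun x => z t x - z s x - m x * p x)
    (((hz.slice_cont t).sub (hz.slice_cont s)).sub (hmc.mul hpc).continuousOn)
    (fun x hx => ((hz.dy t x hx).sub (hz.dy s x hx)).sub ((hm x hx).mul (hp x))) hlim hpos
  have h1 := hle t s x hx.le hτ0 hτ1
  have h2 : doubledBarrier m K ε q t s x = m x * p x := rfl
  simp only [hm0, hp0, hDA] at hlt
  linarith

lemma ExtSol.sub_le_lip (hz : ExtSol β d z zt ztt zy zyy G) (hβ : 0 < β) (hβ2 : β ≤ 1 / 2)
    (hd : 0 < d) (hdβ : β ≤ 2 * d) (hc : 0 ≤ c) {M R Λ N : ℝ} (hΛ : 0 ≤ Λ) (hN : 0 ≤ N)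
    (hΛβ : 32 * (2 * Λ + 3) * β ≤ 1) (hM : ∀ t y, 0 ≤ y → |z t y| ≤ M)
    (hR : ∀ t y, 0 < y → |extResidual c β zt ztt zy zyy t y| ≤ R)
    (hG : ∀ t s, |G t - G s| ≤ Λ * |z t 0 - z s 0| + N * |t - s|) (hst : s ≤ t) (hy : 0 ≤ y) :
    z t y - z s y ≤ lipConst c M R Λ N * (t - s) := by
  have hM0 : 0 ≤ M := (abs_nonneg _).trans (hM 0 0 le_rfl)
  have hR0 : 0 ≤ R := (abs_nonneg _).trans (hR 0 1 one_pos)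
  have hcM : 0 ≤ M * (c + 1) := by positivity
  have hΛM : 0 ≤ (2 * Λ + 3) * M := by positivity
  set k := lipConst c M R Λ N with hk
  have hk1 : k = 8 * M * (c + 1) + 2 * N + 2 * R + 8 * (2 * Λ + 3) * M + 3 := rfl
  have hk0 : 0 ≤ k := by linarith
  set σ : ℝ := 1 / (c + 1) with hσ
  have hσc : σ * (c + 1) = 1 := by rw [hσ]; field_simp
  have hσ0 : 0 < σ := by positivity
  have hσ1 : σ ≤ 1 := by nlinarith
  have hdiff : ∀ t s y, 0 ≤ y → z t y - z s y ≤ 2 * M := fun t s y hy => by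
    have := (abs_le.1 (hM t y hy)).2
    have := (abs_le.1 (hM s y hy)).1
    linarith
  have hkσ : 8 * M ≤ k * σ := by
    have h1 : 8 * M * (c + 1) * σ ≤ k * σ := mul_le_mul_of_nonneg_right (by linarith) hσ0.le
    have h2 : 8 * M * (c + 1) * σ = 8 * M * (σ * (c + 1)) := by ring
    rw [h2, hσc] at h1
    linarith
  by_contra! hcon
  have hts : t - s ≤ σ := by
    by_contra! h
    have h1 : k * σ ≤ k * (t - s) := mul_le_mul_of_nonneg_left h.le hk0
    have := hdiff t s y hy
    linarith
  obtain ⟨m, m1, m2, hmc, hm0, hm1, hm, hmb⟩ := exists_multiplier hβ hβ2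
    (by linarith : 0 ≤ 2 * Λ + 3) hΛβ
  obtain ⟨ε, q, t', s', y', hε, hε1, hq, hy', hτ0, hτ1, heq, hle⟩ := exists_touching hz.cont hmc
    hm1 hM hk0 hσ1 hy (sub_nonneg.2 hst) hts hcon
    (by positivity : 0 < 1 / (2 * (1 + c)))
  have hεc : 2 * ε * (1 + c) ≤ 1 := by
    rw [le_div_iff₀ (by positivity)] at hε1
    linarith
  have hεle : ε ≤ 1 := by nlinarith [mul_nonneg hε.le hc]
  have hlog : 0 ≤ ε * (log (cosh t') + log (cosh s') + y' ^ 2) := by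
    have := log_cosh_nonneg t'
    have := log_cosh_nonneg s'
    positivity
  have hbar : ∀ ρ, 0 ≤ ρ → ρ ≤ 1 → t' - s' = ρ → k * ρ / 4 < z t' y' - z s' y' := by
    intro ρ h0 h1 h
    have h2 : k * (ρ / 2) ≤ k * (ρ - ρ ^ 2 / 2) := mul_le_mul_of_nonneg_left (by nlinarith) hk0
    have h3 : 1 / 2 * (k * (ρ / 2) + q) ≤ m y' * (k * (ρ - ρ ^ 2 / 2) +
        ε * (log (cosh t') + log (cosh s') + y' ^ 2) + q) :=
      mul_le_mul (hm1 y' hy').1 (by linarith) (by positivity) (by linarith [(hm1 y' hy').1])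
    rw [heq, doubledBarrier, h]
    linarith
  have hne0 : 0 < t' - s' := by
    refine hτ0.lt_of_ne fun h => ?_
    have h1 := hbar 0 le_rfl zero_le_one h.symm
    rw [sub_eq_zero.1 h.symm] at h1
    simp at h1
  have hne1 : t' - s' < σ := by
    refine hτ1.lt_of_ne fun h => ?_
    have h1 := hbar σ hσ0.le hσ1 h
    have := hdiff t' s' y' hy'
    linarith
  rcases hy'.eq_or_lt with h0 | h0
  · subst h0
    exact hz.touching_bottom_false hβ hd hdβ hΛ (by linarith) hmc hm0 (fun y hy => (hm y hy).1)
      hmb hε.le hk0 hq hG hτ0 hτ1 hσ1 heq hle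
  · have h1 := hz.touching_residual (P₀ := 4 * M) h0 hβ2 hc (hm1 y' hy') hm (by linarith) hε.le hk0
      hq.le hne0 hne1 hσ1 (by nlinarith) (by linarith) heq
      (by linarith [hdiff t' s' y' hy']) hle
    have h2 := (abs_le.1 (hR t' y' h0)).1
    have h3 := (abs_le.1 (hR s' y' h0)).2
    linarith

lemma ExtSol.neg (hz : ExtSol β d z zt ztt zy zyy G) :
    ExtSol β d (fun t y => -z t y) (fun t y => -zt t y) (fun t y => -ztt t y)
      (fun t y => -zy t y) (fun t y => -zyy t y) (fun t => -G t) where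
  cont := hz.cont.neg
  dt t y hy := (hz.dt t y hy).neg
  dtt t y hy := (hz.dtt t y hy).neg
  dy t y hy := (hz.dy t y hy).neg
  dyy t y hy := (hz.dyy t y hy).neg
  bc t := by simpa [neg_div] using (hz.bc t).neg

/-- Tangential Lipschitz estimate for the extension problem, uniform as `β → 0`. -/
lemma ExtSol.abs_sub_le_lip (hz : ExtSol β d z zt ztt zy zyy G) (hβ : 0 < β) (hβ2 : β ≤ 1 / 2)
    (hd : 0 < d) (hdβ : β ≤ 2 * d) (hc : 0 ≤ c) {M R Λ N : ℝ} (hΛ : 0 ≤ Λ) (hN : 0 ≤ N)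
    (hΛβ : 32 * (2 * Λ + 3) * β ≤ 1) (hM : ∀ t y, 0 ≤ y → |z t y| ≤ M)
    (hR : ∀ t y, 0 < y → |extResidual c β zt ztt zy zyy t y| ≤ R)
    (hG : ∀ t s, |G t - G s| ≤ Λ * |z t 0 - z s 0| + N * |t - s|) (t s : ℝ) (hy : 0 ≤ y) :
    |z t y - z s y| ≤ lipConst c M R Λ N * |t - s| := by
  wlog hst : s ≤ t generalizing t s
  · rw [abs_sub_comm, abs_sub_comm t]
    exact this s t (le_of_not_ge hst)
  rw [abs_of_nonneg (sub_nonneg.2 hst), abs_le]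
  have h1 := hz.sub_le_lip hβ hβ2 hd hdβ hc hΛ hN hΛβ hM hR hG hst hy
  have h2 := hz.neg.sub_le_lip (M := M) (R := R) hβ hβ2 hd hdβ hc hΛ hN hΛβ
    (fun t y hy => by simpa using hM t y hy)
    (fun t y hy => by
      rw [show extResidual c β (fun t y => -zt t y) (fun t y => -ztt t y) (fun t y => -zy t y)
        (fun t y => -zyy t y) t y = -extResidual c β zt ztt zy zyy t y by
          unfold extResidual; ring, abs_neg]
      exact hR t y hy)
    (fun t s => by
      rw [neg_sub_neg, neg_sub_neg, abs_sub_comm (G s), abs_sub_comm (z s 0)]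
      exact hG t s) hst hy
  constructor <;> linarith

end Touching

section Scalar

lemma abs_sub_le_of_abs_deriv_le {f f' : ℝ → ℝ} {C a b : ℝ} (hab : a ≤ b)
    (hf : ∀ x ∈ Icc a b, HasDerivAt f (f' x) x) (hC : ∀ x ∈ Icc a b, |f' x| ≤ C) :
    |f b - f a| ≤ C * (b - a) := by
  have := (convex_Icc a b).norm_image_sub_le_of_norm_hasDerivWithin_le
    (fun x hx => (hf x hx).hasDerivWithinAt) hC ⟨le_rfl, hab⟩ ⟨hab, le_rfl⟩
  rwa [Real.norm_eq_abs, Real.norm_eq_abs, abs_of_nonneg (sub_nonneg.2 hab)] at this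

lemma abs_le_of_lipschitz {f : ℝ → ℝ} {f' x C : ℝ} (hf : HasDerivAt f f' x)
    (hC : ∀ s t, |f s - f t| ≤ C * |s - t|) : |f'| ≤ C := by
  have hC0 : 0 ≤ C := by simpa using (abs_nonneg _).trans (hC 1 0)
  have := hf.le_of_lip' hC0 (Eventually.of_forall fun t => by simpa using hC t x)
  simpa using this

/-- Forward second difference of a twice differentiable function. -/
lemma abs_second_diff_sub_le {f f1 : ℝ → ℝ} (hf : ∀ x, HasDerivAt f (f1 x) x) {t h c ε : ℝ}
    (hh : 0 ≤ h) (hb : ∀ r ∈ Icc 0 h, |f1 (t + h + r) - f1 (t + r) - h * c| ≤ ε) :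
    |f (t + 2 * h) - 2 * f (t + h) + f t - h ^ 2 * c| ≤ ε * h := by
  have hd : ∀ r ∈ Icc (0:ℝ) h, HasDerivAt (fun r => f (t + h + r) - f (t + r) - h * c * r)
      (f1 (t + h + r) - f1 (t + r) - h * c) r := by
    intro r _
    have e1 := (hf (t + h + r)).comp_const_add (t + h) r
    have e2 := (hf (t + r)).comp_const_add t r
    exact ((e1.sub e2).sub ((hasDerivAt_id r).const_mul (h * c))).congr_deriv (by simp)
  have := abs_sub_le_of_abs_deriv_le hh hd hb
  simp only [add_zero, mul_zero, sub_zero] at this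
  convert this using 2
  rw [show t + h + h = t + 2 * h by ring]
  ring

lemma tendsto_second_diff {f f1 : ℝ → ℝ} (hf : ∀ x, HasDerivAt f (f1 x) x) {t c : ℝ}
    (hf1 : HasDerivAt f1 c t) :
    Tendsto (fun h => (f (t + 2 * h) - 2 * f (t + h) + f t) / h ^ 2) (𝓝[>] 0) (𝓝 c) := by
  rw [Metric.tendsto_nhds]
  intro ε hε
  have h1 := (hasDerivAt_iff_isLittleO_nhds_zero.1 hf1).bound (by positivity : 0 < ε / 4)
  obtain ⟨δ, hδ, h2⟩ := Metric.eventually_nhds_iff.1 h1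
  filter_upwards [Ioo_mem_nhdsGT (by positivity : 0 < δ / 2)] with h hh
  have h3 : ∀ r, 0 ≤ r → r ≤ 2 * h → |f1 (t + r) - f1 t - r * c| ≤ ε / 4 * r := by
    intro r h0 h1
    have := h2 (y := r) (by rw [Real.dist_eq, sub_zero, abs_of_nonneg h0]; linarith [hh.2])
    simpa [abs_of_nonneg h0] using this
  have h4 := abs_second_diff_sub_le hf (t := t) (c := c) (ε := 3 * (ε / 4) * h) hh.1.le (by
    intro r hr
    have a1 := abs_le.1 (h3 r hr.1 (by linarith [hr.2, hh.1]))
    have a2 := abs_le.1 (h3 (h + r) (by linarith [hr.1, hh.1]) (by linarith [hr.2]))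
    have a3 : ε / 4 * r ≤ ε / 4 * h := by gcongr; exact hr.2
    rw [← add_assoc] at a2
    rw [abs_le]
    constructor <;> linarith [a1.1, a1.2, a2.1, a2.2])
  have hh2 : 0 < h ^ 2 := by have := hh.1; positivity
  rw [Real.dist_eq, div_sub' hh2.ne', abs_div, abs_of_pos hh2, div_lt_iff₀ hh2]
  have : 0 < ε * h ^ 2 := by positivity
  linarith

/-- Consequences of a uniform Lipschitz bound on second difference quotients. -/
lemma lipschitz_of_second_diff {f f1 f2 : ℝ → ℝ} (hf : ∀ x, HasDerivAt f (f1 x) x)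
    (hf1 : ∀ x, HasDerivAt f1 (f2 x) x) {C : ℝ}
    (hC : ∀ h, 0 < h → ∀ t s, |(f (t + 2 * h) - 2 * f (t + h) + f t) / h ^ 2 -
      (f (s + 2 * h) - 2 * f (s + h) + f s) / h ^ 2| ≤ C * |t - s|) (t s : ℝ) :
    |f2 t - f2 s| ≤ C * |t - s| := by
  have h1 := ((tendsto_second_diff hf (hf1 t)).sub (tendsto_second_diff hf (hf1 s))).abs
  exact le_of_tendsto h1 (by filter_upwards [self_mem_nhdsWithin] with h hh using hC h hh t s)

lemma abs_first_order_le {f f1 : ℝ → ℝ} (hf : ∀ x, HasDerivAt f (f1 x) x) {C : ℝ}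
    (hC : ∀ t s, |f1 t - f1 s| ≤ C * |t - s|) {t h : ℝ} (hh : 0 ≤ h) :
    |f (t + h) - f t - h * f1 t| ≤ C * h ^ 2 := by
  have hC0 : 0 ≤ C := by simpa using (abs_nonneg _).trans (hC 1 0)
  have := abs_sub_le_of_abs_deriv_le (f := fun r => f (t + r) - f1 t * r) (C := C * h)
    (f' := fun r => f1 (t + r) - f1 t) hh
    (fun r _ => (((hf (t + r)).comp_const_add t r).sub
      ((hasDerivAt_id r).const_mul (f1 t))).congr_deriv (by simp))
    (fun r hr => (hC _ _).trans (by
      rw [add_sub_cancel_left, abs_of_nonneg hr.1]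
      exact mul_le_mul_of_nonneg_left hr.2 hC0))
  simp only [add_zero, mul_zero, sub_zero] at this
  rw [show f (t + h) - f t - h * f1 t = f (t + h) - f1 t * h - f t by ring]
  calc _ ≤ _ := this
    _ = _ := by ring

lemma abs_second_diff_quot_sub_le {f f1 f2 : ℝ → ℝ} (hf : ∀ x, HasDerivAt f (f1 x) x)
    (hf1 : ∀ x, HasDerivAt f1 (f2 x) x) {C : ℝ}
    (hC : ∀ t s, |f2 t - f2 s| ≤ C * |t - s|) {t h : ℝ} (hh : 0 < h) :
    |f2 t - (f (t + 2 * h) - 2 * f (t + h) + f t) / h ^ 2| ≤ 2 * C * h := by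
  have hC0 : 0 ≤ C := by simpa using (abs_nonneg _).trans (hC 1 0)
  have h1 := abs_second_diff_sub_le hf (t := t) (c := f2 t) (ε := 2 * C * h ^ 2) hh.le (by
    intro r hr
    have a1 := abs_le.1 (abs_first_order_le hf1 hC (t := t + r) hh.le)
    have a2 : |h * (f2 (t + r) - f2 t)| ≤ h * (C * h) := by
      rw [abs_mul, abs_of_pos hh]
      refine mul_le_mul_of_nonneg_left ((hC _ _).trans ?_) hh.le
      rw [add_sub_cancel_left, abs_of_nonneg hr.1]
      exact mul_le_mul_of_nonneg_left hr.2 hC0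
    have a2 := abs_le.1 a2
    rw [show t + h + r = t + r + h by ring, abs_le]
    constructor <;> linarith [a1.1, a1.2, a2.1, a2.2])
  have hh2 : 0 < h ^ 2 := by positivity
  rw [abs_sub_comm, div_sub' hh2.ne', abs_div, abs_of_pos hh2, div_le_iff₀ hh2]
  linarith

lemma abs_convex_comb_le {a b δ θ : ℝ} (hθ : θ ∈ Icc (0:ℝ) 1) (ha : |a| ≤ δ) (hb : |b| ≤ δ) :
    |a + θ * (b - a)| ≤ δ := by
  rw [abs_le] at *
  constructor <;> nlinarith [hθ.1, hθ.2]

/-- Four-point inequality. -/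
lemma four_point {φ φ1 φ2 : ℝ → ℝ} (h1 : ∀ x, HasDerivAt φ (φ1 x) x)
    (h2 : ∀ x, HasDerivAt φ1 (φ2 x) x) {A B : ℝ} (hA : ∀ x, |x| ≤ 1 → |φ1 x| ≤ A)
    (hB : ∀ x, |x| ≤ 1 → |φ2 x| ≤ B) {p q p' q' δ : ℝ} (hp : |p| ≤ 1) (hq : |q| ≤ 1)
    (hp' : |p'| ≤ 1) (hq' : |q'| ≤ 1) (hδp : |p - p'| ≤ δ) (hδq : |q - q'| ≤ δ) :
    |φ q - φ p - (φ q' - φ p')| ≤ A * |q - p - (q' - p')| + B * |q' - p'| * δ := by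
  have hlip : ∀ x y, |x| ≤ 1 → |y| ≤ 1 → |φ1 x - φ1 y| ≤ B * |x - y| := fun x y hx hy =>
    (convex_Icc (-1:ℝ) 1).norm_image_sub_le_of_norm_hasDerivWithin_le
      (fun x _ => (h2 x).hasDerivWithinAt) (fun x hx => hB x (abs_le.2 hx)) (abs_le.1 hy)
      (abs_le.1 hx)
  have hB0 : 0 ≤ B := (abs_nonneg _).trans (hB p hp)
  have hd : ∀ θ ∈ Icc (0:ℝ) 1, HasDerivAt (fun θ => φ (p + θ * (q - p)) - φ (p' + θ * (q' - p')))
      (φ1 (p + θ * (q - p)) * (q - p) - φ1 (p' + θ * (q' - p')) * (q' - p')) θ := by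
    intro θ _
    have e1 := ((hasDerivAt_id θ).mul_const (q - p)).const_add p
    have e2 := ((hasDerivAt_id θ).mul_const (q' - p')).const_add p'
    exact (((h1 _).comp θ e1).sub ((h1 _).comp θ e2)).congr_deriv (by simp)
  have := abs_sub_le_of_abs_deriv_le zero_le_one hd
    (C := A * |q - p - (q' - p')| + B * |q' - p'| * δ) (by
    intro θ hθ
    have b1 := abs_convex_comb_le hθ hp hq
    have b2 := abs_convex_comb_le hθ hp' hq'
    have b3 : |p + θ * (q - p) - (p' + θ * (q' - p'))| ≤ δ := by
      convert abs_convex_comb_le hθ hδp hδq using 2; ring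
    have b5 := (hlip _ _ b1 b2).trans (mul_le_mul_of_nonneg_left b3 hB0)
    have e : φ1 (p + θ * (q - p)) * (q - p) - φ1 (p' + θ * (q' - p')) * (q' - p') =
        φ1 (p + θ * (q - p)) * (q - p - (q' - p')) +
        (φ1 (p + θ * (q - p)) - φ1 (p' + θ * (q' - p'))) * (q' - p') := by ring
    rw [e]
    refine (abs_add_le _ _).trans ?_
    rw [abs_mul, abs_mul]
    have c1 := mul_le_mul_of_nonneg_right (hA _ b1) (abs_nonneg (q - p - (q' - p')))
    have c2 := mul_le_mul_of_nonneg_right b5 (abs_nonneg (q' - p'))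
    linarith)
  simp only [one_mul, zero_mul, add_zero, add_sub_cancel, sub_zero, mul_one] at this
  rwa [sub_sub_sub_comm] at this

/-- Six-point inequality for second differences. -/
lemma six_point {φ φ1 φ2 φ3 : ℝ → ℝ} (h1 : ∀ x, HasDerivAt φ (φ1 x) x)
    (h2 : ∀ x, HasDerivAt φ1 (φ2 x) x) (h3 : ∀ x, HasDerivAt φ2 (φ3 x) x) {A B C : ℝ}
    (hA : ∀ x, |x| ≤ 1 → |φ1 x| ≤ A) (hB : ∀ x, |x| ≤ 1 → |φ2 x| ≤ B)
    (hC : ∀ x, |x| ≤ 1 → |φ3 x| ≤ C) {p q r p' q' r' δ a e κ : ℝ}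
    (hp : |p| ≤ 1) (hq : |q| ≤ 1) (hr : |r| ≤ 1) (hp' : |p'| ≤ 1) (hq' : |q'| ≤ 1)
    (hr' : |r'| ≤ 1) (hδp : |p - p'| ≤ δ) (hδq : |q - q'| ≤ δ) (hδr : |r - r'| ≤ δ)
    (ha1 : |p - q| ≤ a) (ha2 : |r' - q'| ≤ a) (ha3 : |p' - q'| ≤ a)
    (he1 : |r - q - (r' - q')| ≤ e) (he2 : |p - q - (p' - q')| ≤ e)
    (hκ : |r' - 2 * q' + p'| ≤ κ) :
    |r - 2 * q + p - (r' - 2 * q' + p')| * A + B * κ * δ + (B * (2 * e) + C * (2 * a) * δ) * a +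
      B * (2 * a) * e ≥ |φ r - 2 * φ q + φ p - (φ r' - 2 * φ q' + φ p')| := by
  have hB0 : 0 ≤ B := (abs_nonneg _).trans (hB p hp)
  have hC0 : 0 ≤ C := (abs_nonneg _).trans (hC p hp)
  have hδ0 : 0 ≤ δ := (abs_nonneg _).trans hδp
  have ha0 : 0 ≤ a := (abs_nonneg _).trans ha1
  have he0 : 0 ≤ e := (abs_nonneg _).trans he1
  have hlip : ∀ x y, |x| ≤ 1 → |y| ≤ 1 → |φ1 x - φ1 y| ≤ B * |x - y| := fun x y hx hy =>
    (convex_Icc (-1:ℝ) 1).norm_image_sub_le_of_norm_hasDerivWithin_le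
      (fun x _ => (h2 x).hasDerivWithinAt) (fun x hx => hB x (abs_le.2 hx)) (abs_le.1 hy)
      (abs_le.1 hx)
  set g : ℝ → ℝ := fun θ => (φ (q + θ * (r - q)) + φ (q + θ * (p - q))) -
    (φ (q' + θ * (r' - q')) + φ (q' + θ * (p' - q')))
  have hd : ∀ θ ∈ Icc (0:ℝ) 1, HasDerivAt g
      ((φ1 (q + θ * (r - q)) * (r - q) + φ1 (q + θ * (p - q)) * (p - q)) -
      (φ1 (q' + θ * (r' - q')) * (r' - q') + φ1 (q' + θ * (p' - q')) * (p' - q'))) θ := by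
    intro θ _
    have e1 : ∀ q r, HasDerivAt (fun θ => φ (q + θ * (r - q))) (φ1 (q + θ * (r - q)) * (r - q)) θ :=
      fun q r => ((h1 _).comp θ
        (((hasDerivAt_id θ).mul_const (r - q)).const_add q)).congr_deriv (by simp)
    exact ((e1 q r).add (e1 q p)).sub ((e1 q' r').add (e1 q' p'))
  have := abs_sub_le_of_abs_deriv_le zero_le_one hd
    (C := |r - 2 * q + p - (r' - 2 * q' + p')| * A + B * κ * δ + (B * (2 * e) +
      C * (2 * a) * δ) * a + B * (2 * a) * e) (by
    intro θ hθ
    have b1 := abs_convex_comb_le hθ hq hr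
    have b2 := abs_convex_comb_le hθ hq hp
    have b1' := abs_convex_comb_le hθ hq' hr'
    have b2' := abs_convex_comb_le hθ hq' hp'
    have b3 : |q + θ * (r - q) - (q' + θ * (r' - q'))| ≤ δ := by
      convert abs_convex_comb_le hθ hδq hδr using 2; ring
    have b4 : |q + θ * (p - q) - (q' + θ * (p' - q'))| ≤ δ := by
      convert abs_convex_comb_le hθ hδq hδp using 2; ring
    set X := q + θ * (r - q) with hX
    set Z := q + θ * (p - q) with hZ
    set X' := q' + θ * (r' - q') with hX'
    set Z' := q' + θ * (p' - q') with hZ'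
    have hθe : ∀ v w : ℝ, |v| ≤ w → |θ * v| ≤ w := fun v w h => by
      rw [abs_mul, abs_of_nonneg hθ.1]
      exact (mul_le_of_le_one_left (abs_nonneg _) hθ.2).trans h
    have f1 : |Z - X - (Z' - X')| ≤ 2 * e := by
      rw [show Z - X - (Z' - X') = θ * ((p - q - (p' - q')) - (r - q - (r' - q'))) by
        simp only [hX, hZ, hX', hZ']; ring]
      exact hθe _ _ ((abs_sub _ _).trans (by linarith))
    have f2 : |Z' - X'| ≤ 2 * a := by
      rw [show Z' - X' = θ * ((p' - q') - (r' - q')) by simp only [hX', hZ']; ring]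
      exact hθe _ _ ((abs_sub _ _).trans (by linarith))
    have f3 := four_point h2 h3 hB hC b1 b2 b1' b2' b3 b4
    have f3' : |φ1 Z - φ1 X - (φ1 Z' - φ1 X')| ≤ B * (2 * e) + C * (2 * a) * δ :=
      f3.trans (add_le_add (mul_le_mul_of_nonneg_left f1 hB0)
        (mul_le_mul_of_nonneg_right (mul_le_mul_of_nonneg_left f2 hC0) hδ0))
    have f4 : |φ1 Z' - φ1 X'| ≤ B * (2 * a) :=
      (hlip _ _ b2' b1').trans (mul_le_mul_of_nonneg_left f2 hB0)
    have f5 : |φ1 X - φ1 X'| ≤ B * δ :=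
      (hlip _ _ b1 b1').trans (mul_le_mul_of_nonneg_left b3 hB0)
    have e0 : (φ1 X * (r - q) + φ1 Z * (p - q)) - (φ1 X' * (r' - q') + φ1 Z' * (p' - q')) =
        φ1 X * (r - 2 * q + p - (r' - 2 * q' + p')) + (φ1 X - φ1 X') * (r' - 2 * q' + p') +
        (φ1 Z - φ1 X - (φ1 Z' - φ1 X')) * (p - q) +
        (φ1 Z' - φ1 X') * (p - q - (p' - q')) := by ring
    rw [e0]
    have g1 : |φ1 X * (r - 2 * q + p - (r' - 2 * q' + p'))| ≤
        A * |r - 2 * q + p - (r' - 2 * q' + p')| := by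
      rw [abs_mul]; exact mul_le_mul_of_nonneg_right (hA _ b1) (abs_nonneg _)
    have g2 : |(φ1 X - φ1 X') * (r' - 2 * q' + p')| ≤ (B * δ) * κ := by
      rw [abs_mul]; exact mul_le_mul f5 hκ (abs_nonneg _) (by positivity)
    have g3 : |(φ1 Z - φ1 X - (φ1 Z' - φ1 X')) * (p - q)| ≤ (B * (2 * e) + C * (2 * a) * δ) * a := by
      rw [abs_mul]; exact mul_le_mul f3' ha1 (abs_nonneg _) (by positivity)
    have g4 : |(φ1 Z' - φ1 X') * (p - q - (p' - q'))| ≤ (B * (2 * a)) * e := by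
      rw [abs_mul]; exact mul_le_mul f4 he2 (abs_nonneg _) (by positivity)
    have k1 := abs_add_le (φ1 X * (r - 2 * q + p - (r' - 2 * q' + p')) +
      (φ1 X - φ1 X') * (r' - 2 * q' + p') + (φ1 Z - φ1 X - (φ1 Z' - φ1 X')) * (p - q))
      ((φ1 Z' - φ1 X') * (p - q - (p' - q')))
    have k2 := abs_add_le (φ1 X * (r - 2 * q + p - (r' - 2 * q' + p')) +
      (φ1 X - φ1 X') * (r' - 2 * q' + p')) ((φ1 Z - φ1 X - (φ1 Z' - φ1 X')) * (p - q))
    have k3 := abs_add_le (φ1 X * (r - 2 * q + p - (r' - 2 * q' + p')))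
      ((φ1 X - φ1 X') * (r' - 2 * q' + p'))
    linarith)
  have e1 : g 1 - g 0 = φ r - 2 * φ q + φ p - (φ r' - 2 * φ q' + φ p') := by
    simp only [g, one_mul, zero_mul, add_zero, add_sub_cancel]
    ring
  rw [e1] at this
  linarith

lemma abs_tanh_second_diff_le (t : ℝ) {h : ℝ} (hh : 0 < h) :
    |(tanh (t + h + h) - tanh (t + h)) / h - (tanh (t + h) - tanh t) / h| ≤ 2 * h := by
  have h1 := abs_second_diff_sub_le hasDerivAt_tanh_real (t := t) (c := 0) (ε := 2 * h) hh.le (by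
    intro r _
    have a1 := abs_tanh_sub_le (t + h + r) (t + r)
    have a2 := abs_add_le (tanh (t + h + r)) (tanh (t + r))
    have a3 := abs_tanh_le_one (t + h + r)
    have a4 := abs_tanh_le_one (t + r)
    rw [show 1 - tanh (t + h + r) ^ 2 - (1 - tanh (t + r) ^ 2) - h * 0 =
      -((tanh (t + h + r) - tanh (t + r)) * (tanh (t + h + r) + tanh (t + r))) by ring, abs_neg,
      abs_mul]
    rw [show t + h + r - (t + r) = h by ring, abs_of_pos hh] at a1
    calc _ ≤ h * 2 := mul_le_mul a1 (by linarith) (abs_nonneg _) hh.le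
      _ = _ := by ring)
  rw [← sub_div, abs_div, abs_of_pos hh, div_le_iff₀ hh,
    show t + h + h = t + 2 * h by ring]
  rwa [show tanh (t + 2 * h) - tanh (t + h) - (tanh (t + h) - tanh t) =
    tanh (t + 2 * h) - 2 * tanh (t + h) + tanh t - h ^ 2 * 0 by ring]

end Scalar

section Quotients

/-- Tangential forward difference quotient. -/
noncomputable def diffQuot (h : ℝ) (z : ℝ → ℝ → ℝ) (t y : ℝ) : ℝ := (z (t + h) y - z t y) / h

variable {β d c : ℝ} {z zt ztt zy zyy : ℝ → ℝ → ℝ} {G : ℝ → ℝ}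

lemma ExtSol.diff_quot (hz : ExtSol β d z zt ztt zy zyy G) (h : ℝ) :
    ExtSol β d (diffQuot h z) (diffQuot h zt) (diffQuot h ztt) (diffQuot h zy) (diffQuot h zyy)
      (fun t => (G (t + h) - G t) / h) where
  cont := by
    have h1 : ContinuousOn (fun p : ℝ × ℝ => z (p.1 + h) p.2) {p | 0 ≤ p.2} :=
      hz.cont.comp (f := fun p : ℝ × ℝ => (p.1 + h, p.2)) (by fun_prop) fun p hp => hp
    exact (h1.sub hz.cont).div_const h
  dt t y hy := (((hz.dt (t + h) y hy).comp_add_const t h).sub (hz.dt t y hy)).div_const h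
  dtt t y hy := (((hz.dtt (t + h) y hy).comp_add_const t h).sub (hz.dtt t y hy)).div_const h
  dy t y hy := ((hz.dy (t + h) y hy).sub (hz.dy t y hy)).div_const h
  dyy t y hy := ((hz.dyy (t + h) y hy).sub (hz.dyy t y hy)).div_const h
  bc t := by
    have := ((hz.bc (t + h)).sub (hz.bc t)).div_const h
    rw [show (G (t + h) - G t) / h / d = (G (t + h) / d - G t / d) / h by ring]
    refine this.congr fun y => ?_
    simp only [diffQuot]
    ring

lemma extResidual_diffQuot (h t y : ℝ) :
    extResidual c β (diffQuot h zt) (diffQuot h ztt) (diffQuot h zy) (diffQuot h zyy) t y =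
      (extResidual c β zt ztt zy zyy (t + h) y - extResidual c β zt ztt zy zyy t y) / h -
        c * ((tanh (t + h) - tanh t) / h) * zt (t + h) y := by
  simp only [extResidual, diffQuot]
  ring

/-- A smooth nonlinearity with bounds on `[-1,1]`. -/
structure ReactionBounds (φ φ1 φ2 φ3 : ℝ → ℝ) (A B C : ℝ) : Prop where
  d1 : ∀ x, HasDerivAt φ (φ1 x) x
  d2 : ∀ x, HasDerivAt φ1 (φ2 x) x
  d3 : ∀ x, HasDerivAt φ2 (φ3 x) x
  b1 : ∀ x, |x| ≤ 1 → |φ1 x| ≤ A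
  b2 : ∀ x, |x| ≤ 1 → |φ2 x| ≤ B
  b3 : ∀ x, |x| ≤ 1 → |φ3 x| ≤ C

noncomputable def lip1 (c A : ℝ) : ℝ := lipConst c 1 0 A 0
noncomputable def lip2 (c A B : ℝ) : ℝ :=
  lipConst c (lip1 c A) (c * lip1 c A) A (B * lip1 c A * lip1 c A)
noncomputable def lip3 (c A B C : ℝ) : ℝ :=
  lipConst c (lip2 c A B) (2 * c * (lip1 c A + lip2 c A B)) A
    (5 * B * lip1 c A * lip2 c A B + 2 * C * lip1 c A ^ 3)

variable {φ φ1 φ2 φ3 : ℝ → ℝ} {A B C : ℝ}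

lemma ExtSol.tangential_bounds {u ut utt uy uyy : ℝ → ℝ → ℝ}
    (hφ : ReactionBounds φ φ1 φ2 φ3 A B C)
    (hu : ExtSol β d u ut utt uy uyy (fun t => φ (u t 0))) (hβ : 0 < β) (hβ2 : β ≤ 1 / 2)
    (hd : 0 < d) (hdβ : β ≤ 2 * d) (hc : 0 ≤ c) (hAβ : 32 * (2 * A + 3) * β ≤ 1)
    (hu1 : ∀ t y, 0 ≤ y → |u t y| ≤ 1)
    (heq : ∀ t y, 0 < y → extResidual c β ut utt uy uyy t y = 0) :
    (∀ t s y, 0 ≤ y → |u t y - u s y| ≤ lip1 c A * |t - s|) ∧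
    (∀ t s y, 0 < y → |ut t y - ut s y| ≤ lip2 c A B * |t - s|) ∧
    (∀ t s y, 0 < y → |utt t y - utt s y| ≤ lip3 c A B C * |t - s|) := by
  have hA0 : 0 ≤ A := (abs_nonneg _).trans (hφ.b1 0 (by simp))
  have hB0 : 0 ≤ B := (abs_nonneg _).trans (hφ.b2 0 (by simp))
  have hC0 : 0 ≤ C := (abs_nonneg _).trans (hφ.b3 0 (by simp))
  have hw : ∀ t, |u t 0| ≤ 1 := fun t => hu1 t 0 le_rfl
  have h1 : ∀ t s y, 0 ≤ y → |u t y - u s y| ≤ lip1 c A * |t - s| := fun t s y hy =>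
    hu.abs_sub_le_lip hβ hβ2 hd hdβ hc hA0 le_rfl hAβ hu1
      (fun t y hy => by simp [heq t y hy])
      (fun t s => by
        simpa using (convex_Icc (-1:ℝ) 1).norm_image_sub_le_of_norm_hasDerivWithin_le
          (fun x _ => (hφ.d1 x).hasDerivWithinAt) (fun x hx => hφ.b1 x (abs_le.2 hx))
          (abs_le.1 (hw s)) (abs_le.1 (hw t))) t s hy
  set K1 := lip1 c A with hK1
  have hK10 : 0 ≤ K1 := by simpa using (abs_nonneg _).trans (h1 1 0 0 le_rfl)
  have hut : ∀ t y, 0 < y → |ut t y| ≤ K1 := fun t y hy =>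
    abs_le_of_lipschitz (hu.dt t y hy) fun t s => h1 t s y hy.le
  have hM2 : ∀ h, 0 < h → ∀ t y, 0 ≤ y → |diffQuot h u t y| ≤ K1 := by
    intro h hh t y hy
    have := h1 (t + h) t y hy
    rw [add_sub_cancel_left, abs_of_pos hh] at this
    rw [diffQuot, abs_div, abs_of_pos hh]
    exact div_le_of_le_mul₀ hh.le hK10 this
  have htq : ∀ h, 0 < h → ∀ t, |(tanh (t + h) - tanh t) / h| ≤ 1 := by
    intro h hh t
    have := abs_tanh_sub_le (t + h) t
    rw [add_sub_cancel_left, abs_of_pos hh] at this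
    rw [abs_div, abs_of_pos hh]
    exact div_le_one_of_le₀ this hh.le
  have hres2 : ∀ h, 0 < h → ∀ t y, 0 < y → extResidual c β (diffQuot h ut) (diffQuot h utt)
      (diffQuot h uy) (diffQuot h uyy) t y =
        -(c * ((tanh (t + h) - tanh t) / h) * ut (t + h) y) := by
    intro h hh t y hy
    rw [extResidual_diffQuot, heq _ _ hy, heq _ _ hy]
    simp
  have h2q : ∀ h, 0 < h → ∀ t s y, 0 ≤ y →
      |diffQuot h u t y - diffQuot h u s y| ≤ lip2 c A B * |t - s| := by
    intro h hh t s y hy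
    refine (hu.diff_quot h).abs_sub_le_lip hβ hβ2 hd hdβ hc hA0 (by positivity) hAβ
      (hM2 h hh) (R := c * K1) (N := B * K1 * K1) ?_ ?_ t s hy
    · intro t y hy
      rw [hres2 h hh t y hy, abs_neg, abs_mul, abs_mul, abs_of_nonneg hc, mul_assoc]
      refine mul_le_mul_of_nonneg_left ?_ hc
      calc _ ≤ 1 * K1 := mul_le_mul (htq h hh t) (hut _ _ hy) (abs_nonneg _) zero_le_one
        _ = K1 := one_mul _
    · intro t s
      have e1 := h1 (t + h) (s + h) 0 le_rfl
      rw [add_sub_add_right_eq_sub] at e1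
      have e2 := four_point hφ.d1 hφ.d2 hφ.b1 hφ.b2 (hw t) (hw (t + h)) (hw s) (hw (s + h))
        (h1 t s 0 le_rfl) e1
      have e3 := h1 (s + h) s 0 le_rfl
      rw [add_sub_cancel_left, abs_of_pos hh] at e3
      rw [← sub_div, abs_div, abs_of_pos hh, div_le_iff₀ hh]
      have e4 : |diffQuot h u t 0 - diffQuot h u s 0| * h =
          |u (t + h) 0 - u t 0 - (u (s + h) 0 - u s 0)| := by
        rw [diffQuot, diffQuot, ← sub_div, abs_div, abs_of_pos hh, div_mul_cancel₀ _ hh.ne']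
      have e5 : B * |u (s + h) 0 - u s 0| * (K1 * |t - s|) ≤ B * (K1 * h) * (K1 * |t - s|) := by
        gcongr
      calc _ ≤ _ := e2
        _ ≤ A * (|diffQuot h u t 0 - diffQuot h u s 0| * h) + B * (K1 * h) * (K1 * |t - s|) := by
          rw [e4]; linarith
        _ = _ := by ring
  set K2 := lip2 c A B with hK2
  have hK20 : 0 ≤ K2 := by simpa using (abs_nonneg _).trans (h2q 1 one_pos 1 0 0 le_rfl)
  have h2 : ∀ t s y, 0 < y → |ut t y - ut s y| ≤ K2 * |t - s| := by
    intro t s y hy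
    have e1 := ((hu.dt t y hy).tendsto_slope_zero_right.sub
      (hu.dt s y hy).tendsto_slope_zero_right).abs
    refine le_of_tendsto e1 ?_
    filter_upwards [self_mem_nhdsWithin] with h hh
    have := h2q h hh t s y hy.le
    simpa only [diffQuot, smul_eq_mul, div_eq_inv_mul] using this
  have hM3 : ∀ h, 0 < h → ∀ t y, 0 ≤ y → |diffQuot h (diffQuot h u) t y| ≤ K2 := by
    intro h hh t y hy
    have := h2q h hh (t + h) t y hy
    rw [add_sub_cancel_left, abs_of_pos hh] at this
    rw [diffQuot, abs_div, abs_of_pos hh]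
    exact div_le_of_le_mul₀ hh.le hK20 this
  have hsd : ∀ h, 0 < h → ∀ t y, diffQuot h (diffQuot h u) t y =
      (u (t + 2 * h) y - 2 * u (t + h) y + u t y) / h ^ 2 := by
    intro h hh t y
    simp only [diffQuot]
    rw [show t + h + h = t + 2 * h by ring]
    field_simp
    ring
  have h3q : ∀ h, 0 < h → ∀ t s y, 0 ≤ y → |diffQuot h (diffQuot h u) t y -
      diffQuot h (diffQuot h u) s y| ≤ lip3 c A B C * |t - s| := by
    intro h hh t s y hy
    refine ((hu.diff_quot h).diff_quot h).abs_sub_le_lip hβ hβ2 hd hdβ hc hA0 (by positivity) hAβ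
      (hM3 h hh) (R := 2 * c * (K1 + K2)) (N := 5 * B * K1 * K2 + 2 * C * K1 ^ 3) ?_ ?_ t s hy
    · intro t y hy
      rw [extResidual_diffQuot, hres2 h hh _ _ hy, hres2 h hh _ _ hy]
      set T0 := (tanh (t + h) - tanh t) / h
      set T1 := (tanh (t + h + h) - tanh (t + h)) / h
      have e1 : (-(c * T1 * ut (t + h + h) y) - -(c * T0 * ut (t + h) y)) / h -
          c * T0 * diffQuot h ut (t + h) y =
          -(c * ((T1 - T0) / h * ut (t + h + h) y + 2 * (T0 * diffQuot h ut (t + h) y))) := by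
        simp only [diffQuot]
        field_simp
        ring
      have e2 : |(T1 - T0) / h| ≤ 2 := by
        rw [abs_div, abs_of_pos hh]
        exact div_le_of_le_mul₀ hh.le zero_le_two (abs_tanh_second_diff_le t hh)
      have e3 : |diffQuot h ut (t + h) y| ≤ K2 := by
        have := h2 (t + h + h) (t + h) y hy
        rw [add_sub_cancel_left, abs_of_pos hh] at this
        rw [diffQuot, abs_div, abs_of_pos hh]
        exact div_le_of_le_mul₀ hh.le hK20 this
      rw [e1, abs_neg, abs_mul, abs_of_nonneg hc]
      have e4 : |(T1 - T0) / h * ut (t + h + h) y| ≤ 2 * K1 := by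
        rw [abs_mul]; exact mul_le_mul e2 (hut _ _ hy) (abs_nonneg _) zero_le_two
      have e5 : |2 * (T0 * diffQuot h ut (t + h) y)| ≤ 2 * (1 * K2) := by
        rw [abs_mul, abs_two, abs_mul]
        exact mul_le_mul_of_nonneg_left (mul_le_mul (htq h hh t) e3 (abs_nonneg _) zero_le_one)
          zero_le_two
      calc _ ≤ c * (2 * K1 + 2 * (1 * K2)) :=
            mul_le_mul_of_nonneg_left ((abs_add_le _ _).trans (add_le_add e4 e5)) hc
        _ = _ := by ring
    · intro t s
      have k1 : ∀ a, |u (t + a) 0 - u (s + a) 0| ≤ K1 * |t - s| := fun a => by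
        simpa using h1 (t + a) (s + a) 0 le_rfl
      have k2 : ∀ t, |u (t + h) 0 - u t 0| ≤ K1 * h := fun t => by
        simpa [abs_of_pos hh] using h1 (t + h) t 0 le_rfl
      have k3 : ∀ t s, |u (t + h) 0 - u t 0 - (u (s + h) 0 - u s 0)| ≤ K2 * h * |t - s| := by
        intro t s
        have := h2q h hh t s 0 le_rfl
        rw [diffQuot, diffQuot, ← sub_div, abs_div, abs_of_pos hh, div_le_iff₀ hh] at this
        linarith
      have k4 : ∀ t, |u (t + h + h) 0 - 2 * u (t + h) 0 + u t 0| ≤ K2 * h ^ 2 := by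
        intro t
        have := k3 (t + h) t
        rw [add_sub_cancel_left, abs_of_pos hh] at this
        calc _ = _ := by congr 1; ring
          _ ≤ _ := this
          _ = _ := by ring
      have k5 := k3 (t + h) (s + h)
      have k6 := k3 t s
      rw [add_sub_add_right_eq_sub] at k5
      have e2 := six_point hφ.d1 hφ.d2 hφ.d3 hφ.b1 hφ.b2 hφ.b3 (hw t) (hw (t + h))
        (hw (t + h + h)) (hw s) (hw (s + h)) (hw (s + h + h)) (h1 t s 0 le_rfl) (k1 h)
        (by simpa [add_assoc] using k1 (h + h)) (by rw [abs_sub_comm]; exact k2 t) (k2 (s + h))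
        (by rw [abs_sub_comm]; exact k2 s) k5
        (by
          rw [show u t 0 - u (t + h) 0 - (u s 0 - u (s + h) 0) =
            -(u (t + h) 0 - u t 0 - (u (s + h) 0 - u s 0)) by ring, abs_neg]
          exact k6) (k4 s)
      have hh2 : 0 < h ^ 2 := by positivity
      have e4 : |diffQuot h (diffQuot h u) t 0 - diffQuot h (diffQuot h u) s 0| * h ^ 2 =
          |u (t + h + h) 0 - 2 * u (t + h) 0 + u t 0 -
            (u (s + h + h) 0 - 2 * u (s + h) 0 + u s 0)| := by
        rw [hsd h hh, hsd h hh, ← sub_div, abs_div, abs_of_pos hh2, div_mul_cancel₀ _ hh2.ne',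
          show t + 2 * h = t + h + h by ring, show s + 2 * h = s + h + h by ring]
      rw [show ((φ (u (t + h + h) 0) - φ (u (t + h) 0)) / h - (φ (u (t + h) 0) - φ (u t 0)) / h) / h
        - ((φ (u (s + h + h) 0) - φ (u (s + h) 0)) / h - (φ (u (s + h) 0) - φ (u s 0)) / h) / h =
        (φ (u (t + h + h) 0) - 2 * φ (u (t + h) 0) + φ (u t 0) -
          (φ (u (s + h + h) 0) - 2 * φ (u (s + h) 0) + φ (u s 0))) / h ^ 2 by field_simp; ring,
        abs_div, abs_of_pos hh2, div_le_iff₀ hh2]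
      rw [← e4] at e2
      refine e2.le.trans (le_of_eq ?_)
      ring
  refine ⟨h1, h2, fun t s y hy => ?_⟩
  exact lipschitz_of_second_diff (fun x => hu.dt x y hy) (fun x => hu.dtt x y hy)
    (fun h hh t s => by
      rw [← hsd h hh, ← hsd h hh]
      exact h3q h hh t s y hy.le) t s

end Quotients

section Trace

lemma abs_sub_le_sub_of_deriv_le {X X' Y Y' : ℝ → ℝ} {x y : ℝ} (hxy : x ≤ y)
    (hX : ∀ r ∈ Icc x y, HasDerivAt X (X' r) r) (hY : ∀ r ∈ Icc x y, HasDerivAt Y (Y' r) r)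
    (hb : ∀ r ∈ Icc x y, |X' r| ≤ Y' r) : |X y - X x| ≤ Y y - Y x := by
  have key : ∀ Z Z' : ℝ → ℝ, (∀ r ∈ Icc x y, HasDerivAt Z (Z' r) r) →
      (∀ r ∈ Icc x y, 0 ≤ Z' r) → Z x ≤ Z y := by
    intro Z Z' h1 h2
    refine monotoneOn_of_deriv_nonneg (convex_Icc x y)
      (fun r hr => (h1 r hr).continuousAt.continuousWithinAt)
      (fun r hr => (h1 r (interior_subset hr)).differentiableAt.differentiableWithinAt)
      (fun r hr => ?_) ⟨le_rfl, hxy⟩ ⟨hxy, le_rfl⟩ hxy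
    rw [(h1 r (interior_subset hr)).deriv]
    exact h2 r (interior_subset hr)
  have h1 := key _ _ (fun r hr => (hY r hr).sub (hX r hr)) fun r hr => by
    linarith [(abs_le.1 (hb r hr)).2]
  have h2 := key _ _ (fun r hr => (hY r hr).add (hX r hr)) fun r hr => by
    linarith [(abs_le.1 (hb r hr)).1]
  simp only [Pi.sub_apply, Pi.add_apply] at h1 h2
  rw [abs_le]
  constructor <;> linarith

lemma exists_limit_of_approx {g e C A : ℝ → ℝ}
    (h : ∀ h, 0 < h → ∀ y, 0 < y → y ≤ 1 → |g y - A h| ≤ e h + C h * y)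
    (he : Tendsto e (𝓝[>] 0) (𝓝 0)) :
    ∃ l, Tendsto g (𝓝[>] 0) (𝓝 l) ∧
      ∀ h, 0 < h → |l - A h| ≤ e h ∧ ∀ y, 0 < y → y ≤ 1 → |g y - l| ≤ 2 * e h + C h * y := by
  have hev : ∀ᶠ y : ℝ in 𝓝[>] 0, 0 < y ∧ y ≤ 1 := by
    filter_upwards [Ioc_mem_nhdsGT (zero_lt_one' ℝ)] with y hy using hy
  have hC : ∀ h, Tendsto (fun y : ℝ => C h * y) (𝓝[>] 0) (𝓝 0) := fun h => by
    have : Tendsto (fun y : ℝ => C h * y) (𝓝 0) (𝓝 (C h * 0)) := tendsto_id.const_mul _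
    rw [mul_zero] at this
    exact this.mono_left nhdsWithin_le_nhds
  obtain ⟨l, hl⟩ : ∃ l, Tendsto g (𝓝[>] 0) (𝓝 l) := by
    refine cauchy_map_iff_exists_tendsto.1 (Metric.cauchy_iff.2 ⟨inferInstance, fun ε hε => ?_⟩)
    obtain ⟨h₀, hh1, hh2⟩ := ((he.eventually (gt_mem_nhds (by positivity : 0 < ε / 4))).and
      self_mem_nhdsWithin).exists
    have hh2 : 0 < h₀ := hh2
    refine ⟨g '' {y | (0 < y ∧ y ≤ 1) ∧ C h₀ * y < ε / 4}, image_mem_map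
      (hev.and ((hC h₀).eventually (gt_mem_nhds (by positivity)))), ?_⟩
    rintro _ ⟨y, ⟨hy, hy1⟩, rfl⟩ _ ⟨y', ⟨hy', hy1'⟩, rfl⟩
    have a1 := abs_le.1 (h h₀ hh2 y hy.1 hy.2)
    have a2 := abs_le.1 (h h₀ hh2 y' hy'.1 hy'.2)
    rw [Real.dist_eq, abs_lt]
    constructor <;> linarith [a1.1, a1.2, a2.1, a2.2]
  refine ⟨l, hl, fun h₀ hh => ?_⟩
  have h1 : |l - A h₀| ≤ e h₀ := by
    have := (hC h₀).const_add (e h₀)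
    rw [add_zero] at this
    refine le_of_tendsto_of_tendsto (hl.sub_const (A h₀)).abs this ?_
    filter_upwards [hev] with y hy using h h₀ hh y hy.1 hy.2
  refine ⟨h1, fun y hy hy1 => ?_⟩
  have a1 := abs_le.1 h1
  have a2 := abs_le.1 (h h₀ hh y hy hy1)
  rw [abs_le]
  constructor <;> linarith [a1.1, a1.2, a2.1, a2.2]

/-- A solution of the extension problem together with tangential Lipschitz bounds. -/
structure RegularExt (β d c K1 K2 K3 : ℝ) (φ : ℝ → ℝ) (u ut utt uy uyy : ℝ → ℝ → ℝ) : Prop where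
  sol : ExtSol β d u ut utt uy uyy (fun t => φ (u t 0))
  beta_pos : 0 < β
  beta_le : β ≤ 1 / 2
  c_nonneg : 0 ≤ c
  bdd : ∀ t y, 0 ≤ y → |u t y| ≤ 1
  eqn : ∀ t y, 0 < y → extResidual c β ut utt uy uyy t y = 0
  lip_u : ∀ t s y, 0 ≤ y → |u t y - u s y| ≤ K1 * |t - s|
  lip_ut : ∀ t s y, 0 < y → |ut t y - ut s y| ≤ K2 * |t - s|
  lip_utt : ∀ t s y, 0 < y → |utt t y - utt s y| ≤ K3 * |t - s|

variable {β d c K1 K2 K3 : ℝ} {φ : ℝ → ℝ} {u ut utt uy uyy : ℝ → ℝ → ℝ}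

namespace RegularExt

lemma abs_ut_le (H : RegularExt β d c K1 K2 K3 φ u ut utt uy uyy) (t : ℝ) {y : ℝ} (hy : 0 < y) :
    |ut t y| ≤ K1 :=
  abs_le_of_lipschitz (H.sol.dt t y hy) fun t s => H.lip_u t s y hy.le

lemma abs_utt_le (H : RegularExt β d c K1 K2 K3 φ u ut utt uy uyy) (t : ℝ) {y : ℝ} (hy : 0 < y) :
    |utt t y| ≤ K2 :=
  abs_le_of_lipschitz (H.sol.dtt t y hy) fun t s => H.lip_ut t s y hy

lemma abs_tangential_le (H : RegularExt β d c K1 K2 K3 φ u ut utt uy uyy) (t : ℝ) {y : ℝ}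
    (hy : 0 < y) : |utt t y + c * tanh t * ut t y| ≤ K2 + c * K1 := by
  refine (abs_add_le _ _).trans (add_le_add (H.abs_utt_le t hy) ?_)
  rw [abs_mul, abs_mul, abs_of_nonneg H.c_nonneg, mul_assoc]
  refine mul_le_mul_of_nonneg_left ?_ H.c_nonneg
  calc _ ≤ 1 * K1 := mul_le_mul (abs_tanh_le_one t) (H.abs_ut_le t hy) (abs_nonneg _) zero_le_one
    _ = K1 := one_mul _

lemma hasDerivAt_conormal (H : RegularExt β d c K1 K2 K3 φ u ut utt uy uyy) (t : ℝ) {y : ℝ}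
    (hy : 0 < y) : HasDerivAt (fun y => y ^ (β - 1) * uy t y)
      (-(y ^ (β - 1) * (utt t y + c * tanh t * ut t y))) y := by
  have h1 := (hasDerivAt_rpow_const (p := β - 1) (Or.inl hy.ne')).mul (H.sol.dyy t y hy)
  refine h1.congr_deriv ?_
  have h2 := H.eqn t y hy
  unfold extResidual at h2
  rw [show uyy t y = -((β - 1) / y * uy t y + utt t y + c * tanh t * ut t y) by linarith,
    rpow_sub_one hy.ne']
  field_simp
  ring

lemma abs_conormal_one_le (H : RegularExt β d c K1 K2 K3 φ u ut utt uy uyy) (t : ℝ) :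
    |uy t 1| ≤ 2 + (K2 + c * K1) := by
  set ω := K2 + c * K1
  obtain ⟨η, hη, hη2⟩ := exists_hasDerivAt_eq_slope (fun y => u t y) (fun y => uy t y)
    (one_lt_two) (fun y hy => (H.sol.dy t y (by linarith [hy.1])).continuousAt.continuousWithinAt)
    (fun y hy => H.sol.dy t y (by linarith [hy.1]))
  have hpow : ∀ y : ℝ, 1 ≤ y → y ^ (β - 1) ≤ 1 := fun y hy =>
    rpow_le_one_of_one_le_of_nonpos hy (by linarith [H.beta_le])
  have h1 : |η ^ (β - 1) * uy t η| ≤ 2 := by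
    rw [abs_mul, abs_of_nonneg (rpow_nonneg (by linarith [hη.1]) _)]
    have h2 : |uy t η| ≤ 2 := by
      have a1 := abs_le.1 (H.bdd t 2 zero_le_two)
      have a2 := abs_le.1 (H.bdd t 1 zero_le_one)
      rw [hη2, abs_le]
      constructor <;> linarith [a1.1, a1.2, a2.1, a2.2]
    calc _ ≤ 1 * 2 := mul_le_mul (hpow η hη.1.le) h2 (abs_nonneg _) zero_le_one
      _ = 2 := one_mul _
  have h3 := abs_sub_le_sub_of_deriv_le hη.1.le
    (fun r hr => H.hasDerivAt_conormal t (by linarith [hr.1]))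
    (fun r _ => (hasDerivAt_id r).const_mul ω) (fun r hr => by
      have hr0 : 0 < r := by linarith [hr.1]
      rw [abs_neg, abs_mul, abs_of_nonneg (rpow_nonneg hr0.le _), mul_comm]
      exact mul_le_mul (H.abs_tangential_le t hr0) (hpow r hr.1) (rpow_nonneg hr0.le _)
        ((abs_nonneg _).trans (H.abs_tangential_le t hr0)))
  have hω : 0 ≤ ω := (abs_nonneg _).trans (H.abs_tangential_le t one_pos)
  simp only [one_rpow, one_mul, id] at h3
  have h4 : ω * η - ω * 1 ≤ ω := by nlinarith [hη.2]
  have a1 := abs_le.1 h1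
  have a2 := abs_le.1 h3
  rw [abs_le]
  constructor <;> linarith [a1.1, a1.2, a2.1, a2.2]

lemma abs_uy_le (H : RegularExt β d c K1 K2 K3 φ u ut utt uy uyy) (t : ℝ) {y : ℝ} (hy : 0 < y)
    (hy1 : y ≤ 1) : |uy t y| ≤ 2 + 3 * (K2 + c * K1) := by
  set ω := K2 + c * K1 with hω_def
  have hω : 0 ≤ ω := (abs_nonneg _).trans (H.abs_tangential_le t one_pos)
  have h3 := abs_sub_le_sub_of_deriv_le (Y := fun r => ω * (-2 * r ^ (-(1 / 2) : ℝ)))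
    (Y' := fun r => ω * r ^ (-(3 / 2) : ℝ)) hy1
    (fun r hr => H.hasDerivAt_conormal t (by linarith [hr.1]))
    (fun r hr => by
      have := ((hasDerivAt_rpow_const (p := -(1 / 2)) (Or.inl (by linarith [hr.1] :
        r ≠ 0))).const_mul (-2)).const_mul ω
      refine this.congr_deriv ?_
      rw [show (-(1 / 2) - 1 : ℝ) = -(3 / 2) by norm_num]
      ring) (fun r hr => by
      have hr0 : 0 < r := by linarith [hr.1]
      rw [abs_neg, abs_mul, abs_of_nonneg (rpow_nonneg hr0.le _), mul_comm]
      exact mul_le_mul (H.abs_tangential_le t hr0) (rpow_le_rpow_of_exponent_ge hr0 hr.2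
        (by linarith [H.beta_pos])) (rpow_nonneg hr0.le _) hω)
  have h4 := H.abs_conormal_one_le t
  simp only [one_rpow, one_mul] at h3
  have hp : 1 ≤ y ^ (-(1 / 2) : ℝ) := one_le_rpow_of_pos_of_le_one_of_nonpos hy hy1 (by norm_num)
  have h5 : |y ^ (β - 1) * uy t y| ≤ (2 + 3 * ω) * y ^ (-(1 / 2) : ℝ) := by
    have a1 := abs_le.1 h4
    have a2 := abs_le.1 h3
    have h6 : 2 + ω ≤ (2 + ω) * y ^ (-(1 / 2) : ℝ) := le_mul_of_one_le_right (by linarith) hp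
    rw [abs_le]
    constructor <;> nlinarith [a1.1, a1.2, a2.1, a2.2]
  have h6 : uy t y = y ^ (1 - β) * (y ^ (β - 1) * uy t y) := by
    rw [← mul_assoc, ← rpow_add hy]; simp
  rw [h6, abs_mul, abs_of_nonneg (rpow_nonneg hy.le _)]
  calc _ ≤ y ^ (1 - β) * ((2 + 3 * ω) * y ^ (-(1 / 2) : ℝ)) :=
        mul_le_mul_of_nonneg_left h5 (rpow_nonneg hy.le _)
    _ = (2 + 3 * ω) * y ^ (1 / 2 - β) := by
        rw [mul_left_comm, ← rpow_add hy]; ring_nf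
    _ ≤ (2 + 3 * ω) * 1 := mul_le_mul_of_nonneg_left
        (rpow_le_one hy.le hy1 (by linarith [H.beta_le])) (by linarith)
    _ = _ := mul_one _

lemma abs_sub_trace_le (H : RegularExt β d c K1 K2 K3 φ u ut utt uy uyy) (t : ℝ) {y : ℝ}
    (hy : 0 < y) (hy1 : y ≤ 1) : |u t y - u t 0| ≤ (2 + 3 * (K2 + c * K1)) * y := by
  obtain ⟨η, hη, hη2⟩ := exists_hasDerivAt_eq_slope (fun y => u t y) (fun y => uy t y) hy
    ((H.sol.slice_cont t).mono fun x hx => hx.1) (fun y hy => H.sol.dy t y hy.1)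
  have h1 : u t y - u t 0 = uy t η * y := by
    rw [hη2, sub_zero, div_mul_cancel₀ _ hy.ne']
  rw [h1, abs_mul, abs_of_pos hy]
  exact mul_le_mul_of_nonneg_right (H.abs_uy_le t hη.1 (by linarith [hη.2])) hy.le

/-- Existence and regularity of the trace, with quantitative attainment of its derivatives. -/
lemma exists_trace_derivs (H : RegularExt β d c K1 K2 K3 φ u ut utt uy uyy) :
    ∃ w1 w2 : ℝ → ℝ, (∀ t, HasDerivAt (fun s => u s 0) (w1 t) t) ∧
      (∀ t, HasDerivAt w1 (w2 t) t) ∧ (∀ t, |w1 t| ≤ K1) ∧ (∀ t, |w2 t| ≤ K2) ∧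
      Continuous w2 ∧
      ∀ h, 0 < h → ∀ t y, 0 < y → y ≤ 1 →
        |ut t y - w1 t| ≤ 2 * (K2 * h) + 2 * (2 + 3 * (K2 + c * K1)) / h * y ∧
        |utt t y - w2 t| ≤ 2 * (2 * K3 * h) + 4 * (2 + 3 * (K2 + c * K1)) / h ^ 2 * y := by
  set C := 2 + 3 * (K2 + c * K1)
  have hlin : ∀ K : ℝ, Tendsto (fun h : ℝ => K * h) (𝓝[>] 0) (𝓝 0) := fun K => by
    have : Tendsto (fun y : ℝ => K * y) (𝓝 0) (𝓝 (K * 0)) := tendsto_id.const_mul _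
    rw [mul_zero] at this
    exact this.mono_left nhdsWithin_le_nhds
  have h1 : ∀ t, ∃ l, Tendsto (fun y => ut t y) (𝓝[>] 0) (𝓝 l) ∧
      ∀ h, 0 < h → |l - (u (t + h) 0 - u t 0) / h| ≤ K2 * h ∧ ∀ y, 0 < y → y ≤ 1 →
        |ut t y - l| ≤ 2 * (K2 * h) + 2 * C / h * y := by
    intro t
    refine exists_limit_of_approx (fun h hh y hy hy1 => ?_) (hlin K2)
    have a1 := abs_le.1 (abs_first_order_le (fun x => H.sol.dt x y hy)
      (fun t s => H.lip_ut t s y hy) (t := t) hh.le)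
    have a2 := abs_le.1 (H.abs_sub_trace_le t hy hy1)
    have a3 := abs_le.1 (H.abs_sub_trace_le (t + h) hy hy1)
    rw [show ut t y - (u (t + h) 0 - u t 0) / h = (h * ut t y - (u (t + h) 0 - u t 0)) / h by
      field_simp, abs_div, abs_of_pos hh, div_le_iff₀ hh,
      show (K2 * h + 2 * C / h * y) * h = K2 * h ^ 2 + 2 * (C * y) by field_simp, abs_le]
    constructor <;> linarith [a1.1, a1.2, a2.1, a2.2, a3.1, a3.2]
  have h2 : ∀ t, ∃ l, Tendsto (fun y => utt t y) (𝓝[>] 0) (𝓝 l) ∧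
      ∀ h, 0 < h → |l - (u (t + 2 * h) 0 - 2 * u (t + h) 0 + u t 0) / h ^ 2| ≤ 2 * K3 * h ∧
        ∀ y, 0 < y → y ≤ 1 → |utt t y - l| ≤ 2 * (2 * K3 * h) + 4 * C / h ^ 2 * y := by
    intro t
    refine exists_limit_of_approx (fun h hh y hy hy1 => ?_) (hlin (2 * K3))
    have a1 := abs_le.1 (abs_second_diff_quot_sub_le (fun x => H.sol.dt x y hy)
      (fun x => H.sol.dtt x y hy) (fun t s => H.lip_utt t s y hy) (t := t) hh)
    have a2 := abs_le.1 (H.abs_sub_trace_le t hy hy1)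
    have a3 := abs_le.1 (H.abs_sub_trace_le (t + h) hy hy1)
    have a4 := abs_le.1 (H.abs_sub_trace_le (t + 2 * h) hy hy1)
    have hh2 : 0 < h ^ 2 := by positivity
    have a5 : |(u (t + 2 * h) y - 2 * u (t + h) y + u t y) / h ^ 2 -
        (u (t + 2 * h) 0 - 2 * u (t + h) 0 + u t 0) / h ^ 2| ≤ 4 * C / h ^ 2 * y := by
      rw [← sub_div, abs_div, abs_of_pos hh2, div_le_iff₀ hh2,
        show 4 * C / h ^ 2 * y * h ^ 2 = 4 * (C * y) by field_simp, abs_le]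
      constructor <;> linarith [a2.1, a2.2, a3.1, a3.2, a4.1, a4.2]
    have a5 := abs_le.1 a5
    rw [abs_le]
    constructor <;> linarith [a1.1, a1.2, a5.1, a5.2]
  choose w1 hw1 hw1' using h1
  choose w2 hw2 hw2' using h2
  have hunif : TendstoUniformly (fun y t => utt t y) w2 (𝓝[>] 0) := by
    rw [Metric.tendstoUniformly_iff]
    intro ε hε
    obtain ⟨h, hh1, hh2⟩ := (((hlin (4 * K3)).eventually (gt_mem_nhds (by positivity :
      0 < ε / 2))).and self_mem_nhdsWithin).exists
    filter_upwards [(hlin (4 * C / h ^ 2)).eventually (gt_mem_nhds (by positivity : 0 < ε / 2)),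
      Ioc_mem_nhdsGT (zero_lt_one' ℝ)] with y hy1 hy2 t
    rw [dist_comm, Real.dist_eq]
    refine ((hw2' t h hh2).2 y hy2.1 hy2.2).trans_lt ?_
    linarith
  have hunif1 : TendstoUniformly (fun y t => ut t y) w1 (𝓝[>] 0) := by
    rw [Metric.tendstoUniformly_iff]
    intro ε hε
    obtain ⟨h, hh1, hh2⟩ := (((hlin (2 * K2)).eventually (gt_mem_nhds (by positivity :
      0 < ε / 2))).and self_mem_nhdsWithin).exists
    filter_upwards [(hlin (2 * C / h)).eventually (gt_mem_nhds (by positivity : 0 < ε / 2)),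
      Ioc_mem_nhdsGT (zero_lt_one' ℝ)] with y hy1 hy2 t
    rw [dist_comm, Real.dist_eq]
    refine ((hw1' t h hh2).2 y hy2.1 hy2.2).trans_lt ?_
    linarith
  have hev : ∀ᶠ y : ℝ in 𝓝[>] 0, 0 < y := self_mem_nhdsWithin
  refine ⟨w1, w2, fun t => ?_, fun t => ?_, fun t => ?_, fun t => ?_, ?_, ?_⟩
  · refine hasDerivAt_of_tendstoUniformly hunif1
      (hev.mono fun y hy t => H.sol.dt t y hy) (fun x => ?_) t
    have := H.sol.slice_cont x 0 (le_refl (0:ℝ))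
    exact this.tendsto.mono_left (nhdsWithin_mono _ Ioi_subset_Ici_self)
  · exact hasDerivAt_of_tendstoUniformly hunif
      (hev.mono fun y hy t => H.sol.dtt t y hy) hw1 t
  · exact le_of_tendsto (hw1 t).abs (hev.mono fun y hy => H.abs_ut_le t hy)
  · exact le_of_tendsto (hw2 t).abs (hev.mono fun y hy => H.abs_utt_le t hy)
  · have hl : ∀ t s, |w2 t - w2 s| ≤ K3 * |t - s| := fun t s =>
      le_of_tendsto ((hw2 t).sub (hw2 s)).abs (hev.mono fun y hy => H.lip_utt t s y hy)
    have hK3 : 0 ≤ K3 := by simpa using (abs_nonneg _).trans (hl 1 0)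
    exact (LipschitzWith.of_dist_le_mul (K := ⟨K3, hK3⟩) hl).continuous
  · exact fun h hh t y hy hy1 => ⟨(hw1' t h hh).2 y hy hy1, (hw2' t h hh).2 y hy hy1⟩

/-- The trace solves the limiting ODE up to an explicit error. -/
lemma abs_ode_error_le (H : RegularExt β d c K1 K2 K3 φ u ut utt uy uyy) (hd : 0 < d)
    (hdβ : d ≤ 2 * β) {w1 w2 : ℝ → ℝ} (hw1 : ∀ t, |w1 t| ≤ K1) (hw2 : ∀ t, |w2 t| ≤ K2)
    {e Q : ℝ} (he : 0 ≤ e) (hQ : 0 ≤ Q)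
    (h : ∀ t y, 0 < y → y ≤ 1 → |ut t y - w1 t| ≤ e + Q * y ∧ |utt t y - w2 t| ≤ e + Q * y)
    (t : ℝ) :
    |w2 t + c * tanh t * w1 t - φ (u t 0)| ≤ |d / β - 1| * (K2 + c * K1) +
      d * (2 + (K2 + c * K1)) + 2 * ((1 + c) * e) + d * ((1 + c) * Q) := by
  have hβ := H.beta_pos
  have hc := H.c_nonneg
  have htanh : ∀ x b : ℝ, |x| ≤ b → |c * tanh t * x| ≤ c * b := fun x b hx => by
    rw [abs_mul, abs_mul, abs_of_nonneg hc, mul_assoc]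
    refine mul_le_mul_of_nonneg_left ?_ hc
    calc _ ≤ 1 * b := mul_le_mul (abs_tanh_le_one t) hx (abs_nonneg _) zero_le_one
      _ = b := one_mul _
  set ω₀ := w2 t + c * tanh t * w1 t with hω₀
  have hω₀b : |ω₀| ≤ K2 + c * K1 := (abs_add_le _ _).trans (add_le_add (hw2 t) (htanh _ _ (hw1 t)))
  have hdiff : ∀ y, 0 < y → y ≤ 1 → |ω₀ - (utt t y + c * tanh t * ut t y)| ≤
      (1 + c) * e + (1 + c) * Q * y := by
    intro y hy hy1
    have a1 := abs_le.1 (h t y hy hy1).2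
    have a2 := abs_le.1 (htanh _ _ (h t y hy hy1).1)
    rw [hω₀, abs_le]
    constructor <;> linarith [a1.1, a1.2, a2.1, a2.2]
  have hstep : ∀ x, 0 < x → x ≤ 1 → |(uy t 1 + ω₀ / β) - (x ^ (β - 1) * uy t x + ω₀ * x ^ β / β)| ≤
      ((1 + c) * e / β + (1 + c) * Q) - ((1 + c) * e * x ^ β / β + (1 + c) * Q * x) := by
    intro x hx hx1
    have hp : ∀ r, x ≤ r → HasDerivAt (fun r => r ^ β / β) (r ^ (β - 1)) r := fun r hr => by
      refine ((hasDerivAt_rpow_const (p := β) (Or.inl (by linarith))).div_const β).congr_deriv ?_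
      field_simp
    have := abs_sub_le_sub_of_deriv_le (X := fun r => r ^ (β - 1) * uy t r + ω₀ * (r ^ β / β))
      (Y := fun r => (1 + c) * e * (r ^ β / β) + (1 + c) * Q * r)
      (X' := fun r => -(r ^ (β - 1) * (utt t r + c * tanh t * ut t r)) + ω₀ * r ^ (β - 1))
      (Y' := fun r => (1 + c) * e * r ^ (β - 1) + (1 + c) * Q * 1) hx1
      (fun r hr => (H.hasDerivAt_conormal t (by linarith [hr.1])).add ((hp r hr.1).const_mul ω₀))
      (fun r hr => ((hp r hr.1).const_mul _).add ((hasDerivAt_id r).const_mul _)) (fun r hr => by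
        have hr0 : 0 < r := by linarith [hr.1]
        have hrp := rpow_nonneg hr0.le (β - 1)
        rw [show -(r ^ (β - 1) * (utt t r + c * tanh t * ut t r)) + ω₀ * r ^ (β - 1) =
          r ^ (β - 1) * (ω₀ - (utt t r + c * tanh t * ut t r)) by ring, abs_mul,
          abs_of_nonneg hrp]
        have h1 := mul_le_mul_of_nonneg_left (hdiff r hr0 hr.2) hrp
        have h2 : r ^ (β - 1) * r ≤ 1 := by
          rw [← rpow_add_one hr0.ne', sub_add_cancel]
          exact rpow_le_one hr0.le hr.2 hβ.le
        have h3 : 0 ≤ (1 + c) * Q := by positivity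
        have h4 := mul_le_mul_of_nonneg_left h2 h3
        linarith)
    simp only [one_rpow, one_mul, mul_one] at this
    convert this using 2 <;> ring
  have hlim : |(uy t 1 + ω₀ / β) - (φ (u t 0) / d + ω₀ * 0 / β)| ≤
      ((1 + c) * e / β + (1 + c) * Q) - ((1 + c) * e * 0 / β + (1 + c) * Q * 0) := by
    have hpow : Tendsto (fun x : ℝ => x ^ β) (𝓝[>] 0) (𝓝 0) := by
      have h2 := (continuous_rpow_const (q := β) hβ.le).tendsto 0
      rw [zero_rpow hβ.ne'] at h2
      exact h2.mono_left nhdsWithin_le_nhds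
    have hid : Tendsto (fun x : ℝ => x) (𝓝[>] 0) (𝓝 0) := nhdsWithin_le_nhds
    refine le_of_tendsto_of_tendsto
      (((H.sol.bc t).add ((hpow.const_mul ω₀).div_const β)).const_sub _).abs
      ((((hpow.const_mul _).div_const β).add (hid.const_mul _)).const_sub _) ?_
    filter_upwards [Ioc_mem_nhdsGT (zero_lt_one' ℝ)] with x hx using hstep x hx.1 hx.2
  simp only [mul_zero, zero_div, add_zero, sub_zero] at hlim
  have h1 := H.abs_conormal_one_le t
  have h2 : ω₀ - φ (u t 0) = d * ((uy t 1 + ω₀ / β) - φ (u t 0) / d) + -(d * uy t 1) +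
      -((d / β - 1) * ω₀) := by
    field_simp; ring
  rw [h2]
  refine (abs_add_three _ _ _).trans ?_
  rw [abs_neg, abs_neg, abs_mul, abs_mul, abs_mul, abs_of_pos hd]
  have h3 := mul_le_mul_of_nonneg_left hlim hd.le
  have h4 := mul_le_mul_of_nonneg_left h1 hd.le
  have h5 := mul_le_mul_of_nonneg_left hω₀b (abs_nonneg (d / β - 1))
  have h6 : d * ((1 + c) * e / β) ≤ 2 * ((1 + c) * e) := by
    rw [← mul_div_assoc, div_le_iff₀ hβ]
    nlinarith [mul_nonneg (by linarith : 0 ≤ 1 + c) he]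
  linarith

end RegularExt

end Trace

section ApproximateODE

/-- `w` solves `w'' + c tanh t · w' = Φ(w)` up to an error `ε`, with `|w| ≤ 1`. -/
structure ApproxODE (c ε : ℝ) (Φ w w1 w2 : ℝ → ℝ) : Prop where
  d1 : ∀ t, HasDerivAt w (w1 t) t
  d2 : ∀ t, HasDerivAt w1 (w2 t) t
  bdd : ∀ t, |w t| ≤ 1
  err : ∀ t, |w2 t + c * tanh t * w1 t - Φ (w t)| ≤ ε

lemma RegularExt.lip_nonneg {β d c K1 K2 K3 : ℝ} {φ : ℝ → ℝ} {u ut utt uy uyy : ℝ → ℝ → ℝ}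
    (H : RegularExt β d c K1 K2 K3 φ u ut utt uy uyy) : 0 ≤ K1 ∧ 0 ≤ K2 ∧ 0 ≤ K3 := by
  have h1 := H.lip_u 1 0 1 zero_le_one
  have h2 := H.lip_ut 1 0 1 zero_lt_one
  have h3 := H.lip_utt 1 0 1 zero_lt_one
  simp only [sub_zero, abs_one, mul_one] at h1 h2 h3
  exact ⟨(abs_nonneg _).trans h1, (abs_nonneg _).trans h2, (abs_nonneg _).trans h3⟩

lemma RegularExt.exists_approxODE {c K1 K2 K3 ε : ℝ} (hc : 0 ≤ c) (hK1 : 0 ≤ K1) (hK2 : 0 ≤ K2)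
    (hK3 : 0 ≤ K3) (hε : 0 < ε) :
    ∃ δ > 0, ∀ (β d : ℝ) (φ : ℝ → ℝ) (u ut utt uy uyy : ℝ → ℝ → ℝ),
      RegularExt β d c K1 K2 K3 φ u ut utt uy uyy → 0 < d → d ≤ δ → |d / β - 1| ≤ δ →
      ∃ w1 w2, ApproxODE c ε φ (fun t => u t 0) w1 w2 ∧ ∀ t, |w1 t| ≤ K1 := by
  set P := K2 + c * K1 with hP
  have hP0 : 0 ≤ P := by positivity
  set h := ε / (4 * (1 + c) * (2 * K2 + 4 * K3 + 1)) with hh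
  have hh0 : 0 < h := by positivity
  set Q := 2 * (2 + 3 * P) / h + 4 * (2 + 3 * P) / h ^ 2 with hQ
  have hQ0 : 0 ≤ Q := by positivity
  set S := P + (2 + P) + (1 + c) * Q + 1 with hS
  have hS0 : 0 < S := by positivity
  refine ⟨min 1 (ε / (2 * S)), by positivity, fun β d φ u ut utt uy uyy H hd hdδ hrat => ?_⟩
  have hβ := H.beta_pos
  obtain ⟨w1, w2, hw1, hw2, b1, b2, -, happ⟩ := H.exists_trace_derivs
  refine ⟨w1, w2, ⟨hw1, hw2, fun t => H.bdd t 0 le_rfl, fun t => ?_⟩, b1⟩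
  have hdβ : d ≤ 2 * β := by
    have : d / β ≤ 2 := by
      have := (abs_le.1 (hrat.trans (min_le_left _ _))).2
      linarith
    exact (div_le_iff₀ hβ).1 this
  have he : 0 ≤ (2 * K2 + 4 * K3) * h := by positivity
  refine (H.abs_ode_error_le hd hdβ b1 b2 he hQ0 (fun t y hy hy1 => ?_) t).trans ?_
  · obtain ⟨h1, h2⟩ := happ h hh0 t y hy hy1
    have e1 : 0 ≤ 2 * (2 + 3 * P) / h * y := by positivity
    have e2 : 0 ≤ 4 * (2 + 3 * P) / h ^ 2 * y := by positivity
    have e3 : 0 ≤ K2 * h := by positivity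
    have e4 : 0 ≤ K3 * h := by positivity
    rw [hQ, add_mul]
    rw [← hP] at h1 h2
    constructor <;> linarith
  · have r := hrat.trans (min_le_right _ _)
    have q := hdδ.trans (min_le_right _ _)
    have a1 : |d / β - 1| * P ≤ ε / (2 * S) * P := by gcongr
    have a2 : d * (2 + P) ≤ ε / (2 * S) * (2 + P) := by gcongr
    have a3 : d * ((1 + c) * Q) ≤ ε / (2 * S) * ((1 + c) * Q) := by gcongr
    have a4 : 2 * ((1 + c) * ((2 * K2 + 4 * K3) * h)) ≤ ε / 2 := by
      have : 2 * ((1 + c) * ((2 * K2 + 4 * K3 + 1) * h)) = ε / 2 := by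
        rw [hh]; field_simp; norm_num
      have : 0 ≤ (1 + c) * h := by positivity
      linarith
    have a5 : ε / (2 * S) * S = ε / 2 := by field_simp
    have a6 : 0 ≤ ε / (2 * S) := by positivity
    have a7 : ε / (2 * S) * P + ε / (2 * S) * (2 + P) + ε / (2 * S) * ((1 + c) * Q)
        + ε / (2 * S) = ε / 2 := by rw [← a5, hS]; ring
    linarith

end ApproximateODE

section Constants

lemma dgamma_pos {γ : ℝ} (h : γ ∈ Ioo (0 : ℝ) 1) : 0 < dgamma γ := by
  have h1 := Real.Gamma_pos_of_pos h.1
  have h2 := Real.Gamma_pos_of_pos (sub_pos.2 h.2)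
  unfold dgamma; positivity

lemma tendsto_dgamma_div : Tendsto (fun γ : ℝ => dgamma γ / (2 * (1 - γ))) (𝓝[<] 1) (𝓝 1) := by
  have hcont : ContinuousAt
      (fun γ : ℝ => (2 : ℝ) ^ (2 * γ - 1) * Real.Gamma γ / (2 * Real.Gamma (2 - γ))) 1 := by
    have hg : ∀ x : ℝ, x = 1 → ContinuousAt Real.Gamma x := fun x hx => by
      subst hx
      refine (Real.differentiableAt_Gamma fun m => ?_).continuousAt
      have : (0 : ℝ) ≤ m := m.cast_nonneg
      linarith
    have h2 : ContinuousAt (fun γ : ℝ => Real.Gamma (2 - γ)) 1 :=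
      ContinuousAt.comp (f := fun γ : ℝ => 2 - γ) (hg _ (by norm_num)) (by fun_prop)
    have h1 : ContinuousAt (fun γ : ℝ => (2 : ℝ) ^ (2 * γ - 1)) 1 :=
      ContinuousAt.rpow continuousAt_const (by fun_prop) (by norm_num)
    refine (h1.mul (hg 1 rfl)).div (h2.const_mul 2) ?_
    norm_num [Real.Gamma_one]
  have hv := hcont.tendsto
  norm_num [Real.Gamma_one] at hv
  refine (hv.mono_left nhdsWithin_le_nhds).congr' ?_
  filter_upwards [self_mem_nhdsWithin] with γ hγ
  have hγ : γ < 1 := hγ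
  have h0 : 1 - γ ≠ 0 := (sub_pos.2 hγ).ne'
  have h1 : Real.Gamma (2 - γ) = (1 - γ) * Real.Gamma (1 - γ) := by
    rw [← Real.Gamma_add_one h0]; congr 1; ring
  have h2 := (Real.Gamma_pos_of_pos (sub_pos.2 hγ)).ne'
  rw [h1, dgamma]
  field_simp

lemma tendsto_dgamma : Tendsto dgamma (𝓝[<] 1) (𝓝 0) := by
  have h1 : Tendsto (fun γ : ℝ => 2 * (1 - γ)) (𝓝[<] 1) (𝓝 0) := by
    have : Tendsto (fun γ : ℝ => 2 * (1 - γ)) (𝓝 1) (𝓝 (2 * (1 - 1))) :=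
      (tendsto_const_nhds.sub tendsto_id).const_mul 2
    rw [sub_self, mul_zero] at this
    exact this.mono_left nhdsWithin_le_nhds
  have := tendsto_dgamma_div.mul h1
  rw [one_mul] at this
  refine this.congr' ?_
  filter_upwards [self_mem_nhdsWithin] with γ hγ
  have hγ : γ < 1 := hγ
  have h0 : 1 - γ ≠ 0 := (sub_pos.2 hγ).ne'
  field_simp

end Constants

section Setup

lemma hasDerivAt_slices {u : ℝ → ℝ → ℝ}
    (h : ContDiffOn ℝ 2 (fun p : ℝ × ℝ => u p.1 p.2) {p : ℝ × ℝ | 0 < p.2}) {t y : ℝ} (hy : 0 < y) :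
    HasDerivAt (fun s => u s y) (pt u t y) t ∧ HasDerivAt (fun s => pt u s y) (ptt u t y) t ∧
    HasDerivAt (fun x => u t x) (py u t y) y ∧ HasDerivAt (fun x => py u t x) (pyy u t y) y := by
  have hopen : IsOpen {p : ℝ × ℝ | 0 < p.2} := isOpen_lt continuous_const continuous_snd
  have ht : ContDiff ℝ 2 (fun s => u s y) := by
    rw [← contDiffOn_univ]
    exact h.comp (f := fun s : ℝ => (s, y)) (by fun_prop) fun s _ => hy
  have hx : ContDiffOn ℝ 2 (fun x => u t x) (Ioi 0) :=
    h.comp (f := fun x : ℝ => (t, x)) (by fun_prop) fun s hs => hs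
  have hx1 : ∀ x : ℝ, 0 < x → ContDiffAt ℝ 2 (fun x => u t x) x :=
    fun x hx0 => hx.contDiffAt (Ioi_mem_nhds hx0)
  have ht2 : ContDiff ℝ 1 (deriv fun s => u s y) := by
    have : ContDiff ℝ (1 + 1) (fun s => u s y) := ht
    exact (contDiff_succ_iff_deriv.1 this).2.2
  have hx2 : DifferentiableAt ℝ (deriv fun x => u t x) y := by
    have : ContDiffOn ℝ (1 + 1) (fun x => u t x) (Ioi 0) := hx
    exact ((((contDiffOn_succ_iff_deriv_of_isOpen isOpen_Ioi).1 this).2.2).differentiableOn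
      one_ne_zero).differentiableAt (Ioi_mem_nhds hy)
  exact ⟨(ht.differentiable two_ne_zero t).hasDerivAt,
    (ht2.differentiable one_ne_zero t).hasDerivAt,
    ((hx1 y hy).differentiableAt two_ne_zero).hasDerivAt, hx2.hasDerivAt⟩

lemma DoubleWell.exists_reactionBounds {F : ℝ → ℝ} (hF : DoubleWell F) :
    ∃ φ1 φ2 φ3 A B C, ReactionBounds (deriv F) φ1 φ2 φ3 A B C := by
  have hs : ∀ m, ContDiff ℝ (⊤ : ℕ∞) (iteratedDeriv m F) := fun m => by
    rw [iteratedDeriv_eq_iterate]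
    exact ContDiff.iterate_deriv m hF.1
  have hd : ∀ m x, HasDerivAt (iteratedDeriv m F) (iteratedDeriv (m + 1) F x) x := fun m x => by
    rw [iteratedDeriv_succ]
    exact ((hs m).differentiable (by simp) x).hasDerivAt
  have hb : ∀ m, ∃ A, ∀ x, |x| ≤ 1 → |iteratedDeriv m F x| ≤ A := fun m => by
    obtain ⟨A, hA⟩ := (isCompact_Icc (a := (-1 : ℝ)) (b := 1)).exists_bound_of_continuousOn
      (hs m).continuous.continuousOn
    exact ⟨A, fun x hx => hA x (abs_le.1 hx)⟩
  obtain ⟨A, hA⟩ := hb 2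
  obtain ⟨B, hB⟩ := hb 3
  obtain ⟨C, hC⟩ := hb 4
  rw [← iteratedDeriv_one (𝕜 := ℝ) (f := F)]
  exact ⟨_, _, _, A, B, C, hd 1, hd 2, hd 3, hA, hB, hC⟩

lemma exists_eventually_approxODE {n : ℕ} (hn : 2 ≤ n) {F : ℝ → ℝ} (hF : DoubleWell F)
    {γ : ℕ → ℝ} (hγ : ∀ k, γ k ∈ Ioo (0 : ℝ) 1) (hγ1 : Tendsto γ atTop (𝓝 1))
    {u : ℕ → ℝ → ℝ → ℝ} (hbdd : ∀ k, ∀ t y : ℝ, 0 ≤ y → |u k t y| < 1)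
    (hcont : ∀ k, ContinuousOn (fun p : ℝ × ℝ => u k p.1 p.2) {p : ℝ × ℝ | 0 ≤ p.2})
    (hsm : ∀ k, ContDiffOn ℝ 2 (fun p : ℝ × ℝ => u k p.1 p.2) {p : ℝ × ℝ | 0 < p.2})
    (heq : ∀ k, ∀ t y : ℝ, 0 < y → Ha n (1 - 2 * γ k) (u k) t y = 0)
    (hbc : ∀ k, ∀ t : ℝ, Tendsto (fun y : ℝ => y ^ (1 - 2 * γ k) * py (u k) t y)
      (𝓝[>] (0 : ℝ)) (𝓝 ((1 / dgamma (γ k)) * deriv F (u k t 0)))) :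
    ∃ K, ∀ ε > 0, ∀ᶠ k in atTop,
      ApproxODE ((n : ℝ) - 1) ε (deriv F) (fun t => u k t 0) (deriv fun s => u k s 0)
        (deriv (deriv fun s => u k s 0)) ∧ ∀ t, |deriv (fun s => u k s 0) t| ≤ K := by
  obtain ⟨φ1, φ2, φ3, A, B, C, hφ⟩ := hF.exists_reactionBounds
  have hc : (0 : ℝ) ≤ (n : ℝ) - 1 := by
    have : (2 : ℝ) ≤ n := by exact_mod_cast hn
    linarith
  have hγ2 : Tendsto γ atTop (𝓝[<] 1) :=
    tendsto_nhdsWithin_iff.2 ⟨hγ1, Eventually.of_forall fun k => (hγ k).2⟩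
  have hrat : Tendsto (fun k => |dgamma (γ k) / (2 * (1 - γ k)) - 1|) atTop (𝓝 0) := by
    have := ((tendsto_dgamma_div.comp hγ2).sub_const 1).abs
    simpa using this
  have hd0 := tendsto_dgamma.comp hγ2
  have hβ0 : Tendsto (fun k => 2 * (1 - γ k)) atTop (𝓝 0) := by
    simpa using (hγ1.const_sub 1).const_mul 2
  have hβA : Tendsto (fun k => 32 * (2 * A + 3) * (2 * (1 - γ k))) atTop (𝓝 0) := by
    simpa using hβ0.const_mul (32 * (2 * A + 3))
  have hreg : ∀ᶠ k in atTop, RegularExt (2 * (1 - γ k)) (dgamma (γ k)) ((n : ℝ) - 1)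
      (lip1 ((n : ℝ) - 1) A) (lip2 ((n : ℝ) - 1) A B) (lip3 ((n : ℝ) - 1) A B C) (deriv F)
      (u k) (pt (u k)) (ptt (u k)) (py (u k)) (pyy (u k)) := by
    filter_upwards [hβ0.eventually (gt_mem_nhds (by norm_num : (0 : ℝ) < 1 / 2)),
      hβA.eventually (gt_mem_nhds one_pos),
      hrat.eventually (gt_mem_nhds (by norm_num : (0 : ℝ) < 1 / 2))] with k h1 h2 h3
    have hβ : 0 < 2 * (1 - γ k) := by linarith [(hγ k).2]
    have hexp : 2 * (1 - γ k) - 1 = 1 - 2 * γ k := by ring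
    have hsol : ExtSol (2 * (1 - γ k)) (dgamma (γ k)) (u k) (pt (u k)) (ptt (u k)) (py (u k))
        (pyy (u k)) (fun t => deriv F (u k t 0)) :=
      ⟨hcont k, fun t y hy => (hasDerivAt_slices (hsm k) hy).1,
        fun t y hy => (hasDerivAt_slices (hsm k) hy).2.1,
        fun t y hy => (hasDerivAt_slices (hsm k) hy).2.2.1,
        fun t y hy => (hasDerivAt_slices (hsm k) hy).2.2.2, fun t => by
          rw [hexp, div_eq_inv_mul, ← one_div]; exact hbc k t⟩
    have heqn : ∀ t y, 0 < y → extResidual ((n : ℝ) - 1) (2 * (1 - γ k)) (pt (u k)) (ptt (u k))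
        (py (u k)) (pyy (u k)) t y = 0 := fun t y hy => by
      have := heq k t y hy
      unfold Ha at this
      rw [extResidual, hexp, ← this]
    have hdβ : 2 * (1 - γ k) ≤ 2 * dgamma (γ k) := by
      have : 1 / 2 ≤ dgamma (γ k) / (2 * (1 - γ k)) := by linarith [(abs_lt.1 h3).1]
      rw [le_div_iff₀ hβ] at this
      linarith
    obtain ⟨l1, l2, l3⟩ := hsol.tangential_bounds hφ hβ h1.le (dgamma_pos (hγ k)) hdβ hc h2.le
      (fun t y hy => (hbdd k t y hy).le) heqn
    exact ⟨hsol, hβ, h1.le, hc, fun t y hy => (hbdd k t y hy).le, heqn, l1, l2, l3⟩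
  obtain ⟨k₀, hk₀⟩ := hreg.exists
  obtain ⟨hK1, hK2, hK3⟩ := hk₀.lip_nonneg
  refine ⟨lip1 ((n : ℝ) - 1) A, fun ε hε => ?_⟩
  obtain ⟨δ, hδ, key⟩ := RegularExt.exists_approxODE hc hK1 hK2 hK3 hε
  filter_upwards [hreg, hd0.eventually (gt_mem_nhds hδ), hrat.eventually (gt_mem_nhds hδ)]
    with k h1 h2 h3
  obtain ⟨w1, w2, H, hb⟩ := key _ _ _ _ _ _ _ _ h1 (dgamma_pos (hγ k)) h2.le h3.le
  have e1 : (deriv fun s => u k s 0) = w1 := funext fun t => (H.d1 t).deriv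
  have e2 : deriv w1 = w2 := funext fun t => (H.d2 t).deriv
  rw [e1, e2]
  exact ⟨H, hb⟩

end Setup

section Wells

/-- A double well `F` with `F' = Φ`, where `Φ` is `A`-Lipschitz on `[-1,1]`. -/
structure Well (F Φ : ℝ → ℝ) (A : ℝ) : Prop where
  d : ∀ x, HasDerivAt F (Φ x) x
  cont : Continuous Φ
  lip : ∀ x y, |x| ≤ 1 → |y| ≤ 1 → |Φ x - Φ y| ≤ A * |x - y|
  pos : ∀ x ∈ Ioo (-1 : ℝ) 1, 0 < F x
  left : F (-1) = 0
  right : F 1 = 0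
  crit_left : Φ (-1) = 0
  crit_right : Φ 1 = 0
  nonpos : ∀ᶠ x in 𝓝[<] 1, Φ x ≤ 0

lemma Well.lip_const_nonneg {F Φ : ℝ → ℝ} {A : ℝ} (W : Well F Φ A) : 0 ≤ A := by
  have := (abs_nonneg _).trans (W.lip 1 0 (by norm_num) (by norm_num))
  simpa using this

lemma Well.nonneg {F Φ : ℝ → ℝ} {A : ℝ} (W : Well F Φ A) {x : ℝ} (hx : |x| ≤ 1) : 0 ≤ F x := by
  obtain ⟨h1, h2⟩ := abs_le.1 hx
  rcases h1.eq_or_lt with h | h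
  · rw [← h, W.left]
  rcases h2.eq_or_lt with h' | h'
  · rw [h', W.right]
  exact (W.pos x ⟨h, h'⟩).le

lemma monotone_tanh_real : Monotone Real.tanh :=
  monotone_of_hasDerivAt_nonneg (fun t => hasDerivAt_tanh_real t) fun t => by
    have := (sq_le_one_iff_abs_le_one _).2 (abs_tanh_le_one t)
    simp only [Pi.zero_apply]; linarith

lemma tanh_nonneg_of_nonneg {t : ℝ} (ht : 0 ≤ t) : 0 ≤ tanh t := by
  have := monotone_tanh_real ht
  rwa [Real.tanh_zero] at this

end Wells

section Energy

variable {F Φ w w1 w2 v v1 v2 : ℝ → ℝ} {A c ε ε' : ℝ}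

lemma ApproxODE.error_nonneg (H : ApproxODE c ε Φ w w1 w2) : 0 ≤ ε :=
  (abs_nonneg _).trans (H.err 0)

lemma ApproxODE.reflect (H : ApproxODE c ε Φ w w1 w2) :
    ApproxODE c ε (fun x => -Φ (-x)) (fun t => -w (-t)) (fun t => w1 (-t)) (fun t => -w2 (-t)) where
  d1 t := by
    have := ((H.d1 (-t)).comp t (hasDerivAt_neg t)).neg
    refine this.congr_deriv (by ring)
  d2 t := by
    have := (H.d2 (-t)).comp t (hasDerivAt_neg t)
    refine this.congr_deriv (by ring)
  bdd t := by rw [abs_neg]; exact H.bdd _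
  err t := by
    have := H.err (-t)
    rw [Real.tanh_neg] at this
    rw [neg_neg, ← abs_neg]
    convert this using 2
    ring

lemma ApproxODE.energy_ge_of_nonneg (W : ∀ x, HasDerivAt F (Φ x) x) (hF1 : F 1 = 0)
    (H : ApproxODE c ε Φ w w1 w2) (hc : 0 ≤ c) (hpos : ∀ t, 0 < w1 t)
    (hlim : Tendsto w atTop (𝓝 1)) {t : ℝ} (ht : 0 ≤ t) :
    -(2 * ε) ≤ w1 t ^ 2 / 2 - F (w t) := by
  have hanti : AntitoneOn (fun s => w1 s ^ 2 / 2 - F (w s) - ε * w s) (Ici 0) := by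
    have hd : ∀ s, HasDerivAt (fun s => w1 s ^ 2 / 2 - F (w s) - ε * w s)
        (w1 s * w2 s - Φ (w s) * w1 s - ε * w1 s) s := fun s => by
      have e1 := ((H.d2 s).pow 2).div_const 2
      have e2 := (W (w s)).comp s (H.d1 s)
      exact ((e1.sub e2).sub ((H.d1 s).const_mul ε)).congr_deriv (by push_cast; ring)
    refine antitoneOn_of_deriv_nonpos (convex_Ici 0)
      (fun s _ => (hd s).continuousAt.continuousWithinAt)
      (fun s _ => (hd s).differentiableAt.differentiableWithinAt) fun s hs => ?_
    rw [(hd s).deriv]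
    rw [interior_Ici] at hs
    have e1 := tanh_nonneg_of_nonneg (le_of_lt hs)
    have e2 := (abs_le.1 (H.err s)).2
    have e3 : 0 ≤ c * tanh s * w1 s := mul_nonneg (mul_nonneg hc e1) (hpos s).le
    have e4 : w2 s - Φ (w s) - ε ≤ 0 := by linarith
    have e5 := mul_nonpos_of_nonneg_of_nonpos (hpos s).le e4
    linarith
  have hFw : Tendsto (fun s => -F (w s) - ε * w s) atTop (𝓝 (-0 - ε * 1)) := by
    rw [← hF1]
    exact (((W 1).continuousAt.tendsto.comp hlim).neg).sub (hlim.const_mul ε)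
  have h1 : -0 - ε * 1 ≤ w1 t ^ 2 / 2 - F (w t) - ε * w t := by
    refine le_of_tendsto hFw ?_
    filter_upwards [eventually_ge_atTop t] with s hs
    have := hanti (mem_Ici.2 ht) (mem_Ici.2 (ht.trans hs)) hs
    simp only at this
    linarith [sq_nonneg (w1 s)]
  have h2 := mul_le_mul_of_nonneg_left (abs_le.1 (H.bdd t)).1 H.error_nonneg
  linarith

lemma ApproxODE.energy_ge (W : Well F Φ A) (H : ApproxODE c ε Φ w w1 w2) (hc : 0 ≤ c)
    (hpos : ∀ t, 0 < w1 t) (htop : Tendsto w atTop (𝓝 1)) (hbot : Tendsto w atBot (𝓝 (-1)))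
    (t : ℝ) : -(2 * ε) ≤ w1 t ^ 2 / 2 - F (w t) := by
  rcases le_total 0 t with ht | ht
  · exact H.energy_ge_of_nonneg W.d W.right hc hpos htop ht
  · have hd : ∀ x, HasDerivAt (fun x => F (-x)) (-Φ (-x)) x := fun x =>
      ((W.d (-x)).comp x (hasDerivAt_neg x)).congr_deriv (by ring)
    have hl : Tendsto (fun s => -w (-s)) atTop (𝓝 1) := by
      have := (hbot.comp tendsto_neg_atTop_atBot).neg
      rwa [neg_neg] at this
    have := H.reflect.energy_ge_of_nonneg hd W.left hc (fun s => hpos (-s)) hl (neg_nonneg.2 ht)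
    simpa using this

/-- Continuous dependence: stability of approximate solutions on the data at `t₀`. -/
lemma ApproxODE.stability (W : Well F Φ A) (H : ApproxODE c ε Φ w w1 w2)
    (H' : ApproxODE c ε' Φ v v1 v2) (hc : 0 ≤ c) (t₀ t : ℝ) :
    |w t - v t| ≤ (1 + c + A) *
      (|w t₀ - v t₀| + |w1 t₀ - v1 t₀| + (ε + ε')) * exp ((2 + 2 * c + A) * |t - t₀|) ∧
    |w1 t - v1 t| ≤ (1 + c + A) *
      (|w t₀ - v t₀| + |w1 t₀ - v1 t₀| + (ε + ε')) * exp ((2 + 2 * c + A) * |t - t₀|) ∧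
    |w2 t - v2 t| ≤ (1 + c + A) *
      (|w t₀ - v t₀| + |w1 t₀ - v1 t₀| + (ε + ε')) * exp ((2 + 2 * c + A) * |t - t₀|) := by
  have hA := W.lip_const_nonneg
  set η := ε + ε' with hη
  have hη0 : 0 ≤ η := add_nonneg H.error_nonneg H'.error_nonneg
  have hsec : ∀ s, |w2 s - v2 s| ≤ η + c * |w1 s - v1 s| + A * |w s - v s| := fun s => by
    have e1 := abs_le.1 (H.err s)
    have e2 := abs_le.1 (H'.err s)
    have e3 := abs_le.1 (W.lip _ _ (H.bdd s) (H'.bdd s))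
    have e4 : |c * tanh s * (w1 s - v1 s)| ≤ c * |w1 s - v1 s| := by
      rw [abs_mul, abs_mul, abs_of_nonneg hc]
      have := mul_le_mul_of_nonneg_left (abs_tanh_le_one s) hc
      exact mul_le_mul_of_nonneg_right (by linarith) (abs_nonneg _)
    have e5 := abs_le.1 e4
    rw [abs_le]
    constructor <;> linarith [e1.1, e1.2, e2.1, e2.2, e3.1, e3.2, e5.1, e5.2]
  set L := 2 + 2 * c + A with hL
  set X : ℝ → ℝ := fun s => (w s - v s) ^ 2 + (w1 s - v1 s) ^ 2 + η ^ 2 with hX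
  set X' : ℝ → ℝ := fun s =>
    2 * (w s - v s) * (w1 s - v1 s) + 2 * (w1 s - v1 s) * (w2 s - v2 s) with hX'
  have hdX : ∀ s, HasDerivAt X (X' s) s := fun s => by
    have e1 := ((H.d1 s).sub (H'.d1 s)).pow 2
    have e2 := ((H.d2 s).sub (H'.d2 s)).pow 2
    exact ((e1.add e2).add_const (η ^ 2)).congr_deriv (by simp [hX'])
  have hbX : ∀ s, |X' s| ≤ L * X s := fun s => by
    have e1 : |X' s| ≤ 2 * (|w s - v s| * |w1 s - v1 s|) + 2 * (|w1 s - v1 s| * |w2 s - v2 s|) := by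
      rw [hX']
      refine (abs_add_le _ _).trans (le_of_eq ?_)
      simp only [abs_mul, abs_two]; ring
    have e2 := mul_le_mul_of_nonneg_left (hsec s) (abs_nonneg (w1 s - v1 s))
    have e3 : X s = |w s - v s| ^ 2 + |w1 s - v1 s| ^ 2 + η ^ 2 := by simp [hX, sq_abs]
    rw [e3]
    set a := |w s - v s|
    set b := |w1 s - v1 s|
    have f1 := sq_nonneg (a - b)
    have f2 := sq_nonneg (b - η)
    have f3 := mul_nonneg hA f1
    have f4 := mul_nonneg hc (sq_nonneg a)
    have f5 := mul_nonneg hc (sq_nonneg η)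
    have f6 := mul_nonneg hA (sq_nonneg η)
    rw [hL]
    nlinarith [sq_nonneg a, sq_nonneg η]
  have hgrow : X t ≤ X t₀ * exp (L * |t - t₀|) := by
    have hexp : ∀ a s : ℝ, HasDerivAt (fun s => X s * exp (a * s))
        (X' s * exp (a * s) + X s * (exp (a * s) * a)) s := fun a s =>
      (hdX s).mul (((hasDerivAt_id s).const_mul a).exp.congr_deriv (by simp))
    rcases le_total t₀ t with h | h
    · have hanti : Antitone fun s => X s * exp (-L * s) :=
        antitone_of_hasDerivAt_nonpos (fun s => hexp (-L) s) fun s => by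
          have := (abs_le.1 (hbX s)).2
          have e := exp_pos (-L * s)
          simp only [Pi.zero_apply]
          nlinarith
      have := hanti h
      simp only at this
      rw [abs_of_nonneg (sub_nonneg.2 h)]
      have e : exp (L * (t - t₀)) = exp (-L * t₀) * exp (L * t) := by rw [← exp_add]; ring_nf
      have e' : exp (-L * t) * exp (L * t) = 1 := by rw [← exp_add]; simp
      calc X t = X t * exp (-L * t) * exp (L * t) := by rw [mul_assoc, e', mul_one]
        _ ≤ X t₀ * exp (-L * t₀) * exp (L * t) :=
          mul_le_mul_of_nonneg_right this (exp_pos _).le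
        _ = _ := by rw [e]; ring
    · have hmono : Monotone fun s => X s * exp (L * s) :=
        monotone_of_hasDerivAt_nonneg (fun s => hexp L s) fun s => by
          have := (abs_le.1 (hbX s)).1
          have e := exp_pos (L * s)
          simp only [Pi.zero_apply]
          nlinarith
      have := hmono h
      simp only at this
      rw [abs_of_nonpos (sub_nonpos.2 h)]
      have e : exp (L * -(t - t₀)) = exp (L * t₀) * exp (-L * t) := by rw [← exp_add]; ring_nf
      have e' : exp (L * t) * exp (-L * t) = 1 := by rw [← exp_add]; simp
      calc X t = X t * exp (L * t) * exp (-L * t) := by rw [mul_assoc, e', mul_one]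
        _ ≤ X t₀ * exp (L * t₀) * exp (-L * t) :=
          mul_le_mul_of_nonneg_right this (exp_pos _).le
        _ = _ := by rw [e]; ring
  set r := |w t₀ - v t₀| + |w1 t₀ - v1 t₀| + η with hr
  have hr0 : 0 ≤ r := by positivity
  set E := exp (L * |t - t₀|) with hE
  have hE1 : 1 ≤ E := one_le_exp (by positivity)
  have hXr : X t ≤ (r * E) ^ 2 := by
    have e1 : X t₀ ≤ r ^ 2 := by
      have e3 : X t₀ = |w t₀ - v t₀| ^ 2 + |w1 t₀ - v1 t₀| ^ 2 + η ^ 2 := by simp [hX, sq_abs]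
      rw [e3, hr]
      have f1 := mul_nonneg (abs_nonneg (w t₀ - v t₀)) (abs_nonneg (w1 t₀ - v1 t₀))
      have f2 := mul_nonneg (abs_nonneg (w t₀ - v t₀)) hη0
      have f3 := mul_nonneg (abs_nonneg (w1 t₀ - v1 t₀)) hη0
      linarith
    calc X t ≤ X t₀ * E := hgrow
      _ ≤ r ^ 2 * E ^ 2 := by
        refine mul_le_mul e1 ?_ (by positivity) (by positivity)
        nlinarith
      _ = _ := by ring
  have hrE : 0 ≤ r * E := by positivity
  have hrr : r ≤ r * E := le_mul_of_one_le_right hr0 hE1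
  have k1 : |w t - v t| ≤ r * E :=
    abs_le_of_sq_le_sq (by nlinarith [sq_nonneg (w1 t - v1 t), sq_nonneg η]) hrE
  have k2 : |w1 t - v1 t| ≤ r * E :=
    abs_le_of_sq_le_sq (by nlinarith [sq_nonneg (w t - v t), sq_nonneg η]) hrE
  have k3 : η ≤ r * E := by
    refine le_trans ?_ hrr
    rw [hr]
    have f1 := abs_nonneg (w t₀ - v t₀)
    have f2 := abs_nonneg (w1 t₀ - v1 t₀)
    linarith
  have e1 := mul_le_mul_of_nonneg_left k1 hA
  have e2 := mul_le_mul_of_nonneg_left k2 hc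
  have e3 := mul_nonneg hc hrE
  have e4 := mul_nonneg hA hrE
  have hexpand : (1 + c + A) * r * E = r * E + c * (r * E) + A * (r * E) := by ring
  rw [hexpand]
  exact ⟨by linarith, by linarith, (hsec t).trans (by linarith)⟩

end Energy

section Layers

variable {F Φ w w1 w2 v v1 v2 : ℝ → ℝ} {A c ε : ℝ}

/-- An increasing exact solution connecting `-1` to `1`, normalized by `w 0 = 0`. -/
structure Layer (c : ℝ) (Φ w w1 w2 : ℝ → ℝ) : Prop where
  ode : ApproxODE c 0 Φ w w1 w2
  zero : w 0 = 0
  pos : ∀ t, 0 < w1 t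
  top : Tendsto w atTop (𝓝 1)
  bot : Tendsto w atBot (𝓝 (-1))

lemma Layer.w2_eq (H : Layer c Φ w w1 w2) (t : ℝ) : w2 t = Φ (w t) - c * tanh t * w1 t := by
  have := abs_nonpos_iff.1 (H.ode.err t)
  linarith

lemma Layer.mem_Ioo (H : Layer c Φ w w1 w2) (t : ℝ) : w t ∈ Ioo (-1 : ℝ) 1 := by
  have hm : StrictMono w := strictMono_of_hasDerivAt_pos H.ode.d1 H.pos
  exact ⟨(hm.monotone.le_of_tendsto H.bot (t - 1)).trans_lt (hm (by linarith)),
    (hm (by linarith : t < t + 1)).trans_le (hm.monotone.ge_of_tendsto H.top _)⟩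

lemma not_eventually_deriv_ge (hd : ∀ t, HasDerivAt w (w1 t) t) (hb : ∀ t, |w t| ≤ 1) {q : ℝ}
    (hq : 0 < q) (h : ∀ᶠ t in atTop, q ≤ w1 t) : False := by
  obtain ⟨T, hT⟩ := eventually_atTop.1 h
  have hm : MonotoneOn (fun t => w t - q * t) (Ici T) := by
    have hd' : ∀ t, HasDerivAt (fun t => w t - q * t) (w1 t - q) t := fun t =>
      ((hd t).sub ((hasDerivAt_id t).const_mul q)).congr_deriv (by simp)
    refine monotoneOn_of_deriv_nonneg (convex_Ici T)
      (fun s _ => (hd' s).continuousAt.continuousWithinAt)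
      (fun s _ => (hd' s).differentiableAt.differentiableWithinAt) fun s hs => ?_
    rw [(hd' s).deriv]
    rw [interior_Ici] at hs
    linarith [hT s (le_of_lt hs)]
  have h3 : 0 ≤ 3 / q := by positivity
  have := hm (mem_Ici.2 le_rfl) (mem_Ici.2 (by linarith : T ≤ T + 3 / q)) (by linarith)
  simp only [mul_add] at this
  rw [mul_div_cancel₀ _ hq.ne'] at this
  linarith [(abs_le.1 (hb T)).1, (abs_le.1 (hb (T + 3 / q))).2]

lemma tendsto_one_of_energy (hd : ∀ t, HasDerivAt w (w1 t) t) (hb : ∀ t, |w t| ≤ 1)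
    (hF : Continuous F) (hFpos : ∀ x ∈ Ioo (-1 : ℝ) 1, 0 < F x) (h0 : w 0 = 0)
    (hpos : ∀ t, 0 < w1 t) (hen : ∀ t, 0 ≤ w1 t ^ 2 / 2 - F (w t)) :
    Tendsto w atTop (𝓝 1) := by
  have hm : StrictMono w := strictMono_of_hasDerivAt_pos hd hpos
  have hbdd : BddAbove (range w) := ⟨1, by rintro _ ⟨t, rfl⟩; exact (abs_le.1 (hb t)).2⟩
  have hlim := tendsto_atTop_ciSup hm.monotone hbdd
  set L := ⨆ t, w t
  have hL0 : 0 ≤ L := h0 ▸ le_ciSup hbdd 0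
  have hL1 : L ≤ 1 := ciSup_le fun t => (abs_le.1 (hb t)).2
  rcases hL1.eq_or_lt with h | h
  · rwa [h] at hlim
  exfalso
  have hFL := hFpos L ⟨by linarith, h⟩
  have hFw := (hF.tendsto L).comp hlim
  refine not_eventually_deriv_ge hd hb (Real.sqrt_pos.2 hFL) ?_
  filter_upwards [hFw.eventually (lt_mem_nhds (by linarith : F L / 2 < F L))] with t ht
  simp only [Function.comp_apply] at ht
  rw [Real.sqrt_le_left (hpos t).le]
  linarith [hen t]

lemma Layer.of_energy (W : Well F Φ A) (hc : 0 ≤ c) (H : ApproxODE c 0 Φ w w1 w2)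
    (h0 : w 0 = 0) (hnn : ∀ t, 0 ≤ w1 t) (hen : ∀ t, 0 ≤ w1 t ^ 2 / 2 - F (w t)) :
    Layer c Φ w w1 w2 := by
  have hpos : ∀ t, 0 < w1 t := fun t => by
    refine lt_of_le_of_ne (hnn t) fun h => ?_
    have hF0 : F (w t) = 0 := by
      have := hen t
      rw [← h] at this
      have h2 := W.nonneg (H.bdd t)
      linarith
    have hconst : ∀ a : ℝ, |a| ≤ 1 → a ≠ 0 → Φ a = 0 → w t ≠ a := fun a ha ha0 hΦ hwa => by
      have H' : ApproxODE c 0 Φ (fun _ => a) (fun _ => 0) (fun _ => 0) :=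
        ⟨fun t => hasDerivAt_const t a, fun t => hasDerivAt_const t 0, fun _ => ha,
          fun t => by simp [hΦ]⟩
      have := (H.stability W H' hc t 0).1
      rw [hwa, ← h, h0] at this
      simp only [sub_self, abs_zero, add_zero, mul_zero, zero_mul, zero_sub, abs_neg] at this
      exact ha0 (abs_nonpos_iff.1 this)
    rcases (abs_le.1 (H.bdd t)).1.eq_or_lt with h1 | h1
    · exact hconst (-1) (by norm_num) (by norm_num) W.crit_left h1.symm
    rcases (abs_le.1 (H.bdd t)).2.eq_or_lt with h2 | h2
    · exact hconst 1 (by norm_num) (by norm_num) W.crit_right h2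
    exact (W.pos _ ⟨h1, h2⟩).ne' hF0
  have hFc : Continuous F := continuous_iff_continuousAt.2 fun x => (W.d x).continuousAt
  refine ⟨H, h0, hpos, tendsto_one_of_energy H.d1 H.bdd hFc W.pos h0 hpos hen, ?_⟩
  have := tendsto_one_of_energy (F := fun x => F (-x)) H.reflect.d1 H.reflect.bdd
    (hFc.comp continuous_neg) (fun x hx => W.pos _ ⟨by linarith [hx.2], by linarith [hx.1]⟩)
    (by simp [h0]) (fun t => hpos (-t)) (fun t => by simpa using hen (-t))
  have h2 := (this.comp tendsto_neg_atBot_atTop).neg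
  simpa [Function.comp_def] using h2

lemma pos_of_linear_deriv_ge {q q' m : ℝ → ℝ} {T : ℝ} (hT : 0 ≤ T)
    (hd : ∀ t, HasDerivAt q (q' t) t) (hm : Continuous m) (h0 : 0 < q 0)
    (h : ∀ t ∈ Ico 0 T, 0 < q t → m t * q t ≤ q' t) (hpos : ∀ t ∈ Ico 0 T, 0 < q t) : 0 < q T := by
  obtain ⟨M, hM⟩ := (isCompact_Icc (a := (0 : ℝ)) (b := T)).exists_bound_of_continuousOn
    hm.continuousOn
  have hmono : MonotoneOn (fun t => q t * exp (M * t)) (Icc 0 T) := by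
    have hd' : ∀ t, HasDerivAt (fun t => q t * exp (M * t))
        (q' t * exp (M * t) + q t * (exp (M * t) * M)) t := fun t =>
      (hd t).mul (((hasDerivAt_id t).const_mul M).exp.congr_deriv (by simp))
    refine monotoneOn_of_deriv_nonneg (convex_Icc 0 T)
      (fun s _ => (hd' s).continuousAt.continuousWithinAt)
      (fun s _ => (hd' s).differentiableAt.differentiableWithinAt) fun s hs => ?_
    rw [(hd' s).deriv]
    rw [interior_Icc] at hs
    have e1 := hpos s ⟨hs.1.le, hs.2⟩
    have e2 := h s ⟨hs.1.le, hs.2⟩ e1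
    have e3 := (abs_le.1 (hM s ⟨hs.1.le, hs.2.le⟩)).1
    have e4 : 0 ≤ q' s + M * q s := by nlinarith
    have e5 := mul_nonneg e4 (exp_pos (M * s)).le
    linarith
  have := hmono ⟨le_rfl, hT⟩ ⟨hT, le_rfl⟩ hT
  simp only [mul_zero, exp_zero, mul_one] at this
  exact pos_of_mul_pos_left (h0.trans_le this) (exp_pos _).le

/-- The change of variable matching the level sets of two layers. -/
lemma Layer.exists_matching (H : Layer c Φ w w1 w2) (H' : Layer c Φ v v1 v2) :
    ∃ σ : ℝ → ℝ, σ 0 = 0 ∧ (∀ t, v (σ t) = w t) ∧ ∀ t, HasDerivAt σ (w1 t / v1 (σ t)) t := by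
  have hsurj : ∀ {f g f1 f2 g1 g2 : ℝ → ℝ}, Layer c Φ f f1 f2 → Layer c Φ g g1 g2 →
      ∀ t, ∃ s, g s = f t := fun {f g f1 f2 g1 g2} Hf Hg t => by
    have hcont : Continuous g := continuous_iff_continuousAt.2 fun x => (Hg.ode.d1 x).continuousAt
    obtain ⟨a, ha⟩ := (Hg.bot.eventually (gt_mem_nhds (Hf.mem_Ioo t).1)).exists
    obtain ⟨b, hb⟩ := (Hg.top.eventually (lt_mem_nhds (Hf.mem_Ioo t).2)).exists
    exact mem_range_of_exists_le_of_exists_ge hcont ⟨a, ha.le⟩ ⟨b, hb.le⟩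
  choose σ hσ using hsurj H H'
  have hw : StrictMono w := strictMono_of_hasDerivAt_pos H.ode.d1 H.pos
  have hv : StrictMono v := strictMono_of_hasDerivAt_pos H'.ode.d1 H'.pos
  have hmono : StrictMono σ := fun a b hab => by
    rw [← hv.lt_iff_lt, hσ, hσ]; exact hw hab
  have hsur : Function.Surjective σ := fun s => by
    obtain ⟨t, ht⟩ := hsurj H' H s
    exact ⟨t, hv.injective (by rw [hσ, ht])⟩
  have hcont : Continuous σ := hmono.monotone.continuous_of_surjective hsur
  refine ⟨σ, hv.injective (by rw [hσ, H.zero, H'.zero]), hσ, fun t => ?_⟩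
  have h1 := hasDerivAt_iff_tendsto_slope.1 (H.ode.d1 t)
  have h2 := hasDerivAt_iff_tendsto_slope.1 (H'.ode.d1 (σ t))
  have h3 : Tendsto σ (𝓝[≠] t) (𝓝[≠] (σ t)) :=
    tendsto_nhdsWithin_iff.2 ⟨hcont.continuousAt.tendsto.mono_left nhdsWithin_le_nhds, by
      filter_upwards [self_mem_nhdsWithin] with s hs
      exact hmono.injective.ne hs⟩
  refine hasDerivAt_iff_tendsto_slope.2 ((h1.div (h2.comp h3) (H'.pos _).ne').congr' ?_)
  filter_upwards [self_mem_nhdsWithin] with s hs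
  have e1 : w s - w t ≠ 0 := sub_ne_zero.2 (hw.injective.ne hs)
  have e2 : s - t ≠ 0 := sub_ne_zero.2 hs
  have e3 : σ s - σ t ≠ 0 := sub_ne_zero.2 (hmono.injective.ne hs)
  simp only [Pi.div_apply, Function.comp_apply, slope_def_field, hσ]
  field_simp

lemma Layer.deriv_zero_le (W : Well F Φ A) (hc : 0 ≤ c) (H : Layer c Φ w w1 w2)
    (H' : Layer c Φ v v1 v2) : w1 0 ≤ v1 0 := by
  by_contra! hlt
  obtain ⟨σ, hσ0, hσ, hdσ⟩ := H.exists_matching H'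
  set q : ℝ → ℝ := fun t => w1 t - v1 (σ t) with hq
  set q' : ℝ → ℝ := fun t =>
    -(Φ (w t) / v1 (σ t)) * q t + c * (tanh (σ t) - tanh t) * w1 t with hq'
  have hdq : ∀ t, HasDerivAt q (q' t) t := fun t => by
    refine ((H.ode.d2 t).sub ((H'.ode.d2 (σ t)).comp t (hdσ t))).congr_deriv ?_
    have := (H'.pos (σ t)).ne'
    simp only [hq', hq, H.w2_eq, H'.w2_eq, hσ]
    field_simp
    ring
  have hcσ : Continuous σ := continuous_iff_continuousAt.2 fun t => (hdσ t).continuousAt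
  have hcw : Continuous w := continuous_iff_continuousAt.2 fun t => (H.ode.d1 t).continuousAt
  have hcv1 : Continuous v1 := continuous_iff_continuousAt.2 fun t => (H'.ode.d2 t).continuousAt
  have hcq : Continuous q := continuous_iff_continuousAt.2 fun t => (hdq t).continuousAt
  have hcm : Continuous fun t => -(Φ (w t) / v1 (σ t)) :=
    ((W.cont.comp hcw).div (hcv1.comp hcσ) fun t => (H'.pos _).ne').neg
  have hq0 : 0 < q 0 := by simp only [hq, hσ0]; linarith
  have hge : ∀ T, 0 ≤ T → (∀ t ∈ Ico 0 T, 0 < q t) → T ≤ σ T := fun T hT h => by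
    have hm : MonotoneOn (fun t => σ t - t) (Icc 0 T) := by
      have hd' : ∀ t, HasDerivAt (fun t => σ t - t) (w1 t / v1 (σ t) - 1) t := fun t =>
        (hdσ t).sub (hasDerivAt_id t)
      refine monotoneOn_of_deriv_nonneg (convex_Icc 0 T)
        (fun s _ => (hd' s).continuousAt.continuousWithinAt)
        (fun s _ => (hd' s).differentiableAt.differentiableWithinAt) fun s hs => ?_
      rw [(hd' s).deriv]
      rw [interior_Icc] at hs
      have e := h s ⟨hs.1.le, hs.2⟩
      rw [sub_nonneg, one_le_div (H'.pos _)]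
      simp only [hq] at e
      linarith
    have := hm ⟨le_rfl, hT⟩ ⟨hT, le_rfl⟩ hT
    simp only [hσ0] at this
    linarith
  have hfirst : ∀ T, 0 ≤ T → (∀ t ∈ Ico 0 T, 0 < q t) → 0 < q T := fun T hT h => by
    refine pos_of_linear_deriv_ge hT hdq hcm hq0 (fun t ht _ => ?_) h
    have e1 := hge t ht.1 fun s hs => h s ⟨hs.1, hs.2.trans ht.2⟩
    have e2 := sub_nonneg.2 (monotone_tanh_real e1)
    have e3 := mul_nonneg (mul_nonneg hc e2) (H.pos t).le
    simp only [hq']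
    linarith
  have hqpos : ∀ t, 0 ≤ t → 0 < q t := by
    by_contra! hex
    obtain ⟨T, hT0, hT⟩ := hex
    have hcomp : IsCompact (Icc 0 T ∩ {t | q t ≤ 0}) :=
      isCompact_Icc.inter_right (isClosed_le hcq continuous_const)
    obtain ⟨T₁, ⟨hT₁, hq1⟩, hleast⟩ := hcomp.exists_isLeast ⟨T, ⟨hT0, le_rfl⟩, hT⟩
    refine (hfirst T₁ hT₁.1 fun t ht => ?_).not_ge hq1
    by_contra! hneg
    exact ht.2.not_ge (hleast ⟨⟨ht.1, ht.2.le.trans hT₁.2⟩, hneg⟩)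
  have hσge : ∀ t, 0 ≤ t → t ≤ σ t := fun t ht => hge t ht fun s hs => hqpos s hs.1
  have hwlt : Tendsto w atTop (𝓝[<] 1) :=
    tendsto_nhdsWithin_iff.2 ⟨H.top, Eventually.of_forall fun t => (H.mem_Ioo t).2⟩
  obtain ⟨T, hT⟩ := eventually_atTop.1 ((hwlt.eventually W.nonpos).and (eventually_ge_atTop 0))
  have hT0 := (hT T le_rfl).2
  have hm : MonotoneOn q (Ici T) := by
    refine monotoneOn_of_deriv_nonneg (convex_Ici T) hcq.continuousOn
      (fun s _ => (hdq s).differentiableAt.differentiableWithinAt) fun s hs => ?_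
    rw [(hdq s).deriv]
    rw [interior_Ici] at hs
    obtain ⟨e1, e2⟩ := hT s (le_of_lt hs)
    have e3 := sub_nonneg.2 (monotone_tanh_real (hσge s e2))
    have e4 := mul_nonneg (mul_nonneg hc e3) (H.pos s).le
    have e5 := mul_nonneg (neg_nonneg.2 (div_nonpos_of_nonpos_of_nonneg e1 (H'.pos (σ s)).le))
      (hqpos s e2).le
    simp only [hq']
    linarith
  refine not_eventually_deriv_ge H.ode.d1 H.ode.bdd (hqpos T hT0) ?_
  filter_upwards [eventually_ge_atTop T] with t ht
  have := hm (mem_Ici.2 le_rfl) (mem_Ici.2 ht) ht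
  have e := (H'.pos (σ t)).le
  simp only [hq] at this ⊢
  linarith

lemma Layer.unique (W : Well F Φ A) (hc : 0 ≤ c) (H : Layer c Φ w w1 w2)
    (H' : Layer c Φ v v1 v2) : w = v := by
  have h0 := le_antisymm (H.deriv_zero_le W hc H') (H'.deriv_zero_le W hc H)
  funext t
  have := (H.ode.stability W H'.ode hc 0 t).1
  rw [h0, H.zero, H'.zero] at this
  simp only [sub_self, abs_zero, add_zero, mul_zero, zero_mul] at this
  exact sub_eq_zero.1 (abs_nonpos_iff.1 this)

end Layers

section WeightedLimits

variable {f f' : ℕ → ℝ → ℝ} {g g' : ℝ → ℝ} {L : ℝ}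

/-- Convergence on `ℝ`, uniform with respect to the weight `exp (L |t|)`. -/
def WeightedTendsto (L : ℝ) (f : ℕ → ℝ → ℝ) (g : ℝ → ℝ) : Prop :=
  ∀ ε > 0, ∀ᶠ k in atTop, ∀ t, |f k t - g t| ≤ ε * exp (L * |t|)

lemma WeightedTendsto.tendstoUniformlyOn (h : WeightedTendsto L f g) {K : Set ℝ}
    (hK : IsCompact K) : TendstoUniformlyOn f g atTop K := by
  obtain ⟨B, hB⟩ := hK.exists_bound_of_continuousOn
    (by fun_prop : Continuous fun t : ℝ => exp (L * |t|)).continuousOn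
  rw [Metric.tendstoUniformlyOn_iff]
  intro ε hε
  filter_upwards [h (ε / (2 * (|B| + 1))) (by positivity)] with k hk t ht
  rw [dist_comm, Real.dist_eq]
  have h1 : exp (L * |t|) ≤ |B| + 1 := by
    have := (le_abs_self _).trans (hB t ht)
    linarith [le_abs_self B]
  calc |f k t - g t| ≤ ε / (2 * (|B| + 1)) * exp (L * |t|) := hk t
    _ ≤ ε / (2 * (|B| + 1)) * (|B| + 1) := by gcongr
    _ = ε / 2 := by field_simp
    _ < ε := by linarith

lemma WeightedTendsto.tendsto (h : WeightedTendsto L f g) (t : ℝ) :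
    Tendsto (fun k => f k t) atTop (𝓝 (g t)) :=
  (h.tendstoUniformlyOn isCompact_singleton).tendsto_at (mem_singleton t)

lemma WeightedTendsto.hasDerivAt (h : WeightedTendsto L f g) (h' : WeightedTendsto L f' g')
    (hd : ∀ᶠ k in atTop, ∀ t, HasDerivAt (f k) (f' k t) t) (t : ℝ) : HasDerivAt g (g' t) t := by
  refine hasDerivAt_of_tendstoLocallyUniformlyOn (f := f) (f' := f') (l := atTop) isOpen_univ ?_
    (hd.mono fun k hk s _ => hk s) (fun s _ => h.tendsto s) (mem_univ t)
  rw [tendstoLocallyUniformlyOn_iff_forall_isCompact isOpen_univ]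
  exact fun K _ hK => h'.tendstoUniformlyOn hK

lemma exists_weightedTendsto
    (h : ∀ ε > 0, ∃ N, ∀ j ≥ N, ∀ k ≥ N, ∀ t, |f j t - f k t| ≤ ε * exp (L * |t|)) :
    ∃ g, WeightedTendsto L f g := by
  have hc : ∀ t, ∃ l, Tendsto (fun k => f k t) atTop (𝓝 l) := fun t => by
    refine cauchySeq_tendsto_of_complete (Metric.cauchySeq_iff.2 fun ε hε => ?_)
    obtain ⟨N, hN⟩ := h (ε / (2 * exp (L * |t|))) (by positivity)
    refine ⟨N, fun j hj k hk => ?_⟩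
    have := hN j hj k hk t
    rw [div_mul_eq_mul_div, mul_div_mul_right _ _ (exp_pos _).ne'] at this
    rw [Real.dist_eq]
    linarith
  choose g hg using hc
  refine ⟨g, fun ε hε => ?_⟩
  obtain ⟨N, hN⟩ := h ε hε
  filter_upwards [eventually_ge_atTop N] with k hk t
  refine le_of_tendsto (((hg t).const_sub (f k t)).abs) ?_
  filter_upwards [eventually_ge_atTop N] with j hj using hN k hk j hj t

end WeightedLimits

section LayerSequences

variable {F Φ : ℝ → ℝ} {w w1 w2 : ℕ → ℝ → ℝ} {A c : ℝ}

/-- A sequence of increasing normalized layers solving the limit equation asymptotically. -/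
structure LayerSeq (c : ℝ) (Φ : ℝ → ℝ) (w w1 w2 : ℕ → ℝ → ℝ) : Prop where
  approx : ∀ ε > 0, ∀ᶠ k in atTop, ApproxODE c ε Φ (w k) (w1 k) (w2 k)
  zero : ∀ k, w k 0 = 0
  pos : ∀ k t, 0 < w1 k t
  top : ∀ k, Tendsto (w k) atTop (𝓝 1)
  bot : ∀ k, Tendsto (w k) atBot (𝓝 (-1))

lemma LayerSeq.comp (H : LayerSeq c Φ w w1 w2) {m : ℕ → ℕ} (hm : Tendsto m atTop atTop) :
    LayerSeq c Φ (fun k => w (m k)) (fun k => w1 (m k)) (fun k => w2 (m k)) :=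
  ⟨fun ε hε => hm.eventually (H.approx ε hε), fun k => H.zero (m k), fun k => H.pos (m k),
    fun k => H.top (m k), fun k => H.bot (m k)⟩

lemma LayerSeq.exists_limit (W : Well F Φ A) (hc : 0 ≤ c) (H : LayerSeq c Φ w w1 w2) {p : ℝ}
    (hp : Tendsto (fun k => w1 k 0) atTop (𝓝 p)) : ∃ v v1 v2, Layer c Φ v v1 v2 ∧ v1 0 = p := by
  have hA := W.lip_const_nonneg
  set M := 1 + c + A with hM
  have hM0 : 0 < M := by positivity
  set L := 2 + 2 * c + A with hL
  have hcau : ∀ ε > 0, ∃ N, ∀ j ≥ N, ∀ k ≥ N, ∀ t,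
      |w j t - w k t| ≤ ε * exp (L * |t|) ∧ |w1 j t - w1 k t| ≤ ε * exp (L * |t|) ∧
      |w2 j t - w2 k t| ≤ ε * exp (L * |t|) := fun ε hε => by
    obtain ⟨N1, hN1⟩ := Metric.cauchySeq_iff.1 hp.cauchySeq (ε / (2 * M)) (by positivity)
    obtain ⟨N2, hN2⟩ := eventually_atTop.1 (H.approx (ε / (4 * M)) (by positivity))
    refine ⟨max N1 N2, fun j hj k hk t => ?_⟩
    have hst := (hN2 j (le_of_max_le_right hj)).stability W (hN2 k (le_of_max_le_right hk)) hc 0 t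
    have h1 := hN1 j (le_of_max_le_left hj) k (le_of_max_le_left hk)
    rw [Real.dist_eq] at h1
    rw [H.zero, H.zero, sub_self, abs_zero, zero_add, sub_zero, ← hM, ← hL] at hst
    have hle : M * (|w1 j 0 - w1 k 0| + (ε / (4 * M) + ε / (4 * M))) ≤ ε := by
      calc _ ≤ M * (ε / (2 * M) + (ε / (4 * M) + ε / (4 * M))) := by gcongr
        _ = ε := by field_simp; norm_num
    have hle2 := mul_le_mul_of_nonneg_right hle (exp_pos (L * |t|)).le
    exact ⟨hst.1.trans hle2, hst.2.1.trans hle2, hst.2.2.trans hle2⟩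
  obtain ⟨v, hv⟩ := exists_weightedTendsto (f := w) (L := L) fun ε hε => by
    obtain ⟨N, hN⟩ := hcau ε hε
    exact ⟨N, fun j hj k hk t => (hN j hj k hk t).1⟩
  obtain ⟨v1, hv1⟩ := exists_weightedTendsto (f := w1) (L := L) fun ε hε => by
    obtain ⟨N, hN⟩ := hcau ε hε
    exact ⟨N, fun j hj k hk t => (hN j hj k hk t).2.1⟩
  obtain ⟨v2, hv2⟩ := exists_weightedTendsto (f := w2) (L := L) fun ε hε => by
    obtain ⟨N, hN⟩ := hcau ε hε
    exact ⟨N, fun j hj k hk t => (hN j hj k hk t).2.2⟩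
  have hex := H.approx 1 one_pos
  have hode : ApproxODE c 0 Φ v v1 v2 := by
    refine ⟨fun t => hv.hasDerivAt hv1 (hex.mono fun k hk => hk.d1) t,
      fun t => hv1.hasDerivAt hv2 (hex.mono fun k hk => hk.d2) t,
      fun t => le_of_tendsto (hv.tendsto t).abs (hex.mono fun k hk => hk.bdd t), fun t => ?_⟩
    have hlim := (((hv2.tendsto t).add ((hv1.tendsto t).const_mul (c * tanh t))).sub
      ((W.cont.tendsto _).comp (hv.tendsto t))).abs
    refine le_of_forall_pos_le_add fun ε hε => ?_
    rw [zero_add]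
    exact le_of_tendsto hlim ((H.approx ε hε).mono fun k hk => hk.err t)
  have hFc : Continuous F := continuous_iff_continuousAt.2 fun x => (W.d x).continuousAt
  have hv0 : v 0 = 0 :=
    tendsto_nhds_unique (hv.tendsto 0) (by simp only [H.zero]; exact tendsto_const_nhds)
  refine ⟨v, v1, v2, Layer.of_energy W hc hode hv0
    (fun t => ge_of_tendsto' (hv1.tendsto t) fun k => (H.pos k t).le) (fun t => ?_),
    tendsto_nhds_unique (hv1.tendsto 0) hp⟩
  have hlim := (((hv1.tendsto t).pow 2).div_const 2).sub ((hFc.tendsto _).comp (hv.tendsto t))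
  refine le_of_forall_pos_le_add fun ε hε => ?_
  have := ge_of_tendsto hlim ((H.approx (ε / 2) (by positivity)).mono fun k hk =>
    hk.energy_ge W hc (H.pos k) (H.top k) (H.bot k) t)
  linarith

lemma LayerSeq.exists_layer_tendsto (W : Well F Φ A) (hc : 0 ≤ c) (H : LayerSeq c Φ w w1 w2)
    {K : ℝ} (hK : ∀ᶠ k in atTop, |w1 k 0| ≤ K) :
    ∃ L v v1 v2, Layer c Φ v v1 v2 ∧ WeightedTendsto L w v ∧ WeightedTendsto L w1 v1 ∧
      WeightedTendsto L w2 v2 := by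
  have hA := W.lip_const_nonneg
  have hsub : ∀ m : ℕ → ℕ, Tendsto m atTop atTop → ∃ r : ℕ → ℕ, Tendsto r atTop atTop ∧
      ∃ v v1 v2, Layer c Φ v v1 v2 ∧ Tendsto (fun k => w1 (m (r k)) 0) atTop (𝓝 (v1 0)) :=
    fun m hm => by
    obtain ⟨p, -, r, hr, hp⟩ := tendsto_subseq_of_frequently_bounded
      (Metric.isBounded_Icc (-K) K) ((hm.eventually hK).mono fun k hk => abs_le.1 hk).frequently
    obtain ⟨v, v1, v2, hv, hv1⟩ := (H.comp (hm.comp hr.tendsto_atTop)).exists_limit W hc hp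
    exact ⟨r, hr.tendsto_atTop, v, v1, v2, hv, by rw [hv1]; exact hp⟩
  obtain ⟨-, -, v, v1, v2, hv, -⟩ := hsub id tendsto_id
  have hp : Tendsto (fun k => w1 k 0) atTop (𝓝 (v1 0)) := tendsto_of_subseq_tendsto fun m hm => by
    obtain ⟨r, -, f, f1, f2, hf, hfp⟩ := hsub m hm
    have : f1 0 = v1 0 := le_antisymm (hf.deriv_zero_le W hc hv) (hv.deriv_zero_le W hc hf)
    exact ⟨r, this ▸ hfp⟩
  have hM0 : 0 < 1 + c + A := by positivity
  have key : ∀ ε > 0, ∀ᶠ k in atTop, ∀ t,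
      |w k t - v t| ≤ ε * exp ((2 + 2 * c + A) * |t|) ∧
      |w1 k t - v1 t| ≤ ε * exp ((2 + 2 * c + A) * |t|) ∧
      |w2 k t - v2 t| ≤ ε * exp ((2 + 2 * c + A) * |t|) := fun ε hε => by
    filter_upwards [H.approx (ε / (2 * (1 + c + A))) (by positivity),
      Metric.tendsto_nhds.1 hp (ε / (2 * (1 + c + A))) (by positivity)] with k h1 h2 t
    have hst := h1.stability W hv.ode hc 0 t
    rw [Real.dist_eq] at h2
    rw [H.zero, hv.zero, sub_self, abs_zero, zero_add, sub_zero, add_zero] at hst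
    have hle : (1 + c + A) * (|w1 k 0 - v1 0| + ε / (2 * (1 + c + A))) ≤ ε := by
      calc _ ≤ (1 + c + A) * (ε / (2 * (1 + c + A)) + ε / (2 * (1 + c + A))) := by gcongr
        _ = ε := by field_simp; norm_num
    have hle2 := mul_le_mul_of_nonneg_right hle (exp_pos ((2 + 2 * c + A) * |t|)).le
    exact ⟨hst.1.trans hle2, hst.2.1.trans hle2, hst.2.2.trans hle2⟩
  exact ⟨_, v, v1, v2, hv, fun ε hε => (key ε hε).mono fun k hk t => (hk t).1,
    fun ε hε => (key ε hε).mono fun k hk t => (hk t).2.1,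
    fun ε hε => (key ε hε).mono fun k hk t => (hk t).2.2⟩

end LayerSequences

section Assembly

lemma DoubleWell.exists_well {F : ℝ → ℝ} (hF : DoubleWell F) : ∃ A, Well F (deriv F) A := by
  obtain ⟨φ1, φ2, φ3, A, B, C, hφ⟩ := hF.exists_reactionBounds
  obtain ⟨hsm, hl, hr, hpos, hl', hr', -, hr2⟩ := hF
  refine ⟨A, fun x => (hsm.differentiable (by simp) x).hasDerivAt,
    continuous_iff_continuousAt.2 fun x => (hφ.d1 x).continuousAt, fun x y hx hy => ?_, hpos, hl,
    hr, hl', hr', ?_⟩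
  · have := (convex_Icc (-1 : ℝ) 1).norm_image_sub_le_of_norm_hasDerivWithin_le
      (fun z _ => (hφ.d1 z).hasDerivWithinAt) (fun z hz => hφ.b1 z (abs_le.2 hz))
      (abs_le.1 hy) (abs_le.1 hx)
    exact this
  · have hs := hasDerivAt_iff_tendsto_slope.1 (hφ.d1 1)
    have h2 : φ1 1 = iteratedDeriv 2 F 1 := by
      rw [← (hφ.d1 1).deriv, iteratedDeriv_succ, iteratedDeriv_one]
    rw [h2] at hs
    have hle : 𝓝[<] (1 : ℝ) ≤ 𝓝[≠] 1 := nhdsWithin_mono _ fun x hx => ne_of_lt hx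
    filter_upwards [(hs.mono_left hle).eventually (lt_mem_nhds hr2), self_mem_nhdsWithin]
      with x hx hx1
    have hx1 : x < 1 := hx1
    rw [slope_def_field, hr', sub_zero] at hx
    by_contra! hneg
    exact (div_neg_of_pos_of_neg hneg (sub_neg.2 hx1)).not_gt hx

lemma Layer.of_contDiff {c : ℝ} {Φ w : ℝ → ℝ} (hw : ContDiff ℝ 2 w)
    (heq : ∀ t, -(deriv (deriv w) t) - c * tanh t * deriv w t = -(Φ (w t))) (h0 : w 0 = 0)
    (hpos : ∀ t, 0 < deriv w t) (htop : Tendsto w atTop (𝓝 1)) (hbot : Tendsto w atBot (𝓝 (-1))) :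
    Layer c Φ w (deriv w) (deriv (deriv w)) := by
  have hm : Monotone w := monotone_of_deriv_nonneg (hw.differentiable two_ne_zero)
    fun t => (hpos t).le
  have hw2 : ContDiff ℝ (1 + 1) w := hw
  have hw1 : ContDiff ℝ 1 (deriv w) := (contDiff_succ_iff_deriv.1 hw2).2.2
  refine ⟨⟨fun t => (hw.differentiable two_ne_zero t).hasDerivAt,
    fun t => (hw1.differentiable one_ne_zero t).hasDerivAt,
    fun t => abs_le.2 ⟨hm.le_of_tendsto hbot t, hm.ge_of_tendsto htop t⟩, fun t => ?_⟩,
    h0, hpos, htop, hbot⟩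
  have : deriv (deriv w) t + c * tanh t * deriv w t - Φ (w t) = 0 := by linarith [heq t]
  rw [this, abs_zero]

lemma Layer.contDiff {c : ℝ} {Φ w w1 w2 : ℝ → ℝ} (hΦ : Continuous Φ) (H : Layer c Φ w w1 w2) :
    ContDiff ℝ 2 w := by
  have e1 : deriv w = w1 := funext fun t => (H.ode.d1 t).deriv
  have e2 : deriv w1 = w2 := funext fun t => (H.ode.d2 t).deriv
  have hcw : Continuous w := continuous_iff_continuousAt.2 fun t => (H.ode.d1 t).continuousAt
  have hcw1 : Continuous w1 := continuous_iff_continuousAt.2 fun t => (H.ode.d2 t).continuousAt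
  have hct : Continuous Real.tanh :=
    continuous_iff_continuousAt.2 fun t => (hasDerivAt_tanh_real t).continuousAt
  have hcw2 : Continuous w2 := by
    rw [show w2 = fun t => Φ (w t) - c * tanh t * w1 t from funext H.w2_eq]
    fun_prop
  have h1 : ContDiff ℝ 1 w1 :=
    contDiff_one_iff_deriv.2 ⟨fun t => (H.ode.d2 t).differentiableAt, by rwa [e2]⟩
  have : ContDiff ℝ (1 + 1) w := contDiff_succ_iff_deriv.2
    ⟨fun t => (H.ode.d1 t).differentiableAt, by simp, by rwa [e1]⟩
  exact this

end Assembly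

/-- Convergence of layer solutions as `γ_k ↑ 1`: the traces `w_k = u_k(·,0)` converge in
`C²` uniformly on compact sets to the unique layer solution `w̄` of
`-w̄'' - (n-1) tanh t · w̄' = f(w̄)` with `w̄(0) = 0`, `w̄' > 0` and `w̄(±∞) = ±1`. -/
theorem stmt11 (n : ℕ) (hn : 2 ≤ n) (F : ℝ → ℝ) (hF : DoubleWell F)
    (γ : ℕ → ℝ) (hγ : ∀ k, γ k ∈ Set.Ioo (0:ℝ) 1) (hγ1 : Tendsto γ atTop (𝓝 1))
    (u : ℕ → ℝ → ℝ → ℝ)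
    (hbdd : ∀ k, ∀ t y : ℝ, 0 ≤ y → |u k t y| < 1)
    (hcont : ∀ k, ContinuousOn (fun p : ℝ × ℝ => u k p.1 p.2) {p : ℝ × ℝ | 0 ≤ p.2})
    (hsm : ∀ k, ContDiffOn ℝ 2 (fun p : ℝ × ℝ => u k p.1 p.2) {p : ℝ × ℝ | 0 < p.2})
    (heq : ∀ k, ∀ t y : ℝ, 0 < y → Ha n (1 - 2 * γ k) (u k) t y = 0)
    (hptc : ∀ k, ContinuousOn (fun p : ℝ × ℝ => pt (u k) p.1 p.2) {p : ℝ × ℝ | 0 ≤ p.2})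
    (hbc : ∀ k, ∀ t : ℝ, Tendsto (fun y : ℝ => y ^ (1 - 2 * γ k) * py (u k) t y)
      (𝓝[>] (0:ℝ)) (𝓝 ((1 / dgamma (γ k)) * deriv F (u k t 0))))
    (hmono : ∀ k, ∀ t : ℝ, 0 < pt (u k) t 0)
    (hlimp : ∀ k, Tendsto (fun t => u k t 0) atTop (𝓝 1))
    (hlimm : ∀ k, Tendsto (fun t => u k t 0) atBot (𝓝 (-1)))
    (hzero : ∀ k, u k 0 0 = 0) :
    ∃ wbar : ℝ → ℝ,
      (∃ M : ℝ, ∀ t : ℝ, |wbar t| ≤ M) ∧ ContDiff ℝ 2 wbar ∧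
      (∀ t : ℝ, -(deriv (deriv wbar) t) - ((n : ℝ) - 1) * Real.tanh t * deriv wbar t
        = -(deriv F (wbar t))) ∧
      wbar 0 = 0 ∧ (∀ t : ℝ, 0 < deriv wbar t) ∧
      Tendsto wbar atTop (𝓝 1) ∧ Tendsto wbar atBot (𝓝 (-1)) ∧
      (∀ w' : ℝ → ℝ, (∃ M : ℝ, ∀ t : ℝ, |w' t| ≤ M) → ContDiff ℝ 2 w' →
        (∀ t : ℝ, -(deriv (deriv w') t) - ((n : ℝ) - 1) * Real.tanh t * deriv w' t
          = -(deriv F (w' t))) →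
        w' 0 = 0 → (∀ t : ℝ, 0 < deriv w' t) →
        Tendsto w' atTop (𝓝 1) → Tendsto w' atBot (𝓝 (-1)) → w' = wbar) ∧
      (∀ K : Set ℝ, IsCompact K →
        TendstoUniformlyOn (fun k t => u k t 0) wbar atTop K ∧
        TendstoUniformlyOn (fun k t => deriv (fun s => u k s 0) t) (deriv wbar) atTop K ∧
        TendstoUniformlyOn (fun k t => deriv (deriv (fun s => u k s 0)) t)
          (deriv (deriv wbar)) atTop K) := by
  obtain ⟨A, W⟩ := hF.exists_well
  have hc : (0 : ℝ) ≤ (n : ℝ) - 1 := by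
    have : (2 : ℝ) ≤ n := by exact_mod_cast hn
    linarith
  obtain ⟨K, hK⟩ := exists_eventually_approxODE hn hF hγ hγ1 hbdd hcont hsm heq hbc
  have hseq : LayerSeq ((n : ℝ) - 1) (deriv F) (fun k t => u k t 0)
      (fun k => deriv fun s => u k s 0) (fun k => deriv (deriv fun s => u k s 0)) :=
    ⟨fun ε hε => (hK ε hε).mono fun k hk => hk.1, hzero, hmono, hlimp, hlimm⟩
  obtain ⟨L, v, v1, v2, hv, hw0, hw1, hw2⟩ :=
    hseq.exists_layer_tendsto W hc ((hK 1 one_pos).mono fun k hk => hk.2 0)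
  have e1 : deriv v = v1 := funext fun t => (hv.ode.d1 t).deriv
  have e2 : deriv v1 = v2 := funext fun t => (hv.ode.d2 t).deriv
  refine ⟨v, ⟨1, hv.ode.bdd⟩, hv.contDiff W.cont, fun t => ?_, hv.zero, ?_, hv.top, hv.bot,
    fun f _ hf hode hf0 hf1 htop hbot =>
      (Layer.of_contDiff hf hode hf0 hf1 htop hbot).unique W hc hv, fun S hS => ?_⟩
  · rw [e1, e2, hv.w2_eq]; ring
  · rw [e1]; exact hv.pos
  · rw [e1, e2]
    exact ⟨hw0.tendstoUniformlyOn hS, hw1.tendstoUniformlyOn hS, hw2.tendstoUniformlyOn hS⟩
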